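/- arXiv:1801.08765 — 2 statements merged into one kernel-verified Lean document; each statement's English description precedes it below -/
import Mathlib

section
/- (Equivalence of real Schanuel and real uniform Schanuel). The following two statements are equivalent. (SC_ℝ): for every n and all real numbers a₁,…,aₙ that are linearly independent over ℚ, trdeg_ℚ(a₁, exp a₁, …, aₙ, exp aₙ) ≥ n. (USC_ℝ): for every n and every ideal I of ℚ[X₁,…,X_{2n}] such that the Krull dimension of the quotient ring ℚ[X₁,…,X_{2n}]/I is strictly less than n, there exists a finite set M of nonzero elements of ℤⁿ such that for all real numbers a₁,…,aₙ, if every polynomial in I vanishes at the point (a₁, exp a₁, a₂, exp a₂, …, aₙ, exp aₙ), then there is (m₁,…,mₙ) ∈ M with Σᵢ mᵢ aᵢ = 0. -/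
set_option maxHeartbeats 1000000
set_option synthInstance.maxHeartbeats 400000

/-- Transcendence degree of an algebra extension. -/
noncomputable def trdeg (F E : Type*) [CommRing F] [CommRing E] [Algebra F E] : Cardinal :=
  ⨆ s : { s : Set E // AlgebraicIndependent F ((↑) : s → E) }, Cardinal.mk s.1

/-- The real Schanuel conjecture (SC_ℝ): for all `ℚ`-linearly independent real
numbers `a₁,…,aₙ`, `trdeg_ℚ(a₁, exp a₁, …, aₙ, exp aₙ) ≥ n`. -/
def RealSchanuel : Prop :=
  ∀ (n : ℕ) (a : Fin n → ℝ), LinearIndependent ℚ a →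
    (n : Cardinal) ≤ trdeg ℚ (IntermediateField.adjoin ℚ
      (Set.range a ∪ Set.range fun i => Real.exp (a i)))

/-- The point `(a₁, exp a₁, a₂, exp a₂, …, aₙ, exp aₙ) ∈ ℝ^{2n}`. -/
noncomputable def expPoint {n : ℕ} (a : Fin n → ℝ) : Fin (2 * n) → ℝ :=
  fun j =>
    if j.val % 2 = 0 then a ⟨j.val / 2, by have := j.isLt; omega⟩
    else Real.exp (a ⟨j.val / 2, by have := j.isLt; omega⟩)

/-- The real uniform Schanuel conjecture (USC_ℝ): for every ideal `I` of
`ℚ[X₁,…,X_{2n}]` whose quotient has Krull dimension less than `n`, there is a finite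
set `M` of nonzero integer vectors such that whenever all polynomials of `I` vanish at
`(a₁, exp a₁, …, aₙ, exp aₙ)` there is `(m₁,…,mₙ) ∈ M` with `∑ mᵢ aᵢ = 0`. -/
def RealUniformSchanuel : Prop :=
  ∀ (n : ℕ) (I : Ideal (MvPolynomial (Fin (2 * n)) ℚ)),
    ringKrullDim (MvPolynomial (Fin (2 * n)) ℚ ⧸ I) < n →
    ∃ M : Finset (Fin n → ℤ), (∀ m ∈ M, m ≠ 0) ∧
      ∀ a : Fin n → ℝ,
        (∀ p ∈ I, MvPolynomial.aeval (expPoint a) p = 0) →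
        ∃ m ∈ M, (∑ i, m i • a i) = 0

section RealVarieties

open Set Filter Topology

/-- A set that is the union of finitely many preconnected sets. -/
def IsFiniteUnionPreconnected {Z : Type*} [TopologicalSpace Z] (W : Set Z) : Prop :=
  ∃ 𝒞 : Set (Set Z), 𝒞.Finite ∧ (∀ C ∈ 𝒞, IsPreconnected C) ∧ ⋃₀ 𝒞 = W

namespace IsFiniteUnionPreconnected

variable {Z : Type*} [TopologicalSpace Z] {W W₁ W₂ : Set Z}

theorem union (h₁ : IsFiniteUnionPreconnected W₁) (h₂ : IsFiniteUnionPreconnected W₂) :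
    IsFiniteUnionPreconnected (W₁ ∪ W₂) := by
  obtain ⟨𝒞₁, f₁, c₁, rfl⟩ := h₁
  obtain ⟨𝒞₂, f₂, c₂, rfl⟩ := h₂
  exact ⟨𝒞₁ ∪ 𝒞₂, f₁.union f₂, fun C hC => hC.elim (c₁ C) (c₂ C), sUnion_union _ _⟩

theorem of_finite (h : W.Finite) : IsFiniteUnionPreconnected W := by
  refine ⟨(fun x => {x}) '' W, h.image _, ?_, ?_⟩
  · rintro _ ⟨x, -, rfl⟩
    exact isPreconnected_singleton
  · simp

/-- If `W₁ ⊆ W` meets every connected component of `W` and is a finite union of preconnected sets,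
then so is `W`. -/
theorem of_meets_components (h : IsFiniteUnionPreconnected W₁) (hsub : W₁ ⊆ W)
    (hmeet : ∀ x ∈ W, (connectedComponentIn W x ∩ W₁).Nonempty) :
    IsFiniteUnionPreconnected W := by
  obtain ⟨𝒞, fin, pre, rfl⟩ := h
  refine ⟨connectedComponentIn W '' W, ?_, ?_, ?_⟩
  · have key : ∀ K ∈ connectedComponentIn W '' W, ∃ C ∈ 𝒞, C.Nonempty ∧ C ⊆ K := by
      rintro _ ⟨x, hx, rfl⟩
      obtain ⟨y, hy, C, hC, hyC⟩ := hmeet x hx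
      refine ⟨C, hC, ⟨y, hyC⟩, ?_⟩
      rw [connectedComponentIn_eq hy]
      exact (pre C hC).subset_connectedComponentIn hyC ((subset_sUnion_of_mem hC).trans hsub)
    choose! c hc hne hsubc using key
    refine Finite.of_finite_image (f := c) (fin.subset ?_) ?_
    · rintro _ ⟨K, hK, rfl⟩
      exact hc K hK
    · intro K hK K' hK' e
      obtain ⟨z, hz⟩ := hne K hK
      have h1 := hsubc K hK hz
      have h2 := hsubc K' hK' (e ▸ hz)
      obtain ⟨x, -, rfl⟩ := hK
      obtain ⟨x', -, rfl⟩ := hK'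
      rw [connectedComponentIn_eq h1, connectedComponentIn_eq h2]
  · rintro _ ⟨x, -, rfl⟩
    exact isPreconnected_connectedComponentIn
  · apply Subset.antisymm
    · rintro y ⟨_, ⟨x, -, rfl⟩, hy⟩
      exact connectedComponentIn_subset _ _ hy
    · intro x hx
      exact ⟨_, ⟨x, hx, rfl⟩, mem_connectedComponentIn hx⟩

theorem finite_fiber {Y : Type*} {u : Z → Y} (h : IsFiniteUnionPreconnected W)
    (hu : ∀ C ⊆ W, IsPreconnected C → InjOn u C) (c : Y) : (W ∩ u ⁻¹' {c}).Finite := by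
  obtain ⟨𝒞, fin, pre, rfl⟩ := h
  rw [sUnion_eq_biUnion, iUnion₂_inter]
  refine fin.biUnion fun C hC => Set.Subsingleton.finite ?_
  rintro x ⟨hx, hxc⟩ y ⟨hy, hyc⟩
  exact hu C (subset_sUnion_of_mem hC) (pre C hC) hx hy (hxc.trans hyc.symm)

/-- If `W` is a finite union of preconnected sets and a family of relatively clopen subsets has
dense union in `W`, then finitely many of them cover `W`. -/
theorem exists_finite_cover {ι : Type*} (h : IsFiniteUnionPreconnected W) {Y : ι → Set W}
    (hY : ∀ i, IsClopen (Y i)) (hd : Dense (⋃ i, Y i)) : ∃ t : Finset ι, ⋃ i ∈ t, Y i = univ := by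
  classical
  obtain ⟨𝒞, fin, pre, hW⟩ := h
  have key : ∀ C ∈ 𝒞, ∃ t : Finset ι, ∀ i, ∀ y ∈ Y i, y.1 ∈ C → y ∈ ⋃ i ∈ t, Y i := by
    intro C hC
    by_cases hne : ∃ i, ∃ y ∈ Y i, y.1 ∈ C
    · obtain ⟨i, y, hy, hyC⟩ := hne
      refine ⟨{i}, fun j z _ hzC => ?_⟩
      have hCW : C ⊆ W := hW ▸ subset_sUnion_of_mem hC
      have hpre : IsPreconnected (Subtype.val ⁻¹' C : Set W) := by
        rw [← IsInducing.subtypeVal.isPreconnected_image, Subtype.image_preimage_coe,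
          inter_eq_right.mpr hCW]
        exact pre C hC
      simpa using hpre.subset_isClopen (hY i) ⟨y, hyC, hy⟩ hzC
    · push Not at hne
      exact ⟨∅, fun i y hy hyC => absurd hyC (hne i y hy)⟩
  choose! t ht using key
  refine ⟨fin.toFinset.biUnion t, ?_⟩
  have hcl : IsClosed (⋃ i ∈ fin.toFinset.biUnion t, Y i) :=
    isClosed_biUnion_finset fun i _ => (hY i).1
  have hsub : (⋃ i, Y i) ⊆ ⋃ i ∈ fin.toFinset.biUnion t, Y i := by
    intro y hy
    obtain ⟨i, hi⟩ := mem_iUnion.mp hy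
    obtain ⟨C, hC, hyC⟩ : y.1 ∈ ⋃₀ 𝒞 := hW.symm ▸ y.2
    obtain ⟨j, hj, hyj⟩ := mem_iUnion₂.mp (ht C hC i y hi hyC)
    exact mem_iUnion₂.mpr ⟨j, Finset.mem_biUnion.mpr ⟨C, by simpa using hC, hj⟩, hyj⟩
  exact eq_univ_of_univ_subset (hd.closure_eq ▸ hcl.closure_subset_iff.mpr hsub)

end IsFiniteUnionPreconnected

theorem IsOpenMap.isLocalHomeomorph_of_isLocallyInjective {Z Y : Type*} [TopologicalSpace Z]
    [TopologicalSpace Y] {u : Z → Y} (ho : IsOpenMap u) (hc : Continuous u)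
    (hi : IsLocallyInjective u) : IsLocalHomeomorph u := by
  rw [isLocalHomeomorph_iff_isOpenEmbedding_restrict]
  intro x
  obtain ⟨U, hU, hx, inj⟩ := hi x
  refine ⟨U, hU.mem_nhds hx, ?_⟩
  exact .of_continuous_injective_isOpenMap (hc.comp continuous_subtype_val)
    (injOn_iff_injective.mp inj) (ho.domRestrict hU)

theorem IsLocalHomeomorph.exists_isOpen_isPreconnected_injOn {Z : Type*} [TopologicalSpace Z]
    {u : Z → ℝ} (hu : IsLocalHomeomorph u) (x : Z) :
    ∃ N : Set Z, x ∈ N ∧ IsOpen N ∧ IsPreconnected N ∧ InjOn u N := by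
  obtain ⟨e, hx, rfl⟩ := hu x
  obtain ⟨r, hr, hball⟩ := Metric.isOpen_iff.mp e.open_target (e x) (e.map_source hx)
  refine ⟨e.symm '' Metric.ball (e x) r, ⟨e x, Metric.mem_ball_self hr, e.left_inv hx⟩,
    e.symm.isOpen_image_of_subset_source Metric.isOpen_ball hball, ?_, ?_⟩
  · rw [Real.ball_eq_Ioo] at *
    exact isPreconnected_Ioo.image _ (e.continuousOn_symm.mono hball)
  · refine e.injOn.mono ?_
    rintro _ ⟨y, hy, rfl⟩
    exact e.map_target (hball hy)

theorem IsLocalHomeomorph.injOn_union {Z : Type*} [TopologicalSpace Z] [T2Space Z]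
    {u : Z → ℝ} (hu : IsLocalHomeomorph u) {G N : Set Z} (hG : IsOpen G) (hN : IsOpen N)
    (cG : IsPreconnected G) (cN : IsPreconnected N) (iG : InjOn u G) (iN : InjOn u N)
    (hne : (G ∩ N).Nonempty) : InjOn u (G ∪ N) := by
  obtain ⟨x, hxG, hxN⟩ := hne
  have : Nonempty Z := ⟨x⟩
  have hI : IsPreconnected (u '' G ∩ u '' N) :=
    ((cG.image u hu.continuous.continuousOn).ordConnected.inter
      (cN.image u hu.continuous.continuousOn).ordConnected).isPreconnected
  have sec : ∀ {A : Set Z}, IsOpen A → InjOn u A →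
      ContinuousOn (Function.invFunOn u A) (u '' A) := fun hA iA =>
    (hu.isOpenMap.domRestrict hA).continuousOn_image_of_leftInvOn iA.leftInvOn_invFunOn
  have key : EqOn (Function.invFunOn u G) (Function.invFunOn u N) (u '' G ∩ u '' N) := by
    refine (T2Space.isSeparatedMap u).eqOn_of_comp_eqOn hu.isLocallyInjective hI
      ((sec hG iG).mono inter_subset_left) ((sec hN iN).mono inter_subset_right) ?_
      (a := u x) ⟨mem_image_of_mem u hxG, mem_image_of_mem u hxN⟩ ?_
    · rintro y ⟨h1, h2⟩
      simp only [Function.comp]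
      rw [Function.invFunOn_eq h1, Function.invFunOn_eq h2]
    · rw [iG.leftInvOn_invFunOn hxG, iN.leftInvOn_invFunOn hxN]
  have cross : ∀ a ∈ G, ∀ b ∈ N, u a = u b → a = b := by
    intro a ha b hb hab
    have := key ⟨mem_image_of_mem u ha, hab ▸ mem_image_of_mem u hb⟩
    rwa [iG.leftInvOn_invFunOn ha, hab, iN.leftInvOn_invFunOn hb] at this
  rintro a (ha | ha) b (hb | hb) hab
  · exact iG ha hb hab
  · exact cross a ha b hb hab
  · exact (cross b hb a ha hab.symm).symm
  · exact iN ha hb hab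

/-- A local homeomorphism from a Hausdorff space to `ℝ` is injective on preconnected sets. -/
theorem IsLocalHomeomorph.injOn_of_isPreconnected {Z : Type*} [TopologicalSpace Z] [T2Space Z]
    {u : Z → ℝ} (hu : IsLocalHomeomorph u) {C : Set Z} (hC : IsPreconnected C) : InjOn u C := by
  intro p hp q hq hpq
  let 𝒢 : Set (Set Z) := {G | p ∈ G ∧ IsOpen G ∧ IsPreconnected G ∧ InjOn u G}
  obtain ⟨N₀, hN₀⟩ := hu.exists_isOpen_isPreconnected_injOn p
  obtain ⟨G, -, hmax⟩ := zorn_subset_nonempty 𝒢 (fun c hc hchain hne => by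
    refine ⟨⋃₀ c, ⟨?_, ?_, ?_, ?_⟩, fun s hs => subset_sUnion_of_mem hs⟩
    · obtain ⟨s, hs⟩ := hne
      exact ⟨s, hs, (hc hs).1⟩
    · exact isOpen_sUnion fun s hs => (hc hs).2.1
    · exact isPreconnected_sUnion p _ (fun s hs => (hc hs).1) fun s hs => (hc hs).2.2.1
    · rintro a ⟨s, hs, has⟩ b ⟨t, ht, hbt⟩ hab
      rcases hchain.total hs ht with h | h
      · exact (hc ht).2.2.2 (h has) hbt hab
      · exact (hc hs).2.2.2 has (h hbt) hab) N₀ hN₀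
  obtain ⟨hpG, oG, cG, iG⟩ := hmax.prop
  have hclosed : IsClosed G := by
    refine isClosed_of_closure_subset fun z hz => ?_
    obtain ⟨N, hzN, oN, cN, iN⟩ := hu.exists_isOpen_isPreconnected_injOn z
    obtain ⟨y, hyN, hyG⟩ := mem_closure_iff.mp hz N oN hzN
    have hU : G ∪ N ∈ 𝒢 := ⟨Or.inl hpG, oG.union oN, cG.union y hyG hyN cN,
      hu.injOn_union oG oN cG cN iG iN ⟨y, hyG, hyN⟩⟩
    exact hmax.le_of_ge hU subset_union_left (Or.inr hzN)
  have hsub : C ⊆ G := hC.subset_isClopen ⟨hclosed, oG⟩ ⟨p, hp, hpG⟩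
  exact iG hpG (hsub hq) hpq

section Secant

variable {F : Type*} [NormedAddCommGroup F] [InnerProductSpace ℝ F] [FiniteDimensional ℝ F]

/-- Secant directions of pairs of distinct points converging to `p` accumulate at a nonzero vector
that is annihilated by the derivative of every function constant along the pairs, and is orthogonal
to every continuous vector field orthogonal to the secants. -/
theorem exists_limit_secant {p : F} {R : Set (F × F)} (hR : (p, p) ∈ closure R)
    (hne : ∀ z ∈ R, z.1 ≠ z.2) :
    ∃ v : F, v ≠ 0 ∧
      (∀ (g : F → ℝ) (g' : F →L[ℝ] ℝ), HasStrictFDerivAt g g' p →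
        (∀ z ∈ R, g z.1 = g z.2) → g' v = 0) ∧
      ∀ X : F → F, ContinuousAt X p → (∀ z ∈ R, inner ℝ (X z.1) (z.1 - z.2) = 0) →
        inner ℝ (X p) v = 0 := by
  obtain ⟨s, hs, hlim⟩ := mem_closure_iff_seq_limit.mp hR
  have hlim1 : Tendsto (fun k => (s k).1) atTop (𝓝 p) :=
    (continuous_fst.tendsto (p, p)).comp hlim
  let w : ℕ → F := fun k => ‖(s k).1 - (s k).2‖⁻¹ • ((s k).1 - (s k).2)
  have hw : ∀ k, w k ∈ Metric.sphere (0 : F) 1 := fun k => by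
    have : ‖(s k).1 - (s k).2‖ ≠ 0 := norm_ne_zero_iff.mpr (sub_ne_zero.mpr (hne _ (hs k)))
    simp [w, norm_smul, this]
  obtain ⟨v, hv, φ, hφ, hφv⟩ := (isCompact_sphere (0 : F) 1).tendsto_subseq hw
  refine ⟨v, ?_, ?_, ?_⟩
  · rintro rfl
    simp at hv
  · intro g g' hg hgR
    have h1 : (fun k => g' ((s (φ k)).1 - (s (φ k)).2)) =o[atTop]
        fun k => (s (φ k)).1 - (s (φ k)).2 := by
      have := (hasStrictFDerivAt_iff_isLittleO.mp hg).comp_tendsto (hlim.comp hφ.tendsto_atTop)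
      refine (this.neg_left).congr (fun k => ?_) fun k => rfl
      simp [hgR _ (hs (φ k))]
    have h2 : Tendsto (fun k => g' (w (φ k))) atTop (𝓝 0) := by
      have h3 := (h1.norm_right).tendsto_div_nhds_zero
      refine h3.congr fun k => ?_
      simp [w, div_eq_inv_mul]
    exact tendsto_nhds_unique ((g'.continuous.tendsto v).comp hφv) h2
  · intro X hX hXR
    have h1 : Tendsto (fun k => inner ℝ (X (s (φ k)).1) (w (φ k))) atTop (𝓝 (inner ℝ (X p) v)) :=
      (hX.tendsto.comp (hlim1.comp hφ.tendsto_atTop)).inner hφv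
    refine tendsto_nhds_unique h1 (tendsto_const_nhds.congr fun k => ?_)
    simp [w, inner_smul_right, hXR _ (hs (φ k))]

/-- Let `Y ⊆ W` be closed and invariant under the infinitesimal motions `𝒳`. If at `p ∈ Y` no nonzero
vector is both tangent to `W` and orthogonal to `𝒳`, then `Y` is a neighbourhood of `p` in `W`. -/
theorem eventually_mem_of_invariant {p : F} {W Y : Set F} {𝒳 : Set (F → F)} (hY : IsClosed Y)
    (hYW : Y ⊆ W) (hp : p ∈ Y) (hc : ∀ X ∈ 𝒳, ContinuousAt X p)
    (hflow : ∀ X ∈ 𝒳, ∀ z ∈ Y, ∃ γ : ℝ → F, γ 0 = z ∧ HasDerivAt γ (X z) 0 ∧ ∀ᶠ t in 𝓝 0, γ t ∈ Y)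
    (hker : ∀ v : F, (∀ (g : F → ℝ) (g' : F →L[ℝ] ℝ), HasStrictFDerivAt g g' p →
      (∀ z ∈ W, g z = 0) → g' v = 0) → (∀ X ∈ 𝒳, inner ℝ (X p) v = 0) → v = 0) :
    ∀ᶠ q in 𝓝 p, q ∈ W → q ∈ Y := by
  by_contra hcon
  let R : Set (F × F) :=
    {z | z.1 ∈ Y ∧ z.2 ∈ W ∧ z.2 ∉ Y ∧ ∀ X ∈ 𝒳, inner ℝ (X z.1) (z.1 - z.2) = 0}
  have hR : (p, p) ∈ closure R := by
    rw [Metric.mem_closure_iff]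
    intro ε hε
    obtain ⟨q, hq, hqW⟩ := ((not_eventually.mp hcon).and_eventually
      (Metric.ball_mem_nhds p (half_pos hε))).exists
    push Not at hq
    obtain ⟨z, hz, hmin⟩ := hY.exists_infDist_eq_dist ⟨p, hp⟩ q
    have hmin' : ∀ y ∈ Y, dist q z ≤ dist q y := fun y hy => hmin ▸ Metric.infDist_le_dist_of_mem hy
    have hqp : dist q p < ε / 2 := hqW
    have hqz : dist q z < ε / 2 := (hmin' p hp).trans_lt hqp
    refine ⟨(z, q), ⟨hz, hq.1, hq.2, fun X hX => ?_⟩, ?_⟩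
    · obtain ⟨γ, rfl, hγ, hγY⟩ := hflow X hX z hz
      have hloc : IsLocalMin (fun t => ‖γ t - q‖ ^ 2) 0 := by
        filter_upwards [hγY] with t ht
        have := hmin' _ ht
        rw [dist_comm, dist_eq_norm, dist_comm, dist_eq_norm] at this
        gcongr
      have hd := (hγ.sub_const q).norm_sq
      have := hloc.hasDerivAt_eq_zero hd
      rw [real_inner_comm]
      linarith
    · rw [Prod.dist_eq, max_lt_iff]
      have := dist_triangle p q z
      rw [dist_comm p q] at *
      exact ⟨by linarith, by simpa using by linarith⟩
  obtain ⟨v, hv0, hv1, hv2⟩ := exists_limit_secant hR fun z hz h => hz.2.2.1 (h ▸ hz.1)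
  refine hv0 (hker v (fun g g' hg hgW => hv1 g g' hg fun z hz => ?_) fun X hX =>
    hv2 X (hc X hX) fun z hz => hz.2.2.2 X hX)
  rw [hgW _ (hYW hz.1), hgW _ hz.2.1]

end Secant

open Matrix in
theorem eventually_eq_zero_of_linear_ode {ι : Type*} [Fintype ι] {G : ℝ → ι → ℝ}
    {A : ℝ → Matrix ι ι ℝ} (hA : ContinuousAt A 0)
    (hG : ∀ᶠ t in 𝓝 0, HasDerivAt G (A t *ᵥ G t) t) (h0 : G 0 = 0) : ∀ᶠ t in 𝓝 0, G t = 0 := by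
  classical
  let L : Matrix ι ι ℝ →ₗ[ℝ] ((ι → ℝ) →L[ℝ] (ι → ℝ)) :=
    LinearMap.toContinuousLinearMap.toLinearMap ∘ₗ Matrix.toLin'.toLinearMap
  have hL : ∀ M x, L M x = M *ᵥ x := fun M x => by simp [L]
  have hcont : ContinuousAt (fun t => ‖L (A t)‖₊) 0 :=
    (L.continuous_of_finiteDimensional.continuousAt.comp hA).nnnorm
  have hbd : ∀ᶠ t in 𝓝 0, ‖L (A t)‖₊ < ‖L (A 0)‖₊ + 1 :=
    hcont.eventually_lt continuousAt_const (by simp)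
  refine ODE_solution_unique_of_eventually (v := fun t x => A t *ᵥ x) (s := fun _ => univ)
    (K := ‖L (A 0)‖₊ + 1) (g := fun _ => 0) ?_ ?_ ?_ h0
  · filter_upwards [hbd] with t ht
    have := ((L (A t)).lipschitz.weaken ht.le).lipschitzOnWith (s := univ)
    simpa only [funext (hL (A t))] using this
  · filter_upwards [hG] with t ht using ⟨ht, mem_univ _⟩
  · refine Eventually.of_forall fun t => ⟨?_, mem_univ _⟩
    simpa using hasDerivAt_const t (0 : ι → ℝ)

namespace ExpVariety

open MvPolynomial

section Eval

variable {σ : Type*}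

/-- Evaluation of rational polynomials at a point of a Euclidean space. -/
noncomputable abbrev evalAt (z : EuclideanSpace ℝ σ) : MvPolynomial σ ℚ →ₐ[ℚ] ℝ :=
  aeval z.ofLp

/-- The vector at `z` of a polynomial vector field. -/
noncomputable def fieldAt (X : σ → MvPolynomial σ ℚ) (z : EuclideanSpace ℝ σ) :
    EuclideanSpace ℝ σ :=
  WithLp.toLp 2 fun j => evalAt z (X j)

theorem fieldAt_apply (X : σ → MvPolynomial σ ℚ) (z : EuclideanSpace ℝ σ) (j : σ) :
    fieldAt X z j = evalAt z (X j) := rfl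

variable [Fintype σ]

theorem mkDerivation_eq_sum (X : σ → MvPolynomial σ ℚ) (g : MvPolynomial σ ℚ) :
    mkDerivation ℚ X g = ∑ j, X j * pderiv j g := by
  classical
  induction g using MvPolynomial.induction_on with
  | C a => simp
  | add p q hp hq => simp only [map_add, hp, hq, mul_add, Finset.sum_add_distrib]
  | mul_X p i hp =>
    rw [Derivation.leibniz, hp, mkDerivation_X]
    simp [Derivation.leibniz, pderiv_X, Pi.single_apply, mul_add, Finset.sum_add_distrib,
      Finset.mul_sum]
    congr 1
    · ring
    · exact Finset.sum_congr rfl fun j _ => by ring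

theorem contDiff_evalAt (g : MvPolynomial σ ℚ) {k : WithTop ℕ∞} :
    ContDiff ℝ k fun z : EuclideanSpace ℝ σ => evalAt z g := by
  induction g using MvPolynomial.induction_on with
  | C a => simpa using contDiff_const
  | add p q hp hq => simpa using hp.add hq
  | mul_X p i hp =>
    have : ContDiff ℝ k fun z : EuclideanSpace ℝ σ => z i :=
      (EuclideanSpace.proj (𝕜 := ℝ) i).contDiff
    simpa using hp.mul this

theorem continuous_evalAt (g : MvPolynomial σ ℚ) :
    Continuous fun z : EuclideanSpace ℝ σ => evalAt z g :=
  (contDiff_evalAt g (k := 0)).continuous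

theorem contDiff_fieldAt (X : σ → MvPolynomial σ ℚ) : ContDiff ℝ 1 (fieldAt X) :=
  contDiff_euclidean.mpr fun j => contDiff_evalAt (X j)

/-- The differential of a polynomial. -/
noncomputable def dEval (p : EuclideanSpace ℝ σ) (g : MvPolynomial σ ℚ) :
    EuclideanSpace ℝ σ →L[ℝ] ℝ :=
  ∑ j, evalAt p (pderiv j g) • EuclideanSpace.proj j

theorem dEval_apply (p : EuclideanSpace ℝ σ) (g : MvPolynomial σ ℚ) (v : EuclideanSpace ℝ σ) :
    dEval p g v = ∑ j, evalAt p (pderiv j g) * v j := by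
  simp [dEval]

theorem dEval_fieldAt (p : EuclideanSpace ℝ σ) (g : MvPolynomial σ ℚ)
    (X : σ → MvPolynomial σ ℚ) : dEval p g (fieldAt X p) = evalAt p (mkDerivation ℚ X g) := by
  simp [dEval_apply, mkDerivation_eq_sum, fieldAt_apply, mul_comm]

theorem hasStrictFDerivAt_evalAt (p : EuclideanSpace ℝ σ) (g : MvPolynomial σ ℚ) :
    HasStrictFDerivAt (fun z => evalAt z g) (dEval p g) p := by
  classical
  induction g using MvPolynomial.induction_on with
  | C a =>
    have : dEval p (C a) = 0 := by ext v; simp [dEval_apply]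
    simpa [this] using hasStrictFDerivAt_const (𝕜 := ℝ) (a : ℝ) p
  | add q r hq hr =>
    have : dEval p (q + r) = dEval p q + dEval p r := by
      ext v; simp [dEval_apply, add_mul, Finset.sum_add_distrib]
    simp only [this, map_add]
    exact hq.add hr
  | mul_X q i hq =>
    have hi : HasStrictFDerivAt (fun z : EuclideanSpace ℝ σ => z i)
        (EuclideanSpace.proj (𝕜 := ℝ) i : EuclideanSpace ℝ σ →L[ℝ] ℝ) p :=
      (EuclideanSpace.proj (𝕜 := ℝ) i).hasStrictFDerivAt
    have : dEval p (q * X i) = evalAt p q • (EuclideanSpace.proj (𝕜 := ℝ) i :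
        EuclideanSpace ℝ σ →L[ℝ] ℝ) + p i • dEval p q := by
      ext v
      simp [dEval_apply, add_mul, Finset.sum_add_distrib, pderiv_X, Pi.single_apply,
        Finset.mul_sum, apply_ite]
      ring_nf
    simp only [this, map_mul, aeval_X]
    exact hq.mul hi

theorem hasDerivAt_evalAt {γ : ℝ → EuclideanSpace ℝ σ} {t : ℝ} {X : σ → MvPolynomial σ ℚ}
    (hγ : HasDerivAt γ (fieldAt X (γ t)) t) (g : MvPolynomial σ ℚ) :
    HasDerivAt (fun s => evalAt (γ s) g) (evalAt (γ t) (mkDerivation ℚ X g)) t := by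
  rw [← dEval_fieldAt]
  exact (hasStrictFDerivAt_evalAt (γ t) g).hasFDerivAt.comp_hasDerivAt t hγ

end Eval

variable {ι : Type*}

/-- The real points of `J` whose coordinates `x i`, `y i` satisfy `y i = exp (x i)` for `i ∈ S`. -/
def expVariety (S : Finset ι) (J : Ideal (MvPolynomial (ι ⊕ ι) ℚ)) :
    Set (EuclideanSpace ℝ (ι ⊕ ι)) :=
  {z | (∀ g ∈ J, evalAt z g = 0) ∧ ∀ i ∈ S, z (.inr i) = Real.exp (z (.inl i))}

/-- Polynomial vector fields that preserve `J` and, modulo `J`, are tangent to the graph of `exp` in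
the coordinates of `S`. -/
def tangentFields (S : Finset ι) (J : Ideal (MvPolynomial (ι ⊕ ι) ℚ)) :
    Set (ι ⊕ ι → MvPolynomial (ι ⊕ ι) ℚ) :=
  {Y | (∀ g ∈ J, mkDerivation ℚ Y g ∈ J) ∧ ∀ i ∈ S, Y (.inr i) - X (.inr i) * Y (.inl i) ∈ J}

theorem expVariety_anti {S : Finset ι} {I J : Ideal (MvPolynomial (ι ⊕ ι) ℚ)} (h : I ≤ J) :
    expVariety S J ⊆ expVariety S I :=
  fun _ hz => ⟨fun g hg => hz.1 g (h hg), hz.2⟩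

theorem expVariety_anti_left {S T : Finset ι} {J : Ideal (MvPolynomial (ι ⊕ ι) ℚ)} (h : S ⊆ T) :
    expVariety T J ⊆ expVariety S J :=
  fun _ hz => ⟨hz.1, fun i hi => hz.2 i (h hi)⟩

theorem mem_expVariety_sup_span {S : Finset ι} {J : Ideal (MvPolynomial (ι ⊕ ι) ℚ)}
    {g : MvPolynomial (ι ⊕ ι) ℚ} {z : EuclideanSpace ℝ (ι ⊕ ι)} (hz : z ∈ expVariety S J)
    (hg : evalAt z g = 0) : z ∈ expVariety S (J ⊔ Ideal.span {g}) := by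
  refine ⟨?_, hz.2⟩
  have : J ⊔ Ideal.span {g} ≤ RingHom.ker (evalAt z) :=
    sup_le (fun f hf => hz.1 f hf) ((Ideal.span_singleton_le_iff_mem _).mpr hg)
  exact fun f hf => this hf

variable [Fintype ι]

theorem isClosed_expVariety (S : Finset ι) (J : Ideal (MvPolynomial (ι ⊕ ι) ℚ)) :
    IsClosed (expVariety S J) := by
  have hc : ∀ j, Continuous fun z : EuclideanSpace ℝ (ι ⊕ ι) => z j := fun j =>
    (EuclideanSpace.proj (𝕜 := ℝ) j).continuous
  have : expVariety S J = (⋂ g ∈ J, {z | evalAt z g = 0}) ∩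
      ⋂ i ∈ S, {z | z (.inr i) = Real.exp (z (.inl i))} := by
    ext z; simp [expVariety]
  rw [this]
  refine (isClosed_biInter fun g _ => ?_).inter (isClosed_biInter fun i _ => ?_)
  · exact isClosed_eq (continuous_evalAt g) continuous_const
  · exact isClosed_eq (hc _) (Real.continuous_exp.comp (hc _))

/-- Integral curves of tangent fields stay in the variety. -/
theorem exists_integralCurve {S : Finset ι} {J : Ideal (MvPolynomial (ι ⊕ ι) ℚ)}
    {Y : ι ⊕ ι → MvPolynomial (ι ⊕ ι) ℚ} (hY : Y ∈ tangentFields S J)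
    {p : EuclideanSpace ℝ (ι ⊕ ι)} (hp : p ∈ expVariety S J) :
    ∃ γ : ℝ → EuclideanSpace ℝ (ι ⊕ ι), γ 0 = p ∧
      (∀ᶠ t in 𝓝 0, HasDerivAt γ (fieldAt Y (γ t)) t) ∧ ∀ᶠ t in 𝓝 0, γ t ∈ expVariety S J := by
  classical
  obtain ⟨γ, rfl, ε, hε, hγ⟩ := ContDiffAt.exists_forall_mem_closedBall_exists_eq_forall_mem_Ioo_hasDerivAt₀
    (contDiff_fieldAt Y).contDiffAt (x₀ := p) 0
  have hγ' : ∀ᶠ t in 𝓝 (0 : ℝ), HasDerivAt γ (fieldAt Y (γ t)) t := by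
    filter_upwards [Ioo_mem_nhds (show (0 : ℝ) - ε < 0 by linarith)
      (show (0 : ℝ) < 0 + ε by linarith)] with t ht using hγ t ht
  refine ⟨γ, rfl, hγ', ?_⟩
  obtain ⟨m, f, hf⟩ := Submodule.fg_iff_exists_fin_generating_family.mp
    (IsNoetherian.noetherian J)
  have hfJ : ∀ k, f k ∈ J := fun k => hf ▸ Submodule.subset_span (mem_range_self k)
  have hspan : ∀ g ∈ J, ∃ c : Fin m → MvPolynomial (ι ⊕ ι) ℚ, ∑ k, c k * f k = g := fun g hg => by
    exact (Submodule.mem_span_range_iff_exists_fun _).mp (hf ▸ hg)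
  have ha : ∀ k, ∃ c : Fin m → MvPolynomial (ι ⊕ ι) ℚ, ∑ l, c l * f l = mkDerivation ℚ Y (f k) :=
    fun k => hspan _ (hY.1 _ (hfJ k))
  have hb : ∀ i : S, ∃ c : Fin m → MvPolynomial (ι ⊕ ι) ℚ,
      ∑ l, c l * f l = Y (.inr i) - X (.inr i) * Y (.inl i) := fun i => hspan _ (hY.2 i i.2)
  choose a ha using ha
  choose b hb using hb
  let M : Matrix (Fin m ⊕ S) (Fin m ⊕ S) (MvPolynomial (ι ⊕ ι) ℚ) :=
    Matrix.fromBlocks (Matrix.of a) 0 (Matrix.of b) (Matrix.diagonal fun i => Y (.inl i))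
  let G : ℝ → Fin m ⊕ S → ℝ := fun t => Sum.elim (fun k => evalAt (γ t) (f k))
    fun i => γ t (.inr i) - Real.exp (γ t (.inl i))
  have hcγ : ContinuousAt γ 0 := hγ'.self_of_nhds.continuousAt
  have key : ∀ᶠ t in 𝓝 0, G t = 0 := by
    refine eventually_eq_zero_of_linear_ode (A := fun t => M.map (evalAt (γ t))) ?_ ?_ ?_
    · refine continuousAt_pi.mpr fun i => continuousAt_pi.mpr fun j => ?_
      exact (continuous_evalAt (M i j)).continuousAt.comp hcγ
    · filter_upwards [hγ'] with t ht
      have hcoord : ∀ j, HasDerivAt (fun s => γ s j) (evalAt (γ t) (Y j)) t := fun j => by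
        simpa using hasDerivAt_evalAt ht (X j)
      rw [hasDerivAt_pi]
      rintro (k | i)
      · have := hasDerivAt_evalAt ht (f k)
        rw [← ha k] at this
        simpa [G, M, Matrix.mulVec, dotProduct] using this
      · have := (hcoord (.inr i)).sub (hcoord (.inl i)).exp
        refine this.congr_deriv ?_
        have h2 := congrArg (evalAt (γ t)) (hb i)
        simp only [map_sum, map_mul, map_sub, aeval_X] at h2
        simp [G, M, Matrix.mulVec, dotProduct, Matrix.diagonal_apply, apply_ite, h2]
        ring
    · funext j
      rcases j with k | i
      · exact hp.1 _ (hfJ k)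
      · exact sub_eq_zero.mpr (hp.2 i i.2)
  filter_upwards [key] with t ht
  refine ⟨fun g hg => ?_, fun i hi => sub_eq_zero.mp (congrFun ht (.inr ⟨i, hi⟩))⟩
  obtain ⟨c, rfl⟩ := hspan g hg
  rw [map_sum]
  refine Finset.sum_eq_zero fun k _ => ?_
  rw [map_mul, show evalAt (γ t) (f k) = 0 from congrFun ht (.inl k), mul_zero]

end ExpVariety

open Matrix in
/-- Over a field, the identity matrix lies in the span of the matrices `c ⊗ e` with `c` in the
orthogonal of `L` and `e ⊗ l` with `l ∈ L`. -/
theorem Matrix.one_mem_span_orthogonal {K σ : Type*} [Field K] [Fintype σ] [DecidableEq σ]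
    (L : Set (σ → K)) (N : Set (σ → K))
    (hN : ∀ c : σ → K, (∀ l ∈ L, l ⬝ᵥ c = 0) → c ∈ Submodule.span K N) :
    (1 : Matrix σ σ K) ∈ Submodule.span K ({M | ∃ c ∈ N, ∃ j, M = vecMulVec c (Pi.single j 1)} ∪
      {M | ∃ l ∈ L, ∃ i, M = vecMulVec (Pi.single i 1) l}) := by
  by_contra hcon
  obtain ⟨f, hf, hle⟩ := Submodule.exists_le_ker_of_notMem hcon
  let B : Matrix σ σ K := Matrix.of fun j i => f (Matrix.single i j 1)
  have hB : ∀ M, f M = ∑ i, ∑ j, M i j * B j i := fun M => by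
    conv_lhs => rw [Matrix.matrix_eq_sum_single M]
    simp only [map_sum]
    refine Finset.sum_congr rfl fun i _ => Finset.sum_congr rfl fun j _ => ?_
    rw [show Matrix.single i j (M i j) = M i j • Matrix.single i j (1 : K) by simp, map_smul]
    rfl
  have hcol : ∀ i, Bᵀ i ∈ Submodule.span K N := fun i => hN _ fun l hl => by
    have : f (vecMulVec (Pi.single i 1) l) = 0 := hle (Submodule.subset_span (.inr ⟨l, hl, i, rfl⟩))
    rw [hB, Finset.sum_eq_single i (fun k _ hk => by simp [vecMulVec_apply, hk]) (by simp)] at this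
    simpa [vecMulVec_apply, dotProduct] using this
  have hmul : ∀ c ∈ Submodule.span K N, B *ᵥ c = 0 := by
    intro c hc
    have hker : Submodule.span K N ≤ LinearMap.ker (Matrix.mulVecLin B) := by
      refine Submodule.span_le.mpr fun c hc => ?_
      funext j
      have : f (vecMulVec c (Pi.single j 1)) = 0 :=
        hle (Submodule.subset_span (.inl ⟨c, hc, j, rfl⟩))
      rw [hB] at this
      simpa [vecMulVec_apply, mulVec, dotProduct, Pi.single_apply, mul_comm] using this
    exact hker hc
  have hBB : B * B = 0 := by
    ext j i
    simpa [mul_apply, mulVec, dotProduct] using congrFun (hmul _ (hcol i)) j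
  have htr : B.trace = 0 :=
    (isNilpotent_trace_of_isNilpotent ⟨2, by rw [pow_two, hBB]⟩).eq_zero
  refine hf ?_
  rw [hB]
  simpa [one_apply, trace] using htr

open Matrix in
theorem exists_ne_zero_forall_eval_eq_zero {R σ : Type*} [CommRing R] [IsDomain R] [Fintype σ]
    (L : Set (σ → R)) : ∃ δ : R, δ ≠ 0 ∧ ∀ ev : R →+* ℝ, ev δ ≠ 0 → ∀ v : σ → ℝ,
      (∀ l ∈ L, (ev ∘ l) ⬝ᵥ v = 0) → (∀ c, (∀ l ∈ L, l ⬝ᵥ c = 0) → (ev ∘ c) ⬝ᵥ v = 0) →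
      v = 0 := by
  classical
  let K := FractionRing R
  let a := algebraMap R K
  have ha : Function.Injective a := IsFractionRing.injective R K
  let N : Set (σ → R) := {c | ∀ l ∈ L, l ⬝ᵥ c = 0}
  let S : Set (Matrix σ σ R) := {M | ∃ c ∈ N, ∃ j, M = vecMulVec c (Pi.single j 1)} ∪
      {M | ∃ l ∈ L, ∃ i, M = vecMulVec (Pi.single i 1) l}
  have hone := one_mem_span_orthogonal ((fun l => a ∘ l) '' L) ((fun c => a ∘ c) '' N) fun c hc => by
    obtain ⟨d, hd⟩ := IsLocalization.exist_integer_multiples_of_finite (nonZeroDivisors R) c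
    choose c' hc' using hd
    have hd0 : a d ≠ 0 := (map_ne_zero_iff a ha).mpr (nonZeroDivisors.ne_zero d.2)
    have hcc : c = (a d)⁻¹ • (a ∘ c') := by
      funext j
      have : a (c' j) = (d : R) • c j := hc' j
      simp [this, Algebra.smul_def, a]
      rw [inv_mul_cancel_left₀ hd0]
    rw [hcc]
    refine Submodule.smul_mem _ _ (Submodule.subset_span ⟨c', fun l hl => ha ?_, rfl⟩)
    have h1 := hc _ ⟨l, hl, rfl⟩
    rw [hcc, dotProduct_smul, smul_eq_mul] at h1
    rw [map_zero, RingHom.map_dotProduct]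
    exact (mul_eq_zero.mp h1).resolve_left (inv_ne_zero hd0)
  have hclear : ∀ M ∈ Submodule.span K (({M | ∃ c ∈ (fun c => a ∘ c) '' N, ∃ j,
      M = vecMulVec c (Pi.single j 1)} ∪
      {M | ∃ l ∈ (fun l => a ∘ l) '' L, ∃ i, M = vecMulVec (Pi.single i 1) l})),
      ∃ δ : R, δ ≠ 0 ∧ ∃ M' ∈ Submodule.span R S, a δ • M = M'.map a := by
    intro M hM
    induction hM using Submodule.span_induction with
    | mem M hM =>
      refine ⟨1, one_ne_zero, ?_⟩
      rcases hM with ⟨_, ⟨c, hc, rfl⟩, j, rfl⟩ | ⟨_, ⟨l, hl, rfl⟩, i, rfl⟩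
      · refine ⟨_, Submodule.subset_span (.inl ⟨c, hc, j, rfl⟩), ?_⟩
        ext i k
        simp [vecMulVec_apply, Pi.single_apply, apply_ite a]
      · refine ⟨_, Submodule.subset_span (.inr ⟨l, hl, i, rfl⟩), ?_⟩
        ext j k
        simp [vecMulVec_apply, Pi.single_apply, apply_ite a]
    | zero => exact ⟨1, one_ne_zero, 0, zero_mem _, by simp⟩
    | add M₁ M₂ _ _ h₁ h₂ =>
      obtain ⟨δ₁, n₁, M₁', m₁, e₁⟩ := h₁
      obtain ⟨δ₂, n₂, M₂', m₂, e₂⟩ := h₂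
      refine ⟨δ₁ * δ₂, mul_ne_zero n₁ n₂, δ₂ • M₁' + δ₁ • M₂',
        add_mem (Submodule.smul_mem _ _ m₁) (Submodule.smul_mem _ _ m₂), ?_⟩
      ext i j
      have h1 := congrFun (congrFun e₁ i) j
      have h2 := congrFun (congrFun e₂ i) j
      simp only [Matrix.smul_apply, map_apply, smul_eq_mul, Matrix.add_apply, map_mul, map_add] at *
      rw [← h1, ← h2]
      ring
    | smul k M _ h =>
      obtain ⟨δ, n, M', m, e⟩ := h
      obtain ⟨r, s, hs, rfl⟩ := IsFractionRing.div_surjective (A := R) k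
      have hs0 : a s ≠ 0 := (map_ne_zero_iff a ha).mpr (nonZeroDivisors.ne_zero hs)
      refine ⟨s * δ, mul_ne_zero (nonZeroDivisors.ne_zero hs) n, r • M',
        Submodule.smul_mem _ _ m, ?_⟩
      ext i j
      have h1 := congrFun (congrFun e i) j
      simp only [Matrix.smul_apply, map_apply, smul_eq_mul, map_mul] at *
      rw [← h1, ← mul_assoc, ← mul_assoc, mul_right_comm (a s), mul_div_cancel₀ _ hs0]
  obtain ⟨δ, hδ, M', hM', e⟩ := hclear _ hone
  refine ⟨δ, hδ, fun ev hev v hL hN => ?_⟩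
  have hquad : ∀ M ∈ Submodule.span R S, v ⬝ᵥ (M.map ev *ᵥ v) = 0 := by
    intro M hM
    induction hM using Submodule.span_induction with
    | mem M hM =>
      rcases hM with ⟨c, hc, j, rfl⟩ | ⟨l, hl, i, rfl⟩
      · have h1 : (vecMulVec c (Pi.single j 1)).map ev = vecMulVec (ev ∘ c) (Pi.single j 1) := by
          ext i k; simp [vecMulVec_apply, Pi.single_apply, apply_ite ev]
        rw [h1, vecMulVec_mulVec]
        simp [dotProduct_comm v, hN c hc]
      · have h1 : (vecMulVec (Pi.single i 1) l).map ev = vecMulVec (Pi.single i 1) (ev ∘ l) := by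
          ext j k; simp [vecMulVec_apply, Pi.single_apply, apply_ite ev]
        rw [h1, vecMulVec_mulVec, hL l hl]
        simp
    | zero => simp
    | add M₁ M₂ _ _ h₁ h₂ =>
      rw [Matrix.map_add _ (map_add ev), add_mulVec, dotProduct_add, h₁, h₂, add_zero]
    | smul r M _ h =>
      have h1 : (r • M).map ev = ev r • M.map ev := by ext i j; simp
      rw [h1, smul_mulVec, dotProduct_smul, h, smul_zero]
  have hM1 : M' = δ • (1 : Matrix σ σ R) := by
    ext i j
    apply ha
    have := congrFun (congrFun e i) j
    simp only [Matrix.smul_apply, map_apply, smul_eq_mul, one_apply] at this ⊢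
    rw [← this]
    split_ifs <;> simp
  have h0 := hquad M' hM'
  have h1 : (δ • (1 : Matrix σ σ R)).map ev = ev δ • 1 := by
    ext i j
    by_cases h : i = j <;> simp [one_apply, h]
  rw [hM1, h1, smul_mulVec, one_mulVec, dotProduct_smul, smul_eq_mul, mul_eq_zero] at h0
  exact dotProduct_self_eq_zero.mp (h0.resolve_left hev)

namespace ExpVariety

open MvPolynomial

variable {ι : Type*} [Fintype ι]

/-- Away from a hypersurface, the common tangent space of `P` and of the graphs of `exp` in the
coordinates of `S` contains no nonzero vector orthogonal to all tangent fields. -/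
theorem exists_notMem_forall_eq_zero (S : Finset ι) (P : Ideal (MvPolynomial (ι ⊕ ι) ℚ))
    [hP : P.IsPrime] :
    ∃ δ ∉ P, ∀ p ∈ expVariety ∅ P, evalAt p δ ≠ 0 → ∀ v : EuclideanSpace ℝ (ι ⊕ ι),
      (∀ g ∈ P, dEval p g v = 0) → (∀ i ∈ S, v (.inr i) = p (.inr i) * v (.inl i)) →
      (∀ Y ∈ tangentFields S P, inner ℝ (fieldAt Y p) v = 0) → v = 0 := by
  classical
  let π := Ideal.Quotient.mk P
  let L : Set (ι ⊕ ι → MvPolynomial (ι ⊕ ι) ℚ ⧸ P) :=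
    {l | ∃ g ∈ P, l = fun j => π (pderiv j g)} ∪
    {l | ∃ i ∈ S, l = Pi.single (.inr i) 1 - Pi.single (.inl i) (π (X (.inr i)))}
  obtain ⟨δ, hδ, key⟩ := exists_ne_zero_forall_eval_eq_zero L
  obtain ⟨δ, rfl⟩ := Ideal.Quotient.mk_surjective δ
  refine ⟨δ, fun h => hδ (Ideal.Quotient.eq_zero_iff_mem.mpr h), fun p hp hpδ v h1 h2 h3 => ?_⟩
  let ev : MvPolynomial (ι ⊕ ι) ℚ ⧸ P →+* ℝ := Ideal.Quotient.lift P (evalAt p).toRingHom hp.1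
  have hev : ∀ g, ev (π g) = evalAt p g := fun g => rfl
  have hv := key ev hpδ v.ofLp ?_ ?_
  · ext j; exact congrFun hv j
  · rintro l (⟨g, hg, rfl⟩ | ⟨i, hi, rfl⟩)
    · have := h1 g hg
      rw [dEval_apply] at this
      exact this
    · have : (⇑ev ∘ (Pi.single (Sum.inr i) 1 - Pi.single (Sum.inl i) (π (X (.inr i))))) =
          Pi.single (Sum.inr i) 1 - Pi.single (Sum.inl i) (p (.inr i)) := by
        funext j
        simp only [Function.comp_apply, Pi.sub_apply, map_sub, Pi.single_apply, apply_ite ev,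
          map_one, map_zero, hev, aeval_X]
      rw [this, sub_dotProduct, single_dotProduct, single_dotProduct, h2 i hi]
      simp
  · intro c hc
    choose Y hY using fun j => Ideal.Quotient.mk_surjective (c j)
    obtain rfl : (fun j => π (Y j)) = c := funext hY
    have hYt : Y ∈ tangentFields S P := by
      constructor
      · intro g hg
        have := hc _ (.inl ⟨g, hg, rfl⟩)
        rw [mkDerivation_eq_sum, ← Ideal.Quotient.eq_zero_iff_mem, map_sum, ← this]
        exact Finset.sum_congr rfl fun j _ => by rw [map_mul, mul_comm]
      · intro i hi
        have := hc _ (.inr ⟨i, hi, rfl⟩)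
        rw [sub_dotProduct, single_dotProduct, single_dotProduct, one_mul] at this
        rw [← Ideal.Quotient.eq_zero_iff_mem, map_sub, map_mul]
        exact this
    have := h3 Y hYt
    rw [PiLp.inner_apply] at this
    rw [← this]
    simp only [dotProduct, Function.comp_apply, hev, fieldAt_apply]
    exact Finset.sum_congr rfl fun j _ => by simp [mul_comm]

end ExpVariety

/-- A finitely generated field extension without nonzero derivations, in characteristic zero, is
algebraic. -/
theorem Algebra.isAlgebraic_of_subsingleton_derivation {k K : Type} [Field k] [CharZero k] [Field K]
    [Algebra k K] [Algebra.EssFiniteType k K] (h : ∀ D : Derivation k K K, D = 0) :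
    Algebra.IsAlgebraic k K := by
  have hsub : Subsingleton (Ω[K⁄k]) := by
    refine ⟨fun a b => sub_eq_zero.mp ?_⟩
    rw [← Module.forall_dual_apply_eq_zero_iff K]
    intro f
    have h2 : f = 0 := Derivation.liftKaehlerDifferential_unique f 0 ((h _).trans (h _).symm)
    rw [h2, LinearMap.zero_apply]
  have : Algebra.FormallyUnramified k K := ⟨hsub⟩
  have := (Algebra.FormallyUnramified.iff_isSeparable k K).mp this
  infer_instance

namespace ExpVariety

open MvPolynomial

variable {ι : Type} [Fintype ι]

theorem finite_expVariety_empty {P : Ideal (MvPolynomial (ι ⊕ ι) ℚ)} [hP : P.IsPrime]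
    (hN : ∀ Y ∈ tangentFields ∅ P, ∀ j, Y j ∈ P) : (expVariety ∅ P).Finite := by
  classical
  let A := MvPolynomial (ι ⊕ ι) ℚ
  let K := FractionRing (A ⧸ P)
  let f : A →ₐ[ℚ] K := (IsScalarTower.toAlgHom ℚ (A ⧸ P) K).comp (Ideal.Quotient.mkₐ ℚ P)
  have hf : ∀ g, f g = 0 ↔ g ∈ P := fun g => by
    rw [← Ideal.Quotient.eq_zero_iff_mem, ← map_eq_zero_iff _ (IsFractionRing.injective (A ⧸ P) K)]
    rfl
  have : Algebra.EssFiniteType ℚ K := .comp ℚ (A ⧸ P) K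
  have hK : Algebra.IsAlgebraic ℚ K := by
    refine Algebra.isAlgebraic_of_subsingleton_derivation fun D => ?_
    obtain ⟨d, hd⟩ := IsLocalization.exist_integer_multiples_of_finite (nonZeroDivisors (A ⧸ P))
      fun j => D (f (X j))
    obtain ⟨d, hd0⟩ := d
    obtain ⟨d, rfl⟩ := Ideal.Quotient.mk_surjective d
    choose Y hY using hd
    choose Y' hY' using fun j => Ideal.Quotient.mk_surjective (Y j)
    have hY'' : ∀ j, f (Y' j) = f d * D (f (X j)) := fun j => by
      have := hY j
      rw [← hY', Algebra.smul_def] at this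
      exact this
    have hfd : f d ≠ 0 := fun h => nonZeroDivisors.ne_zero hd0
      (Ideal.Quotient.eq_zero_iff_mem.mpr ((hf d).mp h))
    have hder : ∀ g, f (mkDerivation ℚ Y' g) = f d * D (f g) := fun g => by
      induction g using MvPolynomial.induction_on with
      | C a =>
        rw [show (C a : A) = algebraMap ℚ A a from rfl, Derivation.map_algebraMap, f.commutes,
          Derivation.map_algebraMap]
        simp
      | add p q hp hq => rw [map_add, map_add, hp, hq, map_add, map_add, mul_add]
      | mul_X p i hp =>
        rw [Derivation.leibniz, mkDerivation_X, map_add, map_mul, Derivation.leibniz]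
        simp only [smul_eq_mul, map_mul, hp, hY'']
        ring
    have hX : ∀ j, D (f (X j)) = 0 := fun j => by
      have := hN Y' ⟨fun g hg => (hf _).mp ?_, by simp⟩ j
      · rw [← hf, hY''] at this
        exact (mul_eq_zero.mp this).resolve_left hfd
      · rw [hder, (hf g).mpr hg, map_zero, mul_zero]
    have hA : ∀ g, D (f g) = 0 := fun g => by
      have h1 := hder g
      rw [mkDerivation_eq_sum, map_sum] at h1
      have h2 : ∀ j, f (Y' j) = 0 := fun j => by rw [hY'', hX, mul_zero]
      simp only [map_mul, h2, zero_mul, Finset.sum_const_zero] at h1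
      exact (mul_eq_zero.mp h1.symm).resolve_left hfd
    ext z
    obtain ⟨a, b, hb, rfl⟩ := IsFractionRing.div_surjective (A := A ⧸ P) z
    obtain ⟨a, rfl⟩ := Ideal.Quotient.mk_surjective a
    obtain ⟨b, rfl⟩ := Ideal.Quotient.mk_surjective b
    have hfb : f b ≠ 0 := fun h => nonZeroDivisors.ne_zero hb
      (Ideal.Quotient.eq_zero_iff_mem.mpr ((hf b).mp h))
    change D (f a / f b) = 0
    have h1 : f b * (f a / f b) = f a := mul_div_cancel₀ _ hfb
    have h2 := congrArg D h1
    rw [Derivation.leibniz, hA, hA, smul_zero, add_zero, smul_eq_mul] at h2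
    exact (mul_eq_zero.mp h2).resolve_left hfb
  have hq : ∀ j, ∃ q : Polynomial ℚ, q ≠ 0 ∧ Polynomial.aeval (X j) q ∈ P := fun j => by
    obtain ⟨q, hq0, hq⟩ := hK.isAlgebraic (f (X j))
    refine ⟨q, hq0, (hf _).mp ?_⟩
    rw [← hq, Polynomial.aeval_algHom_apply]
  choose q hq0 hq using hq
  refine Finite.of_finite_image (f := WithLp.ofLp) ?_ (WithLp.ofLp_injective 2).injOn
  refine (Set.Finite.pi' fun j => (q j).rootSet_finite ℝ).subset ?_
  rintro _ ⟨z, hz, rfl⟩ j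
  rw [Polynomial.mem_rootSet_of_ne (hq0 j)]
  have := hz.1 _ (hq j)
  rw [← Polynomial.aeval_algHom_apply, aeval_X] at this
  exact this

end ExpVariety

theorem mem_connectedComponentIn_of_mem_closure {Z : Type*} [TopologicalSpace Z] {W : Set Z}
    {x z : Z} (hx : x ∈ W) (hz : z ∈ W) (h : z ∈ closure (connectedComponentIn W x)) :
    z ∈ connectedComponentIn W x := by
  have hpre : IsPreconnected (closure (connectedComponentIn W x) ∩ W) :=
    isPreconnected_connectedComponentIn.subset_closure
      (subset_inter subset_closure (connectedComponentIn_subset _ _)) inter_subset_left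
  exact hpre.subset_connectedComponentIn ⟨subset_closure (mem_connectedComponentIn hx), hx⟩
    inter_subset_right ⟨h, hz⟩

namespace ExpVariety

open MvPolynomial

variable {ι : Type} [Fintype ι]

/-- Integral curves of tangent fields stay in the connected component of their starting point. -/
theorem exists_integralCurve_mem_connectedComponentIn {S : Finset ι}
    {J : Ideal (MvPolynomial (ι ⊕ ι) ℚ)} {h : MvPolynomial (ι ⊕ ι) ℚ}
    {Y : ι ⊕ ι → MvPolynomial (ι ⊕ ι) ℚ} (hY : Y ∈ tangentFields S J)
    {p : EuclideanSpace ℝ (ι ⊕ ι)} (hp : p ∈ expVariety S J ∩ {z | evalAt z h ≠ 0}) :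
    ∃ γ : ℝ → EuclideanSpace ℝ (ι ⊕ ι), γ 0 = p ∧ HasDerivAt γ (fieldAt Y p) 0 ∧
      ∀ᶠ t in 𝓝 0, γ t ∈ connectedComponentIn (expVariety S J ∩ {z | evalAt z h ≠ 0}) p := by
  obtain ⟨γ, rfl, hγ, hγJ⟩ := exists_integralCurve hY hp.1
  have hh : ∀ᶠ t in 𝓝 0, evalAt (γ t) h ≠ 0 :=
    ((continuous_evalAt h).continuousAt.comp hγ.self_of_nhds.continuousAt).eventually_ne hp.2
  refine ⟨γ, rfl, hγ.self_of_nhds, ?_⟩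
  obtain ⟨ε, hε, hball⟩ := Metric.eventually_nhds_iff_ball.mp (hγ.and (hγJ.and hh))
  have hpre : IsPreconnected (γ '' Metric.ball 0 ε) := by
    refine (convex_ball (0 : ℝ) ε).isPreconnected.image γ fun t ht => ?_
    exact (hball t ht).1.continuousAt.continuousWithinAt
  filter_upwards [Metric.ball_mem_nhds (0 : ℝ) hε] with t ht
  refine hpre.subset_connectedComponentIn ⟨0, Metric.mem_ball_self hε, rfl⟩ ?_ ⟨t, ht, rfl⟩
  rintro _ ⟨s, hs, rfl⟩
  exact (hball s hs).2

/-- If some tangent field is not zero on `P`, the critical points of a suitable function form a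
proper subvariety that meets every connected component. -/
theorem exists_notMem_meets_components {S : Finset ι} {P : Ideal (MvPolynomial (ι ⊕ ι) ℚ)}
    [hP : P.IsPrime] {h : MvPolynomial (ι ⊕ ι) ℚ} (hh : h ∉ P)
    {Y : ι ⊕ ι → MvPolynomial (ι ⊕ ι) ℚ} (hY : Y ∈ tangentFields S P) {j : ι ⊕ ι} (hj : Y j ∉ P) :
    ∃ g ∉ P, ∀ x ∈ expVariety S P ∩ {z | evalAt z h ≠ 0},
      (connectedComponentIn (expVariety S P ∩ {z | evalAt z h ≠ 0}) x ∩
        (expVariety S (P ⊔ Ideal.span {g}) ∩ {z | evalAt z h ≠ 0})).Nonempty := by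
  classical
  let s : (ι ⊕ ι → ℚ) → MvPolynomial (ι ⊕ ι) ℚ := fun c => ∑ k, (X k - C (c k)) ^ 2
  let g : (ι ⊕ ι → ℚ) → MvPolynomial (ι ⊕ ι) ℚ := fun c =>
    h ^ 3 * mkDerivation ℚ Y (s c) - 2 * mkDerivation ℚ Y h
  have hs : ∀ c, mkDerivation ℚ Y (s c) = ∑ k, 2 * (X k - C (c k)) * Y k := fun c => by
    simp only [s, map_sum]
    refine Finset.sum_congr rfl fun k _ => ?_
    rw [pow_two, Derivation.leibniz, map_sub, mkDerivation_X,
      show (C (c k) : MvPolynomial (ι ⊕ ι) ℚ) = algebraMap ℚ _ (c k) from rfl,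
      Derivation.map_algebraMap, smul_eq_mul]
    ring
  obtain ⟨c, hc⟩ : ∃ c, g c ∉ P := by
    by_contra! hcon
    have h1 := P.sub_mem (hcon 0) (hcon (Pi.single j 1))
    have h2 : g 0 - g (Pi.single j 1) = C 2 * (h ^ 3 * Y j) := by
      simp only [g, hs]
      rw [sub_sub_sub_cancel_right, ← mul_sub, ← Finset.sum_sub_distrib,
        Finset.sum_eq_single j _ (by simp)]
      · simp only [Pi.zero_apply, Pi.single_eq_same, map_zero, map_one, map_ofNat]
        ring
      · intro k _ hk
        simp [Pi.single_eq_of_ne hk]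
    rw [h2] at h1
    have h3 : h ^ 3 * Y j ∈ P := by
      have := P.mul_mem_left (C (2⁻¹ : ℚ)) h1
      rwa [← mul_assoc, ← C_mul, inv_mul_cancel₀ two_ne_zero, C_1, one_mul] at this
    exact (hP.mem_or_mem h3).elim (fun h => hh (hP.mem_of_pow_mem _ h)) hj
  refine ⟨g c, hc, fun x hx => ?_⟩
  set W := expVariety S P ∩ {z | evalAt z h ≠ 0} with hW
  let φ : EuclideanSpace ℝ (ι ⊕ ι) → ℝ := fun z => evalAt z (s c) + (evalAt z h ^ 2)⁻¹
  have hs0 : ∀ z : EuclideanSpace ℝ (ι ⊕ ι),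
      evalAt z (s c) = dist z (WithLp.toLp 2 fun k => (c k : ℝ)) ^ 2 := fun z => by
    rw [EuclideanSpace.dist_eq, Real.sq_sqrt (Finset.sum_nonneg fun _ _ => sq_nonneg _)]
    simp [s, Real.dist_eq]
  let K : Set (EuclideanSpace ℝ (ι ⊕ ι)) := closure (connectedComponentIn W x) ∩
    (expVariety S P ∩ {z | evalAt z (s c) * evalAt z h ^ 2 + 1 ≤ φ x * evalAt z h ^ 2})
  have hKh : ∀ z ∈ K, evalAt z h ≠ 0 := fun z hz h0 => by
    have := hz.2.2
    rw [mem_ofPred_eq, h0] at this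
    norm_num at this
  have hφ : ∀ z, evalAt z h ≠ 0 →
      (φ z ≤ φ x ↔ evalAt z (s c) * evalAt z h ^ 2 + 1 ≤ φ x * evalAt z h ^ 2) := fun z hz => by
    have hpos : 0 < evalAt z h ^ 2 := by positivity
    rw [← mul_le_mul_iff_left₀ hpos]
    simp only [φ]
    rw [add_mul, inv_mul_cancel₀ hpos.ne']
  have hKC : K ⊆ connectedComponentIn W x := fun z hz =>
    mem_connectedComponentIn_of_mem_closure hx ⟨hz.2.1, hKh z hz⟩ hz.1
  have hxK : x ∈ K := ⟨subset_closure (mem_connectedComponentIn hx), hx.1, (hφ x hx.2).mp le_rfl⟩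
  have hcs := continuous_evalAt (s c)
  have hch := continuous_evalAt h
  have hKcl : IsClosed K := isClosed_closure.inter ((isClosed_expVariety S P).inter
    (isClosed_le ((hcs.mul (hch.pow 2)).add continuous_const) (continuous_const.mul (hch.pow 2))))
  have hKcomp : IsCompact K := by
    refine Metric.isCompact_of_isClosed_isBounded hKcl ?_
    refine (Metric.isBounded_closedBall (x := WithLp.toLp 2 fun k => (c k : ℝ))
      (r := Real.sqrt (φ x))).subset fun z hz => ?_
    have h1 := (hφ z (hKh z hz)).mpr hz.2.2
    rw [Metric.mem_closedBall]
    refine Real.le_sqrt_of_sq_le ?_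
    rw [← hs0]
    have : 0 ≤ (evalAt z h ^ 2)⁻¹ := by positivity
    simp only [φ] at h1
    linarith
  obtain ⟨q, hqK, hmin⟩ := hKcomp.exists_isMinOn ⟨x, hxK⟩ (f := φ)
    (hcs.continuousOn.add ((hch.pow 2).continuousOn.inv₀ fun z hz => pow_ne_zero 2 (hKh z hz)))
  have hqC := hKC hqK
  have hqW : q ∈ W := connectedComponentIn_subset _ _ hqC
  have hminC : ∀ z ∈ connectedComponentIn W x, φ q ≤ φ z := fun z hz => by
    have hzW := connectedComponentIn_subset _ _ hz
    by_cases hle : φ z ≤ φ x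
    · exact hmin ⟨subset_closure hz, hzW.1, (hφ z hzW.2).mp hle⟩
    · exact (hmin hxK).trans (not_le.mp hle).le
  obtain ⟨γ, rfl, hγ, hγC⟩ := exists_integralCurve_mem_connectedComponentIn hY hqW
  have hloc : IsLocalMin (φ ∘ γ) 0 := by
    filter_upwards [hγC] with t ht
    exact hminC _ (connectedComponentIn_eq hqC ▸ ht)
  have hd := (hasDerivAt_evalAt hγ (s c)).add
    (((hasDerivAt_evalAt hγ h).pow 2).inv (pow_ne_zero 2 hqW.2))
  have hzero := hloc.hasDerivAt_eq_zero hd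
  refine ⟨γ 0, hqC, mem_expVariety_sup_span hqW.1 ?_, hqW.2⟩
  have hne : evalAt (γ 0) h ≠ 0 := hqW.2
  simp only [Nat.cast_ofNat, Nat.add_one_sub_one, pow_one, Pi.pow_apply] at hzero
  field_simp at hzero
  simp only [g, map_sub, map_mul, map_pow, map_ofNat]
  linarith

end ExpVariety

namespace ExpVariety

open MvPolynomial

variable {ι : Type}

theorem expVariety_eq_union {S : Finset ι} {J : Ideal (MvPolynomial (ι ⊕ ι) ℚ)}
    {a b : MvPolynomial (ι ⊕ ι) ℚ} (h : a * b ∈ J) :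
    expVariety S J = expVariety S (J ⊔ Ideal.span {a}) ∪ expVariety S (J ⊔ Ideal.span {b}) := by
  refine Subset.antisymm (fun z hz => ?_)
    (union_subset (expVariety_anti le_sup_left) (expVariety_anti le_sup_left))
  have := hz.1 _ h
  rw [map_mul, mul_eq_zero] at this
  exact this.imp (mem_expVariety_sup_span hz) (mem_expVariety_sup_span hz)

theorem expVariety_inter_eq_union {S : Finset ι} (J : Ideal (MvPolynomial (ι ⊕ ι) ℚ))
    (δ : MvPolynomial (ι ⊕ ι) ℚ) (U : Set (EuclideanSpace ℝ (ι ⊕ ι))) :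
    expVariety S J ∩ U = (expVariety S J ∩ {z | evalAt z δ ≠ 0}) ∩ U ∪
      expVariety S (J ⊔ Ideal.span {δ}) ∩ U := by
  refine Subset.antisymm (fun z hz => ?_) (union_subset ?_ ?_)
  · by_cases h : evalAt z δ = 0
    · exact .inr ⟨mem_expVariety_sup_span hz.1 h, hz.2⟩
    · exact .inl ⟨⟨hz.1, h⟩, hz.2⟩
  · exact inter_subset_inter_left _ inter_subset_left
  · exact inter_subset_inter_left _ (expVariety_anti le_sup_left)

theorem lt_sup_span {R : Type*} [CommRing R] {J : Ideal R} {a : R} (h : a ∉ J) :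
    J < J ⊔ Ideal.span {a} :=
  left_lt_sup.mpr fun hle => h ((Ideal.span_singleton_le_iff_mem _).mp hle)

/-- Noetherian induction over the sets `expVariety S J ∩ U`, reducing to prime ideals. -/
theorem expVariety_induction [Finite ι] {S : Finset ι} {U : Set (EuclideanSpace ℝ (ι ⊕ ι))}
    {p : Set (EuclideanSpace ℝ (ι ⊕ ι)) → Prop} (empty : p ∅)
    (union : ∀ A B, p A → p B → p (A ∪ B))
    (prime : ∀ P : Ideal (MvPolynomial (ι ⊕ ι) ℚ), P.IsPrime →
      (∀ J, P < J → p (expVariety S J ∩ U)) → p (expVariety S P ∩ U))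
    (J : Ideal (MvPolynomial (ι ⊕ ι) ℚ)) : p (expVariety S J ∩ U) := by
  induction J using WellFoundedGT.induction with
  | ind J ih =>
    by_cases hJ : J.IsPrime
    · exact prime J hJ ih
    rw [Ideal.isPrime_iff, not_and_or, not_not] at hJ
    rcases hJ with rfl | hJ
    · have : expVariety S (⊤ : Ideal (MvPolynomial (ι ⊕ ι) ℚ)) = ∅ :=
        eq_empty_of_forall_notMem fun z hz => by simpa using hz.1 1 trivial
      rwa [this, empty_inter]
    · push Not at hJ
      obtain ⟨a, b, hab, ha, hb⟩ := hJ
      rw [expVariety_eq_union hab, union_inter_distrib_right]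
      exact union _ _ (ih _ (lt_sup_span ha)) (ih _ (lt_sup_span hb))

theorem hasStrictFDerivAt_coord (p : EuclideanSpace ℝ (ι ⊕ ι)) (j : ι ⊕ ι) :
    HasStrictFDerivAt (fun z : EuclideanSpace ℝ (ι ⊕ ι) => z j)
      (EuclideanSpace.proj (𝕜 := ℝ) j : EuclideanSpace ℝ (ι ⊕ ι) →L[ℝ] ℝ) p :=
  (EuclideanSpace.proj (𝕜 := ℝ) j).hasStrictFDerivAt

variable [Fintype ι]

theorem isFiniteUnionPreconnected_expVariety {S : Finset ι}
    (hfin : ∀ P : Ideal (MvPolynomial (ι ⊕ ι) ℚ), P.IsPrime →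
      (∀ Y ∈ tangentFields S P, ∀ j, Y j ∈ P) →
      ∃ δ ∉ P, (expVariety S P ∩ {z | evalAt z δ ≠ 0}).Finite)
    (J : Ideal (MvPolynomial (ι ⊕ ι) ℚ)) (h : MvPolynomial (ι ⊕ ι) ℚ) :
    IsFiniteUnionPreconnected (expVariety S J ∩ {z | evalAt z h ≠ 0}) := by
  refine expVariety_induction (.of_finite finite_empty) (fun A B => .union) (fun P hP ih => ?_) J
  by_cases hh : h ∈ P
  · rw [show expVariety S P ∩ {z | evalAt z h ≠ 0} = ∅ from
      eq_empty_of_forall_notMem fun z hz => hz.2 (hz.1.1 h hh)]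
    exact .of_finite finite_empty
  by_cases hN : ∀ Y ∈ tangentFields S P, ∀ j, Y j ∈ P
  · obtain ⟨δ, hδ, hf⟩ := hfin P hP hN
    rw [expVariety_inter_eq_union P δ]
    exact .union (.of_finite (hf.subset inter_subset_left)) (ih _ (lt_sup_span hδ))
  · push Not at hN
    obtain ⟨Y, hY, j, hj⟩ := hN
    obtain ⟨g, hg, hmeet⟩ := exists_notMem_meets_components hh hY hj
    exact (ih _ (lt_sup_span hg)).of_meets_components
      (inter_subset_inter_left _ (expVariety_anti le_sup_left)) hmeet

theorem hasStrictFDerivAt_sub_exp (p : EuclideanSpace ℝ (ι ⊕ ι)) (i : ι) :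
    HasStrictFDerivAt
      (fun z : EuclideanSpace ℝ (ι ⊕ ι) => z (.inr i) - Real.exp (z (.inl i)))
      ((EuclideanSpace.proj (.inr i) - Real.exp (p (.inl i)) • EuclideanSpace.proj (.inl i) :
        EuclideanSpace ℝ (ι ⊕ ι) →L[ℝ] ℝ)) p :=
  (hasStrictFDerivAt_coord p (.inr i)).sub (hasStrictFDerivAt_coord p (.inl i)).exp

theorem hasStrictFDerivAt_mul_exp_neg (p : EuclideanSpace ℝ (ι ⊕ ι)) (i : ι) :
    HasStrictFDerivAt
      (fun z : EuclideanSpace ℝ (ι ⊕ ι) => z (.inr i) * Real.exp (-z (.inl i)))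
      (Real.exp (-p (.inl i)) • (EuclideanSpace.proj (.inr i) -
        p (.inr i) • EuclideanSpace.proj (.inl i) : EuclideanSpace ℝ (ι ⊕ ι) →L[ℝ] ℝ)) p := by
  refine ((hasStrictFDerivAt_coord p (.inr i)).mul
    (hasStrictFDerivAt_coord p (.inl i)).neg.exp).congr_fderiv ?_
  ext v
  simp
  ring

section Insert

variable {S : Finset ι} {P : Ideal (MvPolynomial (ι ⊕ ι) ℚ)} {s : ι}
  {W : Set (EuclideanSpace ℝ (ι ⊕ ι))}

theorem isLocallyInjective_mul_exp_neg (hW : W ⊆ expVariety S P)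
    (hker : ∀ p ∈ W, ∀ v : EuclideanSpace ℝ (ι ⊕ ι), (∀ g ∈ P, dEval p g v = 0) →
      (∀ i, i = s ∨ i ∈ S → v (.inr i) = p (.inr i) * v (.inl i)) → v = 0) :
    IsLocallyInjective fun z : W => z.1 (.inr s) * Real.exp (-z.1 (.inl s)) := by
  rw [isLocallyInjective_iff_nhds]
  by_contra! hcon
  obtain ⟨p, hcon⟩ := hcon
  let R : Set (EuclideanSpace ℝ (ι ⊕ ι) × EuclideanSpace ℝ (ι ⊕ ι)) :=
    {z | z.1 ∈ W ∧ z.2 ∈ W ∧ z.1 ≠ z.2 ∧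
      z.1 (.inr s) * Real.exp (-z.1 (.inl s)) = z.2 (.inr s) * Real.exp (-z.2 (.inl s))}
  have hR : (p.1, p.1) ∈ closure R := by
    rw [Metric.mem_closure_iff]
    intro ε hε
    have := hcon _ (Metric.ball_mem_nhds p hε)
    simp only [InjOn] at this
    push Not at this
    obtain ⟨a, ha, b, hb, hab, hne⟩ := this
    refine ⟨(a.1, b.1), ⟨a.2, b.2, fun h => hne (Subtype.ext h), hab⟩, ?_⟩
    rw [Prod.dist_eq, dist_comm p.1, dist_comm p.1]
    exact max_lt ha hb
  obtain ⟨v, hv0, hv, -⟩ := exists_limit_secant hR fun z hz => hz.2.2.1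
  refine hv0 (hker p.1 p.2 v (fun g hg => ?_) ?_)
  · refine hv _ _ (hasStrictFDerivAt_evalAt p.1 g) fun z hz => ?_
    rw [(hW hz.1).1 g hg, (hW hz.2.1).1 g hg]
  · rintro i (rfl | hi)
    · have := hv _ _ (hasStrictFDerivAt_mul_exp_neg p.1 i) fun z hz => hz.2.2.2
      simpa [Real.exp_ne_zero, sub_eq_zero] using this
    · have := hv _ _ (hasStrictFDerivAt_sub_exp p.1 i) fun z hz => by
        rw [(hW hz.1).2 i hi, (hW hz.2.1).2 i hi, sub_self, sub_self]
      rw [(hW p.2).2 i hi]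
      simpa [sub_eq_zero] using this

theorem isOpenMap_mul_exp_neg {h : MvPolynomial (ι ⊕ ι) ℚ}
    {Y : ι ⊕ ι → MvPolynomial (ι ⊕ ι) ℚ} (hY : Y ∈ tangentFields S P)
    (hh : ∀ z, evalAt z h ≠ 0 → evalAt z (Y (.inr s) - X (.inr s) * Y (.inl s)) ≠ 0) :
    IsOpenMap fun z : ↥(expVariety S P ∩ {z | evalAt z h ≠ 0}) =>
      z.1 (.inr s) * Real.exp (-z.1 (.inl s)) := by
  rw [isOpenMap_iff_nhds_le]
  rintro ⟨p, hp⟩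
  obtain ⟨γ, rfl, hγ, hγJ⟩ := exists_integralCurve hY hp.1
  have hc : ContinuousAt γ 0 := hγ.self_of_nhds.continuousAt
  have hγh : ∀ᶠ t in 𝓝 0, evalAt (γ t) h ≠ 0 :=
    ((continuous_evalAt h).continuousAt.comp hc).eventually_ne hp.2
  have hcoord : ∀ j, ContinuousAt (fun t => γ t j) 0 := fun j =>
    (EuclideanSpace.proj (𝕜 := ℝ) j : EuclideanSpace ℝ (ι ⊕ ι) →L[ℝ] ℝ).continuous.continuousAt.comp
      hc
  let w := Y (.inr s) - X (.inr s) * Y (.inl s)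
  let f : EuclideanSpace ℝ (ι ⊕ ι) → ℝ := fun z => z (.inr s) * Real.exp (-z (.inl s))
  have hd : ∀ᶠ t in 𝓝 0, HasDerivAt (fun t => f (γ t))
      (Real.exp (-γ t (.inl s)) * evalAt (γ t) w) t := by
    filter_upwards [hγ] with t ht
    refine ((hasStrictFDerivAt_mul_exp_neg (γ t) s).hasFDerivAt.comp_hasDerivAt t ht).congr_deriv ?_
    simp [w, fieldAt_apply]
  have hstrict := hasStrictDerivAt_of_hasDerivAt_of_continuousAt hd
    ((hcoord _).neg.rexp.mul ((continuous_evalAt w).continuousAt.comp hc))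
  have hmap := hstrict.map_nhds_eq (mul_ne_zero (Real.exp_ne_zero _) (hh _ hp.2))
  change 𝓝 (f (γ 0)) ≤ _
  rw [← hmap]
  intro t ht
  rw [mem_map, mem_nhds_subtype] at ht
  obtain ⟨V, hV, hVt⟩ := ht
  rw [mem_map]
  filter_upwards [hc hV, hγJ, hγh] with r h1 h2 h3
  exact hVt (show (⟨γ r, h2, h3⟩ : ↥(expVariety S P ∩ {z | evalAt z h ≠ 0})) ∈ _ from h1)

theorem exists_finite_insert [DecidableEq ι]
    (hfin : ∀ P : Ideal (MvPolynomial (ι ⊕ ι) ℚ), P.IsPrime →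
      (∀ Y ∈ tangentFields S P, ∀ j, Y j ∈ P) →
      ∃ δ ∉ P, (expVariety S P ∩ {z | evalAt z δ ≠ 0}).Finite)
    (hP : P.IsPrime) (hN : ∀ Y ∈ tangentFields (insert s S) P, ∀ j, Y j ∈ P) :
    ∃ δ ∉ P, (expVariety (insert s S) P ∩ {z | evalAt z δ ≠ 0}).Finite := by
  by_cases hw : ∀ Y ∈ tangentFields S P, Y (.inr s) - X (.inr s) * Y (.inl s) ∈ P
  · obtain ⟨δ, hδ, hf⟩ := hfin P hP fun Y hY => hN Y ⟨hY.1, fun i hi => by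
      rcases Finset.mem_insert.mp hi with rfl | hi
      exacts [hw Y hY, hY.2 i hi]⟩
    exact ⟨δ, hδ, hf.subset (inter_subset_inter_left _
      (expVariety_anti_left (Finset.subset_insert s S)))⟩
  push Not at hw
  obtain ⟨Y, hY, hw⟩ := hw
  obtain ⟨δ, hδ, hker⟩ := exists_notMem_forall_eq_zero (insert s S) P
  set w := Y (.inr s) - X (.inr s) * Y (.inl s)
  refine ⟨δ * w, fun h => (hP.mem_or_mem h).elim hδ hw, ?_⟩
  set W := expVariety S P ∩ {z | evalAt z (δ * w) ≠ 0} with hW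
  have hWδ : ∀ z, evalAt z (δ * w) ≠ 0 → evalAt z δ ≠ 0 ∧ evalAt z w ≠ 0 := fun z hz => by
    rw [map_mul] at hz
    exact ⟨left_ne_zero_of_mul hz, right_ne_zero_of_mul hz⟩
  let f : EuclideanSpace ℝ (ι ⊕ ι) → ℝ := fun z => z (.inr s) * Real.exp (-z (.inl s))
  have hcoord : ∀ j, Continuous fun z : EuclideanSpace ℝ (ι ⊕ ι) => z j := fun j =>
    (EuclideanSpace.proj (𝕜 := ℝ) j).continuous
  have hf : Continuous f := (hcoord _).mul (Real.continuous_exp.comp (hcoord _).neg)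
  have hinj : IsLocallyInjective fun z : W => f z := by
    refine isLocallyInjective_mul_exp_neg (S := S) (P := P) inter_subset_left
      fun p hp v h1 h2 => ?_
    refine hker p ⟨hp.1.1, by simp⟩ (hWδ p hp.2).1 v h1
      (fun i hi => h2 i (Finset.mem_insert.mp hi)) fun Z hZ => ?_
    have : fieldAt Z p = 0 := by
      ext j
      exact hp.1.1 _ (hN Z hZ j)
    rw [this, inner_zero_left]
  have hhomeo : IsLocalHomeomorph fun z : W => f z :=
    (isOpenMap_mul_exp_neg hY fun z hz => (hWδ z hz).2).isLocalHomeomorph_of_isLocallyInjective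
      (hf.comp continuous_subtype_val) hinj
  refine ((isFiniteUnionPreconnected_expVariety hfin P (δ * w)).finite_fiber (u := f)
    (fun C hC hpre => ?_) 1).subset fun z hz => ⟨⟨expVariety_anti_left
      (Finset.subset_insert s S) hz.1, hz.2⟩, ?_⟩
  · have hpre' : IsPreconnected (Subtype.val ⁻¹' C : Set W) := by
      rwa [← IsInducing.subtypeVal.isPreconnected_image, Subtype.image_preimage_coe,
        inter_eq_right.mpr hC]
    intro a ha b hb hab
    exact congrArg Subtype.val (hhomeo.injOn_of_isPreconnected hpre' (x₁ := ⟨a, hC ha⟩) ha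
      (x₂ := ⟨b, hC hb⟩) hb hab)
  · have := hz.1.2 s (Finset.mem_insert_self s S)
    simp [f, this, ← Real.exp_add]

end Insert

theorem exists_finite_of_tangentFields_eq_zero (S : Finset ι)
    (P : Ideal (MvPolynomial (ι ⊕ ι) ℚ)) (hP : P.IsPrime)
    (hN : ∀ Y ∈ tangentFields S P, ∀ j, Y j ∈ P) :
    ∃ δ ∉ P, (expVariety S P ∩ {z | evalAt z δ ≠ 0}).Finite := by
  classical
  induction S using Finset.induction_on generalizing P with
  | empty =>
    exact ⟨1, fun h => hP.ne_top ((Ideal.eq_top_iff_one P).mpr h),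
      (finite_expVariety_empty hN).subset inter_subset_left⟩
  | insert s S _ ih => exact exists_finite_insert ih hP hN

end ExpVariety

namespace ExpVariety

open MvPolynomial

variable {ι : Type}

/-- The ideal of rational polynomials vanishing on a set of real points. -/
noncomputable def zeroIdeal (T : Set (EuclideanSpace ℝ (ι ⊕ ι))) :
    Ideal (MvPolynomial (ι ⊕ ι) ℚ) :=
  ⨅ z ∈ T, RingHom.ker (evalAt z)

theorem mem_zeroIdeal {T : Set (EuclideanSpace ℝ (ι ⊕ ι))} {g : MvPolynomial (ι ⊕ ι) ℚ} :
    g ∈ zeroIdeal T ↔ ∀ z ∈ T, evalAt z g = 0 := by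
  simp [zeroIdeal, RingHom.mem_ker]

variable [Fintype ι]

theorem tangentFields_subset_zeroIdeal {S : Finset ι} {P : Ideal (MvPolynomial (ι ⊕ ι) ℚ)}
    {T V : Set (EuclideanSpace ℝ (ι ⊕ ι))} (hV : IsOpen V) (hTV : T ⊆ V)
    (hTP : T ⊆ expVariety S P) (hVT : expVariety S P ∩ V ⊆ T) :
    tangentFields S P ⊆ tangentFields S (zeroIdeal T) := by
  intro Y hY
  refine ⟨fun g hg => mem_zeroIdeal.mpr fun z hz => ?_, fun i hi => mem_zeroIdeal.mpr fun z hz =>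
    (hTP hz).1 _ (hY.2 i hi)⟩
  obtain ⟨γ, rfl, hγ, hγP⟩ := exists_integralCurve hY (hTP hz)
  have hγV : ∀ᶠ t in 𝓝 0, γ t ∈ V :=
    hγ.self_of_nhds.continuousAt (hV.mem_nhds (hTV hz))
  refine (hasDerivAt_evalAt hγ.self_of_nhds g).unique ((hasDerivAt_const 0 0).congr_of_eventuallyEq ?_)
  filter_upwards [hγP, hγV] with t h1 h2 using mem_zeroIdeal.mp hg _ (hVT ⟨h1, h2⟩)

/-- If countably many polynomial conditions cover the exponential points of `J`, finitely many of
them do. -/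
theorem exists_finset_cover {κ : Type*} [Countable κ] {f : κ → MvPolynomial (ι ⊕ ι) ℚ}
    {J : Ideal (MvPolynomial (ι ⊕ ι) ℚ)}
    (hJ : ∀ z ∈ expVariety Finset.univ J, ∃ m, evalAt z (f m) = 0) :
    ∃ t : Finset κ, ∀ z ∈ expVariety Finset.univ J, ∃ m ∈ t, evalAt z (f m) = 0 := by
  classical
  suffices h : (∀ z ∈ expVariety Finset.univ J ∩ univ, ∃ m, evalAt z (f m) = 0) →
      ∃ t : Finset κ, ∀ z ∈ expVariety Finset.univ J ∩ univ, ∃ m ∈ t, evalAt z (f m) = 0 by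
    simpa using h (by simpa using hJ)
  refine expVariety_induction
    (p := fun A => (∀ z ∈ A, ∃ m, evalAt z (f m) = 0) →
      ∃ t : Finset κ, ∀ z ∈ A, ∃ m ∈ t, evalAt z (f m) = 0) (by simp) ?_ ?_ J
  · intro A B hA hB h
    obtain ⟨t, ht⟩ := hA fun z hz => h z (.inl hz)
    obtain ⟨t', ht'⟩ := hB fun z hz => h z (.inr hz)
    refine ⟨t ∪ t', fun z hz => ?_⟩
    rcases hz with hz | hz
    · obtain ⟨m, hm, h⟩ := ht z hz
      exact ⟨m, Finset.mem_union_left _ hm, h⟩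
    · obtain ⟨m, hm, h⟩ := ht' z hz
      exact ⟨m, Finset.mem_union_right _ hm, h⟩
  intro P hP ih hcover
  obtain ⟨δ, hδ, hker⟩ := exists_notMem_forall_eq_zero Finset.univ P
  obtain ⟨t₂, ht₂⟩ := ih _ (lt_sup_span hδ) fun z hz =>
    hcover z ⟨expVariety_anti le_sup_left hz.1, hz.2⟩
  set W := expVariety Finset.univ P ∩ {z | evalAt z δ ≠ 0} with hW
  have hopen : IsOpen {z : EuclideanSpace ℝ (ι ⊕ ι) | evalAt z δ ≠ 0} :=
    isOpen_ne_fun (continuous_evalAt δ) continuous_const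
  have : LocallyCompactSpace W :=
    ((isClosed_expVariety _ _).isLocallyClosed.inter hopen.isLocallyClosed).locallyCompactSpace
  let F : κ → Set W := fun m => {z | evalAt z.1 (f m) = 0}
  have hF : ∀ m, IsClosed (F m) := fun m =>
    isClosed_eq ((continuous_evalAt (f m)).comp continuous_subtype_val) continuous_const
  have hdense : Dense (⋃ m, interior (F m)) := dense_iUnion_interior_of_closed hF
    (eq_univ_of_forall fun z => mem_iUnion.mpr (hcover z.1 ⟨z.2.1, trivial⟩))
  let Q : κ → Ideal (MvPolynomial (ι ⊕ ι) ℚ) := fun m =>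
    zeroIdeal (Subtype.val '' interior (F m))
  let Y : κ → Set W := fun m => Subtype.val ⁻¹' expVariety Finset.univ (Q m)
  have hPQ : ∀ m, P ≤ Q m := fun m g hg => mem_zeroIdeal.mpr (by
    rintro _ ⟨z, -, rfl⟩
    exact z.2.1.1 g hg)
  have hfield : ∀ m, tangentFields Finset.univ P ⊆ tangentFields Finset.univ (Q m) := fun m => by
    obtain ⟨V, hV, hVF⟩ := isOpen_induced_iff.mp (isOpen_interior (s := F m))
    refine tangentFields_subset_zeroIdeal (hV.inter hopen) ?_ ?_ ?_
    · rintro _ ⟨z, hz, rfl⟩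
      exact ⟨show z ∈ Subtype.val ⁻¹' V from hVF.symm ▸ hz, z.2.2⟩
    · rintro _ ⟨z, -, rfl⟩
      exact z.2.1
    · rintro z ⟨hz, hzV, hzδ⟩
      refine ⟨⟨z, hz, hzδ⟩, ?_, rfl⟩
      rw [← hVF]
      exact hzV
  have hY : ∀ m, IsClopen (Y m) := fun m => by
    refine ⟨(isClosed_expVariety _ _).preimage continuous_subtype_val,
      isOpen_iff_mem_nhds.mpr fun p hp => ?_⟩
    have hev := eventually_mem_of_invariant (p := p.1)
      (𝒳 := fieldAt '' tangentFields Finset.univ P) (isClosed_expVariety Finset.univ (Q m))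
      (expVariety_anti (hPQ m)) hp
      (by rintro _ ⟨X, -, rfl⟩; exact (contDiff_fieldAt X).continuous.continuousAt)
      (by
        rintro _ ⟨X, hX, rfl⟩ z hz
        obtain ⟨γ, rfl, h1, h2⟩ := exists_integralCurve (hfield m hX) hz
        exact ⟨γ, rfl, h1.self_of_nhds, h2⟩)
      (fun v h1 h2 => hker p.1 ⟨p.2.1.1, by simp⟩ p.2.2 v
        (fun g hg => h1 _ _ (hasStrictFDerivAt_evalAt p.1 g) fun z hz => hz.1 g hg)
        (fun i hi => by
          have := h1 _ _ (hasStrictFDerivAt_sub_exp p.1 i) fun z hz => sub_eq_zero.mpr (hz.2 i hi)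
          rw [p.2.1.2 i hi]
          simpa [sub_eq_zero] using this)
        fun X hX => h2 _ ⟨X, hX, rfl⟩)
    rw [mem_nhds_subtype]
    exact ⟨_, hev, fun q hq => hq q.2.1⟩
  have hYd : Dense (⋃ m, Y m) := hdense.mono (iUnion_mono fun m z hz =>
    ⟨fun g hg => mem_zeroIdeal.mp hg _ ⟨z, hz, rfl⟩, z.2.1.2⟩)
  obtain ⟨t₁, ht₁⟩ := (isFiniteUnionPreconnected_expVariety
    (exists_finite_of_tangentFields_eq_zero _) P δ).exists_finite_cover hY hYd
  refine ⟨t₁ ∪ t₂, fun z hz => ?_⟩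
  by_cases hzδ : evalAt z δ = 0
  · obtain ⟨m, hm, h⟩ := ht₂ z ⟨mem_expVariety_sup_span hz.1 hzδ, hz.2⟩
    exact ⟨m, Finset.mem_union_right _ hm, h⟩
  · obtain ⟨m, hm, h⟩ := mem_iUnion₂.mp (eq_univ_iff_forall.mp ht₁ ⟨z, hz.1, hzδ⟩)
    refine ⟨m, Finset.mem_union_left _ hm, h.1 _ (mem_zeroIdeal.mpr ?_)⟩
    rintro _ ⟨q, hq, rfl⟩
    exact show q ∈ F m from interior_subset hq

end ExpVariety

end RealVarieties

/-- Krull dimension is invariant under injective integral extensions. -/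
theorem ringKrullDim_eq_of_isIntegral (R S : Type*) [CommRing R] [CommRing S] [Algebra R S]
    [Algebra.IsIntegral R S] (h : Function.Injective (algebraMap R S)) :
    ringKrullDim R = ringKrullDim S := by
  apply le_antisymm
  · refine iSup_le fun l => ?_
    obtain ⟨Q, -, hQ, hQl⟩ := Ideal.exists_ideal_over_prime_of_isIntegral
      (l.head.asIdeal) (⊥ : Ideal S)
      (by rw [← RingHom.ker_eq_comap_bot, (RingHom.injective_iff_ker_eq_bot _).1 h]; exact bot_le)
    have : Q.LiesOver l.head.asIdeal := ⟨hQl.symm⟩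
    obtain ⟨L, hL, -⟩ := Ideal.exists_ltSeries_of_hasGoingUp l Q
    rw [← hL]
    exact le_iSup (fun l : LTSeries (PrimeSpectrum S) => ((l.length : ℕ∞) : WithBot ℕ∞)) L
  · exact Order.krullDim_le_of_strictMono (PrimeSpectrum.comap (algebraMap R S))
      fun P Q hPQ => Ideal.IsIntegral.comap_lt_comap hPQ

/-- The Krull dimension of a finitely generated domain over a field is its transcendence degree. -/
theorem exists_ringKrullDim_eq_trdeg_eq (k B : Type*) [Field k] [CommRing B] [IsDomain B]
    [Algebra k B] [Algebra.FiniteType k B] :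
    ∃ s : ℕ, ringKrullDim B = s ∧ Algebra.trdeg k B = s := by
  obtain ⟨s, g, hg, hgi⟩ := exists_integral_inj_algHom_of_fg k B
  algebraize [g.toRingHom]
  have : IsScalarTower k (MvPolynomial (Fin s) k) B := .of_algebraMap_eq' g.comp_algebraMap.symm
  have : FaithfulSMul (MvPolynomial (Fin s) k) B := (faithfulSMul_iff_algebraMap_injective _ _).2 hg
  refine ⟨s, ?_, ?_⟩
  · rw [← ringKrullDim_eq_of_isIntegral (MvPolynomial (Fin s) k) B hg]
    simp [MvPolynomial.ringKrullDim_of_isNoetherianRing]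
  · have := lift_trdeg_add_eq k (MvPolynomial (Fin s) k) B
    simpa [trdeg_eq_zero (R := MvPolynomial (Fin s) k) (A := B)] using this.symm

open scoped IntermediateField.algebraAdjoinAdjoin in
/-- The transcendence degree of the field generated by finitely many elements is the Krull
dimension of the quotient by the ideal of algebraic relations between them. -/
theorem exists_ringKrullDim_eq_trdeg_adjoin_eq {k L σ : Type*} [Field k] [Field L] [Algebra k L]
    [Finite σ] (x : σ → L) :
    ∃ s : ℕ, ringKrullDim
        (MvPolynomial σ k ⧸ RingHom.ker (MvPolynomial.aeval x : MvPolynomial σ k →ₐ[k] L)) = s ∧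
      Algebra.trdeg k (IntermediateField.adjoin k (Set.range x)) = s := by
  have hfg : Algebra.FiniteType k (Algebra.adjoin k (Set.range x)) :=
    .adjoin_of_finite (Set.finite_range x)
  obtain ⟨s, hs, hs'⟩ := exists_ringKrullDim_eq_trdeg_eq k (Algebra.adjoin k (Set.range x))
  refine ⟨s, ?_, ?_⟩
  · rw [← hs]
    refine ringKrullDim_eq_of_ringEquiv ?_
    exact ((Ideal.quotientKerEquivRange (MvPolynomial.aeval x : MvPolynomial σ k →ₐ[k] L)).trans
      (Subalgebra.equivOfEq _ _ (Algebra.adjoin_range_eq_range_aeval k x).symm)).toRingEquiv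
  · rw [← hs', ← trdeg_add_eq k (Algebra.adjoin k (Set.range x))
      (A := IntermediateField.adjoin k (Set.range x)),
      trdeg_eq_zero (R := Algebra.adjoin k (Set.range x)), add_zero]

/-- The equivalence splitting `Fin (2 * n)` into even and odd indices. -/
def evenOddEquiv (n : ℕ) : Fin n ⊕ Fin n ≃ Fin (2 * n) where
  toFun := Sum.elim (fun i => ⟨2 * i, by omega⟩) (fun i => ⟨2 * i + 1, by omega⟩)
  invFun j := if j.val % 2 = 0 then .inl ⟨j / 2, by omega⟩ else .inr ⟨j / 2, by omega⟩
  left_inv := by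
    rintro (i | i)
    · simp
    · simp [Nat.add_mod, show (2 * (i : ℕ) + 1) / 2 = i by omega]
  right_inv j := by
    by_cases h : j.val % 2 = 0 <;> simp only [h, if_true, if_false] <;> ext <;> simp <;> omega

theorem expPoint_evenOddEquiv {n : ℕ} (a : Fin n → ℝ) (j : Fin n ⊕ Fin n) :
    expPoint a (evenOddEquiv n j) = Sum.elim a (fun i => Real.exp (a i)) j := by
  rcases j with i | i
  · simp [expPoint, evenOddEquiv]
  · simp [expPoint, evenOddEquiv, Nat.add_mod, show (2 * (i : ℕ) + 1) / 2 = i by omega]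

theorem range_expPoint {n : ℕ} (a : Fin n → ℝ) :
    Set.range (expPoint a) = Set.range a ∪ Set.range fun i => Real.exp (a i) := by
  rw [← Set.Sum.elim_range, ← (evenOddEquiv n).surjective.range_comp (expPoint a)]
  exact congrArg Set.range (funext (expPoint_evenOddEquiv a))

/-- The ideal of polynomials over `ℚ` vanishing at `expPoint a` has quotient of Krull dimension
`trdeg_ℚ (a, exp a)`. -/
theorem exists_ringKrullDim_expPoint_eq {n : ℕ} (a : Fin n → ℝ) :
    ∃ s : ℕ, ringKrullDim (MvPolynomial (Fin (2 * n)) ℚ ⧸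
        RingHom.ker (MvPolynomial.aeval (expPoint a) : MvPolynomial (Fin (2 * n)) ℚ →ₐ[ℚ] ℝ)) = s ∧
      trdeg ℚ (IntermediateField.adjoin ℚ
        (Set.range a ∪ Set.range fun i => Real.exp (a i))) = s := by
  rw [← range_expPoint]
  exact exists_ringKrullDim_eq_trdeg_adjoin_eq (expPoint a)

/-- Under the real Schanuel conjecture, a point of the exponential graph on a variety of small
dimension has an integer relation among its coordinates. -/
theorem RealSchanuel.exists_int_relation (hSC : RealSchanuel) {n : ℕ}
    {I : Ideal (MvPolynomial (Fin (2 * n)) ℚ)}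
    (hI : ringKrullDim (MvPolynomial (Fin (2 * n)) ℚ ⧸ I) < n) {a : Fin n → ℝ}
    (ha : ∀ p ∈ I, MvPolynomial.aeval (expPoint a) p = 0) :
    ∃ m : Fin n → ℤ, m ≠ 0 ∧ ∑ i, m i • a i = 0 := by
  have hdep : ¬ LinearIndependent ℚ a := by
    intro hlin
    obtain ⟨s, hs, hs'⟩ := exists_ringKrullDim_expPoint_eq a
    have hle := hSC n a hlin
    rw [hs', Nat.cast_le] at hle
    have hdim := ringKrullDim_le_of_surjective _ (Ideal.Quotient.factor_surjective (S := I)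
      (T := RingHom.ker (MvPolynomial.aeval (expPoint a) :
        MvPolynomial (Fin (2 * n)) ℚ →ₐ[ℚ] ℝ)) ha)
    rw [hs] at hdim
    have hlt := hdim.trans_lt hI
    exact hle.not_gt (by exact_mod_cast hlt)
  rw [← LinearIndependent.iff_fractionRing ℤ ℚ, Fintype.not_linearIndependent_iff] at hdep
  obtain ⟨m, hm, i, hi⟩ := hdep
  exact ⟨m, fun h => hi (congrFun h i), hm⟩

open ExpVariety in
theorem RealSchanuel.realUniformSchanuel (hSC : RealSchanuel) : RealUniformSchanuel := by
  intro n I hI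
  let J : Ideal (MvPolynomial (Fin n ⊕ Fin n) ℚ) :=
    I.comap (MvPolynomial.rename (evenOddEquiv n) : MvPolynomial (Fin n ⊕ Fin n) ℚ →ₐ[ℚ] _)
  have haeval (a : Fin n → ℝ) (q : MvPolynomial (Fin n ⊕ Fin n) ℚ) :
      MvPolynomial.aeval (expPoint a) (MvPolynomial.rename (evenOddEquiv n) q) =
        MvPolynomial.aeval (Sum.elim a fun i => Real.exp (a i)) q := by
    rw [MvPolynomial.aeval_rename]
    exact congrArg (fun x => MvPolynomial.aeval x q) (funext (expPoint_evenOddEquiv a))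
  let f : {m : Fin n → ℤ // m ≠ 0} → MvPolynomial (Fin n ⊕ Fin n) ℚ :=
    fun m => ∑ i, m.1 i • MvPolynomial.X (.inl i)
  have hf (z : EuclideanSpace ℝ (Fin n ⊕ Fin n)) (m) :
      evalAt z (f m) = ∑ i, m.1 i • z (.inl i) := by
    simp [evalAt, f]
  obtain ⟨t, ht⟩ := exists_finset_cover (f := f) (J := J) fun z hz => by
    have hza : z.ofLp = Sum.elim (fun i => z (.inl i)) fun i => Real.exp (z (.inl i)) := by
      ext (i | i)
      · rfl
      · exact hz.2 i (Finset.mem_univ i)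
    obtain ⟨m, hm, hrel⟩ := hSC.exists_int_relation hI (a := fun i => z (.inl i)) fun p hp => by
      obtain ⟨q, rfl⟩ := (MvPolynomial.renameEquiv ℚ (evenOddEquiv n)).surjective p
      rw [MvPolynomial.renameEquiv_apply] at hp ⊢
      rw [haeval, ← hza]
      exact hz.1 q hp
    exact ⟨⟨m, hm⟩, (hf z _).trans hrel⟩
  classical
  refine ⟨t.image Subtype.val, fun m hm => ?_, fun a ha => ?_⟩
  · obtain ⟨m, -, rfl⟩ := Finset.mem_image.1 hm
    exact m.2
  · obtain ⟨m, hm, hrel⟩ := ht (WithLp.toLp 2 (Sum.elim a fun i => Real.exp (a i)))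
      ⟨fun q hq => (haeval a q).symm.trans (ha _ hq), fun i _ => rfl⟩
    exact ⟨m, Finset.mem_image_of_mem _ hm, (hf _ m).symm.trans hrel⟩

theorem RealUniformSchanuel.realSchanuel (hUSC : RealUniformSchanuel) : RealSchanuel := by
  intro n a ha
  obtain ⟨s, hs, hs'⟩ := exists_ringKrullDim_expPoint_eq a
  rw [hs', Nat.cast_le]
  by_contra! hlt
  obtain ⟨M, hM, h⟩ := hUSC n _ (hs.trans_lt (by exact_mod_cast hlt))
  obtain ⟨m, hm, hrel⟩ := h a fun p hp => hp
  rw [← LinearIndependent.iff_fractionRing ℤ ℚ, Fintype.linearIndependent_iff] at ha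
  exact hM m hm (funext (ha m hrel))

/-- **Equivalence of the real Schanuel conjecture and the real uniform Schanuel
conjecture.** -/
theorem real_sc_iff_real_usc : RealSchanuel ↔ RealUniformSchanuel :=
  ⟨RealSchanuel.realUniformSchanuel, RealUniformSchanuel.realSchanuel⟩
end

section
/- (Wilkie's theorem on powers 1 + ir). Let r be a real number such that r is not exponentially algebraic in ℂ_exp. If a₁,…,aₙ are nonzero real numbers that are multiplicatively independent, then 2 · trdeg_ℚ(a₁^{1+ir},…,aₙ^{1+ir}) ≥ n, where a^{1+ir} denotes the principal complex power. -/
set_option maxHeartbeats 1000000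
set_option synthInstance.maxHeartbeats 400000

/-- Membership in the smallest subring of functions `ℂⁿ → ℂ` containing the
coordinate projections and closed under `f ↦ exp ∘ f` (exponential polynomials). -/
inductive IsExpPoly {n : ℕ} : ((Fin n → ℂ) → ℂ) → Prop
  | proj (i : Fin n) : IsExpPoly fun x => x i
  | zero : IsExpPoly 0
  | one : IsExpPoly 1
  | neg {f} : IsExpPoly f → IsExpPoly (-f)
  | add {f g} : IsExpPoly f → IsExpPoly g → IsExpPoly (f + g)
  | mul {f g} : IsExpPoly f → IsExpPoly g → IsExpPoly (f * g)
  | exp {f} : IsExpPoly f → IsExpPoly fun x => Complex.exp (f x)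

/-- A complex number `γ` is exponentially algebraic in `ℂ_exp` iff there are `n ≥ 1`,
a point `a ∈ ℂⁿ` with first coordinate `γ`, and exponential polynomials `f₁,…,fₙ`
vanishing at `a` whose Jacobian determinant at `a` is nonzero. -/
def ExpAlgebraic (γ : ℂ) : Prop :=
  ∃ (n : ℕ) (hn : 0 < n) (a : Fin n → ℂ) (f : Fin n → (Fin n → ℂ) → ℂ),
    a ⟨0, hn⟩ = γ ∧ (∀ i, IsExpPoly (f i)) ∧ (∀ i, f i a = 0) ∧
    (Matrix.of fun i j => fderiv ℂ (f i) a (Pi.single j 1)).det ≠ 0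

lemma Algebra.FormallySmooth.of_injective_algebraMap_of_charZero (A K : Type*) [CommRing A]
    [IsDomain A] [Field K] [CharZero K] [Algebra A K]
    (h : Function.Injective (algebraMap A K)) : Algebra.FormallySmooth A K := by
  have : FaithfulSMul A K := (faithfulSMul_iff_algebraMap_injective A K).2 h
  let _ : Algebra (FractionRing A) K := FractionRing.liftAlgebra A K
  have : IsScalarTower A (FractionRing A) K := FractionRing.isScalarTower_liftAlgebra A K
  have : CharZero (FractionRing A) := (algebraMap (FractionRing A) K).charZero
  have : Algebra.FormallySmooth A (FractionRing A) :=
    .of_isLocalization (nonZeroDivisors A)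
  obtain ⟨ι, s, hs⟩ := exists_isTranscendenceBasis' (FractionRing A) K
  have : Algebra.IsAlgebraic (IntermediateField.adjoin (FractionRing A) (Set.range s)) K :=
    hs.isAlgebraic_field
  have : Algebra.FormallySmooth (FractionRing A) K :=
    .of_algebraicIndependent_of_isSeparable hs.1
  exact .comp A (FractionRing A) K

lemma Algebra.FormallySmooth.exists_ringHom_lift {A K B : Type*} [CommRing A] [CommRing K]
    [CommRing B] [Algebra A K] [Algebra.FormallySmooth A K] (φ : A →+* B) (g : B →+* K)
    (hg : Function.Surjective g) (hker : IsNilpotent (RingHom.ker g))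
    (hφ : ∀ a, g (φ a) = algebraMap A K a) :
    ∃ s : K →+* B, (∀ x, g (s x) = x) ∧ ∀ a, s (algebraMap A K a) = φ a := by
  let _ : Algebra A B := φ.toAlgebra
  let g' : B →ₐ[A] K := { g with commutes' := hφ }
  refine ⟨(Algebra.FormallySmooth.liftOfSurjective (AlgHom.id A K) g' hg hker : K →ₐ[A] B),
    fun x => ?_, fun a => AlgHom.commutes _ a⟩
  exact Algebra.FormallySmooth.liftOfSurjective_apply (AlgHom.id A K) g' hg hker x

/-- A ring homomorphism from a domain `A` to the dual numbers over a field `K` of characteristic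
zero lifting an embedding `A → K` extends to a derivation of `K`. -/
lemma exists_derivation_of_ringHom_trivSqZeroExt {A K : Type*} [CommRing A] [IsDomain A] [Field K]
    [CharZero K] (f : A →+* K) (hf : Function.Injective f) (φ : A →+* TrivSqZeroExt K K)
    (hφ : ∀ a, (φ a).fst = f a) :
    ∃ D : Derivation ℤ K K, ∀ a, D (f a) = (φ a).snd := by
  let _ : Algebra A K := f.toAlgebra
  have := Algebra.FormallySmooth.of_injective_algebraMap_of_charZero A K hf
  obtain ⟨s, hs, hs'⟩ := Algebra.FormallySmooth.exists_ringHom_lift φ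
    (TrivSqZeroExt.fstHom K K K : TrivSqZeroExt K K →+* K)
    (fun x => ⟨TrivSqZeroExt.inl x, rfl⟩) ⟨2, TrivSqZeroExt.kerIdeal_sq K K⟩ hφ
  have hs1 : ∀ x, (s x).fst = x := hs
  refine ⟨Derivation.mk' ((TrivSqZeroExt.sndHom K K).toAddMonoidHom.comp
    s.toAddMonoidHom).toIntLinearMap ?_, ?_⟩
  · intro a b
    show (s (a * b)).snd = a • (s b).snd + b • (s a).snd
    rw [map_mul, TrivSqZeroExt.snd_mul, hs1, hs1]
    simp [mul_comm]
  · intro a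
    show (s (f a)).snd = _
    rw [← hs' a]; rfl

open Polynomial in
lemma exists_derivation_apply_eq_one {k K : Type*} [Field k] [Field K] [CharZero K] [Algebra k K]
    {t : K} (ht : Transcendental k t) : ∃ δ : Derivation k K K, δ t = 1 := by
  let φ : k[X] →+* TrivSqZeroExt K K :=
    eval₂RingHom ((TrivSqZeroExt.inlHom K K).comp (algebraMap k K))
      (TrivSqZeroExt.inl t + TrivSqZeroExt.inr 1)
  obtain ⟨D, hD⟩ := exists_derivation_of_ringHom_trivSqZeroExt (aeval (R := k) t : k[X] →+* K)
    (transcendental_iff_injective.1 ht) φ (by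
      intro a
      have : ((TrivSqZeroExt.fstHom K K K : TrivSqZeroExt K K →+* K).comp φ) =
          (aeval (R := k) t : k[X] →+* K) := by
        ext <;> simp [φ]
      exact congrArg (fun f : k[X] →+* K => f a) this)
  have hk : ∀ c : k, D (algebraMap k K c) = 0 := fun c => by
    simpa [φ] using hD (C c)
  refine ⟨Derivation.mk' { toFun := D, map_add' := map_add D, map_smul' := fun c x => ?_ }
    fun a b => ?_, ?_⟩
  · rw [Algebra.smul_def, Derivation.leibniz, hk]; simp [Algebra.smul_def]
  · exact D.leibniz a b
  · simpa [φ] using hD X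

/-- A derivation vanishes on elements algebraic over the base field, in characteristic zero. -/
lemma Derivation.apply_eq_zero_of_isAlgebraic {k K : Type*} [Field k] [Field K] [CharZero K]
    [Algebra k K] (δ : Derivation k K K) {x : K} (hx : IsAlgebraic k x) : δ x = 0 := by
  have : CharZero k := (algebraMap k K).charZero
  have hi := hx.isIntegral
  have h := δ.map_aeval (minpoly k x) x
  rw [minpoly.aeval, map_zero] at h
  have hs : (Polynomial.aeval x) (Polynomial.derivative (minpoly k x)) ≠ 0 :=
    (minpoly.irreducible hi).separable.aeval_derivative_ne_zero (minpoly.aeval k x)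
  simpa [hs] using h.symm

namespace Polynomial

variable {k K : Type*} [Field k] [Field K] [Algebra k K]

/-- The maximal ideal of the local ring at zero of the field `k(t)`, inside an extension of it. -/
def maximalIdealAtZero (k : Type*) {K : Type*} [Field k] [Field K] [Algebra k K] (t : K)
    (_ht : Transcendental k t) : Submodule k K where
  carrier := {x | ∃ p q : k[X], q.coeff 0 ≠ 0 ∧ p.coeff 0 = 0 ∧ x * aeval t q = aeval t p}
  zero_mem' := ⟨0, 1, by simp⟩
  add_mem' := by
    rintro x y ⟨p, q, hq, hp, h⟩ ⟨p', q', hq', hp', h'⟩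
    refine ⟨p * q' + p' * q, q * q', ?_, ?_, ?_⟩
    · simp [mul_coeff_zero, hq, hq']
    · simp [mul_coeff_zero, hp, hp']
    · simp only [map_mul, map_add, ← h, ← h']; ring
  smul_mem' := by
    rintro c x ⟨p, q, hq, hp, h⟩
    refine ⟨C c * p, q, hq, by simp [hp], ?_⟩
    rw [map_mul, ← h, aeval_C, Algebra.smul_def, mul_assoc]

variable {t : K}

lemma aeval_ne_zero_of_transcendental (ht : Transcendental k t) {q : k[X]} (hq : q ≠ 0) :
    aeval t q ≠ 0 := fun h =>
  hq ((transcendental_iff.1 ht) q h)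

lemma aeval_mul_mem_maximalIdealAtZero (ht : Transcendental k t) (r : k[X]) {x : K}
    (hx : x ∈ maximalIdealAtZero k t ht) :
    aeval t r * x ∈ maximalIdealAtZero k t ht := by
  obtain ⟨p, q, hq, hp, h⟩ := hx
  refine ⟨r * p, q, hq, by simp [mul_coeff_zero, hp], ?_⟩
  rw [map_mul, ← h, mul_assoc]

lemma div_notMem_maximalIdealAtZero (ht : Transcendental k t) {a b : k[X]}
    (ha : a.coeff 0 ≠ 0) (hb : b.coeff 0 ≠ 0) :
    aeval t a / aeval t b ∉ maximalIdealAtZero k t ht := by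
  rintro ⟨p, q, hq, hp, h⟩
  have hb' : aeval t b ≠ 0 := aeval_ne_zero_of_transcendental ht (by rintro rfl; simp at hb)
  rw [div_mul_eq_mul_div, div_eq_iff hb', ← map_mul, ← map_mul] at h
  have := congrArg (fun r : k[X] => r.coeff 0) (transcendental_iff_injective.1 ht h)
  simp [mul_coeff_zero, hp, ha, hq] at this

variable {δ : Derivation k K K}

lemma derivation_apply_aeval (hδ : δ t = 1) (p : k[X]) :
    δ (aeval t p) = aeval t (derivative p) := by
  rw [δ.map_aeval, hδ, smul_eq_mul, mul_one]

lemma mul_derivation_div_mem_maximalIdealAtZero (ht : Transcendental k t) (hδ : δ t = 1)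
    (a : k[X]) {b : k[X]} (hb : b.coeff 0 ≠ 0) :
    t * δ (aeval t a / aeval t b) ∈ maximalIdealAtZero k t ht := by
  have hb' : aeval t b ≠ 0 := aeval_ne_zero_of_transcendental ht (by rintro rfl; simp at hb)
  refine ⟨X * (derivative a * b - a * derivative b), b ^ 2, by simp [pow_two, mul_coeff_zero, hb],
    by simp [mul_coeff_zero], ?_⟩
  rw [Derivation.leibniz_div, derivation_apply_aeval hδ, derivation_apply_aeval hδ]
  simp only [map_mul, map_sub, map_pow, aeval_X, smul_eq_mul]
  field_simp

lemma mul_logDeriv_mem_maximalIdealAtZero (ht : Transcendental k t) (hδ : δ t = 1) {a : k[X]}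
    (ha : a.coeff 0 ≠ 0) :
    t * (δ (aeval t a) / aeval t a) ∈ maximalIdealAtZero k t ht := by
  have ha' : aeval t a ≠ 0 := aeval_ne_zero_of_transcendental ht (by rintro rfl; simp at ha)
  refine ⟨X * derivative a, a, ha, by simp [mul_coeff_zero], ?_⟩
  rw [derivation_apply_aeval hδ, map_mul, aeval_X]
  field_simp

lemma exists_eq_zpow_mul_div_of_mem_adjoin (ht : Transcendental k t) {x : K}
    (hx : x ∈ IntermediateField.adjoin k {t}) (hx0 : x ≠ 0) :
    ∃ (m : ℤ) (a b : k[X]), a.coeff 0 ≠ 0 ∧ b.coeff 0 ≠ 0 ∧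
      x = t ^ m * (aeval t a / aeval t b) := by
  have ht0 : t ≠ 0 := fun e => ht (e ▸ isAlgebraic_zero)
  have key : ∀ p : k[X], p ≠ 0 → ∃ (m : ℕ) (a : k[X]), a.coeff 0 ≠ 0 ∧ p = X ^ m * a := by
    intro p hp
    obtain ⟨a, ha, hdvd⟩ := exists_eq_pow_rootMultiplicity_mul_and_not_dvd p hp 0
    refine ⟨_, a, ?_, by simpa using ha⟩
    simpa [X_dvd_iff] using hdvd
  obtain ⟨r, s, rfl⟩ := IntermediateField.mem_adjoin_simple_iff k x |>.1 hx
  obtain ⟨m, a, ha, rfl⟩ := key r (by rintro rfl; simp at hx0)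
  obtain ⟨n, b, hb, rfl⟩ := key s (by rintro rfl; simp at hx0)
  refine ⟨m - n, a, b, ha, hb, ?_⟩
  simp only [map_mul, map_pow, aeval_X, zpow_sub₀ ht0, zpow_natCast]
  field_simp

variable [CharZero K]

/-- The sum of residues at zero of a logarithmic form which is exact vanishes. -/
lemma sum_mul_eq_zero_of_sum_logDeriv_eq_derivation (ht : Transcendental k t)
    (hδ : δ t = 1) {ι : Type*} [Fintype ι] (c : ι → k) (m : ι → ℤ) (a b : ι → k[X])
    (ha : ∀ i, (a i).coeff 0 ≠ 0) (hb : ∀ i, (b i).coeff 0 ≠ 0)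
    {W : K} (hW : W ∈ IntermediateField.adjoin k {t})
    (h : ∑ i, c i • (δ (t ^ m i * (aeval t (a i) / aeval t (b i))) /
      (t ^ m i * (aeval t (a i) / aeval t (b i)))) = δ W) :
    ∑ i, c i * m i = 0 := by
  have ht0 : t ≠ 0 := fun e => ht (e ▸ isAlgebraic_zero)
  have h1 : ∀ i, t * (δ (t ^ m i * (aeval t (a i) / aeval t (b i))) /
      (t ^ m i * (aeval t (a i) / aeval t (b i)))) - (m i : K) ∈ maximalIdealAtZero k t ht := by
    intro i
    have ha' : aeval t (a i) ≠ 0 :=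
      aeval_ne_zero_of_transcendental ht (by intro e; simpa [e] using ha i)
    have hb' : aeval t (b i) ≠ 0 :=
      aeval_ne_zero_of_transcendental ht (by intro e; simpa [e] using hb i)
    convert Submodule.sub_mem _ (mul_logDeriv_mem_maximalIdealAtZero ht hδ (ha i))
      (mul_logDeriv_mem_maximalIdealAtZero ht hδ (hb i)) using 1
    rw [Derivation.leibniz, Derivation.leibniz_div, Derivation.leibniz_zpow, hδ]
    simp only [smul_eq_mul, zsmul_eq_mul, mul_one]
    rw [zpow_sub₀ ht0, zpow_one]
    field_simp
    ring
  have h2 : t * δ W - algebraMap k K (∑ i, c i * m i) ∈ maximalIdealAtZero k t ht := by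
    have := Submodule.sum_mem _ (fun i (_ : i ∈ Finset.univ) =>
      Submodule.smul_mem _ (c i) (h1 i))
    convert this using 1
    rw [← h, Finset.mul_sum, map_sum, ← Finset.sum_sub_distrib]
    refine Finset.sum_congr rfl fun i _ => ?_
    simp only [Algebra.smul_def, map_mul, map_intCast]
    ring
  set S := ∑ i, c i * (m i : k) with hS
  by_contra hS0
  have hSm : algebraMap k K S ∉ maximalIdealAtZero k t ht := by
    intro hmem
    refine div_notMem_maximalIdealAtZero ht (a := C S) (b := 1) (by simpa using hS0) (by simp) ?_
    simpa using hmem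
  have hWm : t * δ W ∉ maximalIdealAtZero k t ht := fun hmem =>
    hSm (by simpa using Submodule.sub_mem _ hmem h2)
  by_cases hW0 : W = 0
  · exact hWm (by simp [hW0])
  obtain ⟨j, p, q, hp, hq, rfl⟩ := exists_eq_zpow_mul_div_of_mem_adjoin ht hW hW0
  rcases j with j | j
  · refine hWm ?_
    have := mul_derivation_div_mem_maximalIdealAtZero ht hδ (X ^ j * p) hq
    simpa [mul_div_assoc] using this
  · set u := aeval t p / aeval t q with hu
    set W := t ^ (Int.negSucc j) * u with hWdef
    have huW : u = t ^ (j + 1) * W := by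
      rw [hWdef, zpow_negSucc]; field_simp
    have e : t * δ u = t ^ (j + 1) * (t * δ W) + ((j + 1 : ℕ) : K) * u := by
      conv_lhs => rw [huW]
      rw [Derivation.leibniz, Derivation.leibniz_pow, hδ, huW]
      simp only [smul_eq_mul, nsmul_eq_mul, add_tsub_cancel_right]
      ring
    have m1 := mul_derivation_div_mem_maximalIdealAtZero ht hδ p hq
    rw [← hu] at m1
    have m2 := aeval_mul_mem_maximalIdealAtZero ht (X ^ (j + 1)) h2
    have m3 : algebraMap k K S * t ^ (j + 1) ∈ maximalIdealAtZero k t ht :=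
      ⟨C S * X ^ (j + 1), 1, by simp, by simp, by simp⟩
    have m4 : ((j + 1 : ℕ) : k) • u ∈ maximalIdealAtZero k t ht := by
      convert Submodule.sub_mem _ (Submodule.sub_mem _ m1 m2) m3 using 1
      rw [e, Algebra.smul_def, map_natCast, map_pow, aeval_X]
      ring
    have : CharZero k := (algebraMap k K).charZero
    exact div_notMem_maximalIdealAtZero ht hp hq <|
      (Submodule.smul_mem_iff _ (by exact_mod_cast j.succ_ne_zero)).1 m4

end Polynomial

section Rosenlicht

variable {k K : Type*} [Field k] [Field K] [Algebra k K]

lemma Derivation.prod_div_prod (δ : Derivation k K K) {ι : Type*} (s : Finset ι) (f : ι → K)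
    (hf : ∀ i ∈ s, f i ≠ 0) :
    δ (∏ i ∈ s, f i) / ∏ i ∈ s, f i = ∑ i ∈ s, δ (f i) / f i := by
  classical
  induction s using Finset.induction_on with
  | empty => simp
  | insert a s ha ih =>
    have h1 := hf a (Finset.mem_insert_self a s)
    have h2 : ∏ i ∈ s, f i ≠ 0 :=
      Finset.prod_ne_zero_iff.2 fun i hi => hf i (Finset.mem_insert_of_mem hi)
    rw [Finset.prod_insert ha, Finset.sum_insert ha,
      ← ih fun i hi => hf i (Finset.mem_insert_of_mem hi), Derivation.leibniz]
    simp only [smul_eq_mul]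
    field_simp
    ring

variable [CharZero K]

/-- Over an intermediate field of algebraic elements, automorphisms commute with any derivation
preserving the base field. -/
lemma Derivation.apply_algEquiv_of_isAlgebraic (δ : Derivation k K K)
    {F : IntermediateField k K} [Algebra.IsAlgebraic F K] (hF : ∀ x ∈ F, δ x ∈ F)
    (σ : K ≃ₐ[F] K) (x : K) : δ (σ x) = σ (δ x) := by
  have hσk : ∀ c : k, σ (algebraMap k K c) = algebraMap k K c := fun c =>
    σ.commutes (algebraMap k F c)
  let d : Derivation k K K := Derivation.mk'
    { toFun := fun x => σ.symm (δ (σ x)) - δ x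
      map_add' := fun a b => by simp only [map_add]; ring
      map_smul' := fun c a => by
        have h1 : σ (c • a) = c • σ a := by
          rw [Algebra.smul_def, map_mul, hσk, ← Algebra.smul_def]
        have h2 : σ.symm (c • δ (σ a)) = c • σ.symm (δ (σ a)) := by
          rw [AlgEquiv.symm_apply_eq, Algebra.smul_def, Algebra.smul_def, map_mul, hσk,
            AlgEquiv.apply_symm_apply]
        rw [h1, δ.map_smul, δ.map_smul, h2, ← smul_sub, RingHom.id_apply] }
    fun a b => by
      simp only [LinearMap.coe_mk, AddHom.coe_mk, map_mul, map_add, Derivation.leibniz,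
        smul_eq_mul, AlgEquiv.symm_apply_apply]
      ring
  have hd : ∀ x, d x = σ.symm (δ (σ x)) - δ x := fun x => rfl
  have hdF : ∀ x ∈ F, d x = 0 := fun x hx => by
    have h1 : σ x = x := σ.commutes ⟨x, hx⟩
    have h2 : σ.symm (δ x) = δ x := σ.symm.commutes ⟨δ x, hF x hx⟩
    rw [hd, h1, h2, sub_self]
  let d' : Derivation F K K := Derivation.mk'
    { toFun := d
      map_add' := map_add d
      map_smul' := fun c a => by
        have := hdF c c.2
        simp [Algebra.smul_def, this] }
    fun a b => d.leibniz a b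
  have h0 : d x = 0 := d'.apply_eq_zero_of_isAlgebraic (Algebra.IsAlgebraic.isAlgebraic x)
  rwa [hd, sub_eq_zero, AlgEquiv.symm_apply_eq] at h0

/-- A relation between logarithmic derivatives and an exact derivative descends by norm and
trace. -/
lemma exists_norm_trace_relation [IsAlgClosed K] (δ : Derivation k K K)
    {F : IntermediateField k K} [Algebra.IsAlgebraic F K] (hF : ∀ x ∈ F, δ x ∈ F)
    {ι : Type*} [Fintype ι] (c : ι → k) (Z : ι → K) (hZ : ∀ i, Z i ≠ 0) (W : K)
    (h : ∑ i, c i • (δ (Z i) / Z i) = δ W) :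
    ∃ (d : ℕ) (Z' : ι → K) (W' : K), d ≠ 0 ∧ (∀ i, Z' i ∈ F) ∧ (∀ i, Z' i ≠ 0) ∧ W' ∈ F ∧
      (∀ i, Z i ∈ F → Z' i = Z i ^ d) ∧ ∑ i, c i • (δ (Z' i) / Z' i) = δ W' := by
  classical
  have : CharZero F := (algebraMap F K).charZero
  have : IsAlgClosure F K := ⟨inferInstance, inferInstance⟩
  have : Normal F K := inferInstance
  let S := IntermediateField.adjoin F (Set.range Z ∪ {W})
  have : FiniteDimensional F S := IntermediateField.finiteDimensional_adjoin
    (S := Set.range Z ∪ {W}) fun x _ => (Algebra.IsAlgebraic.isAlgebraic x).isIntegral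
  let E := IntermediateField.normalClosure F S K
  have hSE : S ≤ E := S.le_normalClosure
  have : FiniteDimensional F E := normalClosure.is_finiteDimensional F S K
  have : Normal F E := normalClosure.normal F S K
  have : IsGalois F E := {}
  let z : ι → E := fun i => ⟨Z i, hSE (IntermediateField.subset_adjoin _ _ (Or.inl ⟨i, rfl⟩))⟩
  let w : E := ⟨W, hSE (IntermediateField.subset_adjoin _ _ (Or.inr rfl))⟩
  have hlift : ∀ (σ : E ≃ₐ[F] E) (x : E), ((σ x : E) : K) = σ.liftNormal K (x : K) := fun σ x =>
    (σ.liftNormal_commutes K x).symm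
  have hnorm : ∀ x : E, ((Algebra.norm F x : F) : K) = ∏ σ : E ≃ₐ[F] E, σ.liftNormal K (x : K) := by
    intro x
    have := congrArg (algebraMap E K) (Algebra.norm_eq_prod_automorphisms F x)
    rw [map_prod] at this
    simp only [← hlift]
    exact this
  have htrace : ∀ x : E, ((Algebra.trace F E x : F) : K) =
      ∑ σ : E ≃ₐ[F] E, σ.liftNormal K (x : K) := by
    intro x
    have := congrArg (algebraMap E K) (trace_eq_sum_automorphisms (K := F) x)
    rw [map_sum] at this
    simp only [← hlift]
    exact this
  have hck : ∀ (σ : K ≃ₐ[F] K) (c : k) (x : K), σ (c • x) = c • σ x := fun σ c x => by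
    rw [Algebra.smul_def, map_mul, Algebra.smul_def]
    congr 1
    exact σ.commutes (algebraMap k F c)
  refine ⟨Module.finrank F E, fun i => Algebra.norm F (z i), Algebra.trace F E w,
    Module.finrank_pos.ne', fun i => (Algebra.norm F (z i)).2, fun i => ?_,
    (Algebra.trace F E w).2, fun i hi => ?_, ?_⟩
  · have : z i ≠ 0 := fun e => hZ i (congrArg Subtype.val e)
    simpa using this
  · have : z i = algebraMap F E ⟨Z i, hi⟩ := rfl
    show ((Algebra.norm F (z i) : F) : K) = _
    rw [this, Algebra.norm_algebraMap]
    simp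
  · rw [htrace, map_sum]
    have : ∀ i, δ ((Algebra.norm F (z i) : F) : K) / ((Algebra.norm F (z i) : F) : K) =
        ∑ σ : E ≃ₐ[F] E, σ.liftNormal K (δ (Z i) / Z i) := by
      intro i
      rw [hnorm, Derivation.prod_div_prod _ _ _ (fun σ _ => by simpa [z] using hZ i)]
      refine Finset.sum_congr rfl fun σ _ => ?_
      rw [δ.apply_algEquiv_of_isAlgebraic hF, map_div₀]
    simp only [this, Finset.smul_sum]
    rw [Finset.sum_comm]
    refine Finset.sum_congr rfl fun σ _ => ?_
    rw [δ.apply_algEquiv_of_isAlgebraic hF, ← h, map_sum]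
    exact Finset.sum_congr rfl fun i _ => (hck _ _ _).symm

open scoped IntermediateField.algebraAdjoinAdjoin in
/-- If a combination of logarithmic differentials with `ℚ`-linearly independent constant
coefficients is exact, then its arguments are algebraic over the constants. -/
theorem isAlgebraic_of_sum_logDeriv_eq_derivation [IsAlgClosed K] {ι : Type*} [Fintype ι]
    (c : ι → k) (hc : ∀ m : ι → ℤ, ∑ i, c i * m i = 0 → m = 0) (Z : ι → K)
    (hZ : ∀ i, Z i ≠ 0) (W : K)
    (h : ∀ δ : Derivation k K K, ∑ i, c i • (δ (Z i) / Z i) = δ W) (i₀ : ι) :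
    IsAlgebraic k (Z i₀) := by
  classical
  by_contra ht
  set t := Z i₀ with htdef
  obtain ⟨s, hts, hs⟩ := exists_isTranscendenceBasis_superset (R := k) (A := K) (s := {t})
    ((algebraicIndependent_singleton_iff (default : ({t} : Set K))).2 ht)
  have hts : t ∈ s := hts rfl
  let k' := IntermediateField.adjoin k (s \ {t})
  have htr : Transcendental k' t := by
    have h1 : AlgebraicIndepOn k id (insert t (s \ {t})) := by
      rw [Set.insert_sdiff_singleton, Set.insert_eq_of_mem hts]; exact hs.1
    have h2 := ((AlgebraicIndepOn.insert_iff (by simp)).1 h1).2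
    rw [Set.image_id] at h2
    intro hh
    apply h2
    exact (IsFractionRing.isAlgebraic_iff (Algebra.adjoin k (s \ {t})) k' K).2 hh
  have hcar : (IntermediateField.adjoin k' {t}).restrictScalars k =
      IntermediateField.adjoin k s := by
    rw [IntermediateField.adjoin_adjoin_left, Set.sdiff_union_self,
      Set.union_eq_self_of_subset_right]
    simpa using hts
  have halg : Algebra.IsAlgebraic (IntermediateField.adjoin k' {t}) K := by
    have := hs.isAlgebraic_field
    rw [Subtype.range_coe, ← hcar] at this
    exact this
  obtain ⟨δ, hδ⟩ := exists_derivation_apply_eq_one htr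
  have hF : ∀ x ∈ IntermediateField.adjoin k' {t}, δ x ∈ IntermediateField.adjoin k' {t} := by
    intro x hx
    obtain ⟨p, q, rfl⟩ := (IntermediateField.mem_adjoin_simple_iff k' x).1 hx
    have hmem : ∀ f : Polynomial k', Polynomial.aeval t f ∈ IntermediateField.adjoin k' {t} :=
      fun f => (IntermediateField.mem_adjoin_simple_iff k' _).2 ⟨f, 1, by simp⟩
    rw [Derivation.leibniz_div, Polynomial.derivation_apply_aeval hδ,
      Polynomial.derivation_apply_aeval hδ]
    simp only [smul_eq_mul]
    exact mul_mem (pow_mem (inv_mem (hmem _)) 2)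
      (sub_mem (mul_mem (hmem _) (hmem _)) (mul_mem (hmem _) (hmem _)))
  have hk := h (δ.restrictScalars k)
  obtain ⟨d, Z', W', hd, hZF, hZ0, hWF, hZd, hrel⟩ := exists_norm_trace_relation δ hF
    (fun i => algebraMap k k' (c i)) Z hZ W (by simpa using hk)
  have hdec : ∀ i, ∃ (m : ℤ) (a b : Polynomial k'), a.coeff 0 ≠ 0 ∧ b.coeff 0 ≠ 0 ∧
      Z' i = t ^ m * (Polynomial.aeval t a / Polynomial.aeval t b) ∧ (i = i₀ → m = d) := by
    intro i
    by_cases hi : i = i₀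
    · refine ⟨d, 1, 1, by simp, by simp, ?_, fun _ => rfl⟩
      subst hi
      rw [hZd i (IntermediateField.mem_adjoin_simple_self k' t)]
      simp [htdef]
    · obtain ⟨m, a, b, ha, hb, e⟩ :=
        Polynomial.exists_eq_zpow_mul_div_of_mem_adjoin htr (hZF i) (hZ0 i)
      exact ⟨m, a, b, ha, hb, e, fun h => absurd h hi⟩
  choose m a b ha hb e hm using hdec
  simp only [e] at hrel
  have := Polynomial.sum_mul_eq_zero_of_sum_logDeriv_eq_derivation htr hδ
    (fun i => algebraMap k k' (c i)) m a b ha hb hWF hrel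
  have h0 := hc m (by
    apply (algebraMap k k').injective
    simpa using this)
  have := hm i₀ rfl
  rw [h0, Pi.zero_apply] at this
  exact hd (by exact_mod_cast this.symm)

end Rosenlicht

section ConstantVectors

variable {C K : Type*} [Field C] [Field K] [Algebra C K]

/-- A subspace of `ι → K` stable under a derivation is spanned by its constant vectors. -/
lemma Submodule.le_span_constants_of_derivation_stable (D : Derivation C K K)
    (hC : ∀ x, D x = 0 → x ∈ Set.range (algebraMap C K)) {ι : Type*} [Finite ι]
    (A : Submodule K (ι → K)) (hA : ∀ k ∈ A, (fun i => D (k i)) ∈ A) :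
    A ≤ Submodule.span K {k | k ∈ A ∧ ∃ c : ι → C, k = fun i => algebraMap C K (c i)} := by
  classical
  have := Fintype.ofFinite ι
  suffices H : ∀ (N : ℕ) (k : ι → K), k ∈ A → (Finset.univ.filter fun i => k i ≠ 0).card = N →
      k ∈ Submodule.span K {k | k ∈ A ∧ ∃ c : ι → C, k = fun i => algebraMap C K (c i)} from
    fun k hk => H _ k hk rfl
  intro N
  induction N using Nat.strong_induction_on with
  | _ N ih =>
    intro k hk hN
    by_cases h0 : k = 0
    · rw [h0]; exact zero_mem _
    obtain ⟨i, hi⟩ : ∃ i, k i ≠ 0 := by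
      by_contra! h
      exact h0 (funext h)
    let l : ι → K := (k i)⁻¹ • k
    have hl : l ∈ A := A.smul_mem _ hk
    have hli : l i = 1 := inv_mul_cancel₀ hi
    have hl0 : ∀ j, k j = 0 → l j = 0 := fun j hj => by simp [l, hj]
    have hkl : k = k i • l := by simp [l, smul_smul, hi]
    suffices h : l ∈ Submodule.span K
        {k | k ∈ A ∧ ∃ c : ι → C, k = fun i => algebraMap C K (c i)} by
      rw [hkl]; exact Submodule.smul_mem _ _ h
    have hsmall : ∀ v ∈ A, (∀ j, k j = 0 → v j = 0) → (∃ j, k j ≠ 0 ∧ v j = 0) →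
        v ∈ Submodule.span K {k | k ∈ A ∧ ∃ c : ι → C, k = fun i => algebraMap C K (c i)} := by
      rintro v hv h1 ⟨j, hj, hvj⟩
      refine ih _ ?_ v hv rfl
      rw [← hN]
      apply Finset.card_lt_card
      rw [Finset.ssubset_iff_of_subset fun x hx => ?_]
      · exact ⟨j, by simpa using hj, by simpa using hvj⟩
      · simp only [Finset.mem_filter, Finset.mem_univ, true_and] at hx ⊢
        exact fun h => hx (h1 x h)
    have hDl : (fun j => D (l j)) ∈ A := hA l hl
    have hDs := hsmall _ hDl (fun j hj => by simp [hl0 j hj]) ⟨i, hi, by simp [hli]⟩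
    by_cases hD : ∀ j, D (l j) = 0
    · choose c hc using fun j => hC _ (hD j)
      exact Submodule.subset_span ⟨hl, c, funext fun j => (hc j).symm⟩
    push Not at hD
    obtain ⟨j, hj⟩ := hD
    have hkj : k j ≠ 0 := fun h => hj (by simp [hl0 j h])
    have hsub := hsmall (l - (l j / D (l j)) • fun j => D (l j))
      (A.sub_mem hl (A.smul_mem _ hDl)) (fun m hm => by simp [hl0 m hm])
      ⟨j, hkj, by simp [div_mul_cancel₀ _ hj]⟩
    have := Submodule.add_mem _ hsub (Submodule.smul_mem _ (l j / D (l j)) hDs)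
    rwa [sub_add_cancel] at this

lemma Derivation.zpow_div (δ : Derivation C K K) {z : K} (hz : z ≠ 0) (m : ℤ) :
    δ (z ^ m) / z ^ m = m * (δ z / z) := by
  rw [Derivation.leibniz_zpow]
  simp only [zsmul_eq_mul, smul_eq_mul]
  rw [zpow_sub_one₀ hz]
  have := zpow_ne_zero m hz
  field_simp

variable [CharZero K] [IsAlgClosed K]

/-- A constant relation between the forms `dz/z - dx` is a combination of rational relations
between the `D x`, whenever `D z = z * D x`. -/
lemma mem_span_rat_relations (D : Derivation C K K) {ι : Type*} [Fintype ι] (z x : ι → K)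
    (hz : ∀ i, z i ≠ 0) (hD : ∀ i, D (z i) = z i * D (x i)) (c : ι → C)
    (hc : ∀ δ : Derivation C K K, ∑ i, algebraMap C K (c i) * (δ (z i) / z i - δ (x i)) = 0) :
    (fun i => algebraMap C K (c i)) ∈ Submodule.span K
      {k | ∃ q : ι → ℚ, ∑ i, (q i : K) * D (x i) = 0 ∧ k = fun i => (q i : K)} := by
  classical
  have : CharZero C := (algebraMap C K).charZero
  let S := Submodule.span ℚ (Set.range c)
  have : FiniteDimensional ℚ S := FiniteDimensional.span_of_finite ℚ (Set.finite_range c)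
  let e := Module.finBasis ℚ S
  let q : ι → Fin (Module.finrank ℚ S) → ℚ := fun i k =>
    e.repr ⟨c i, Submodule.subset_span ⟨i, rfl⟩⟩ k
  have hq : ∀ i, ∑ k, (q i k : C) * (e k : C) = c i := fun i => by
    have := congrArg Subtype.val (e.sum_repr ⟨c i, Submodule.subset_span ⟨i, rfl⟩⟩)
    simpa [Submodule.coe_sum, Rat.smul_def, -Module.Basis.sum_repr] using this
  obtain ⟨M, hM⟩ := IsLocalization.exist_integer_multiples_of_finite (nonZeroDivisors ℤ)
    (fun p : ι × Fin (Module.finrank ℚ S) => q p.1 p.2)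
  have hM0 : ((M : ℤ) : K) ≠ 0 := by
    simp
  choose p hp using hM
  have hp' : ∀ i k, ((p (i, k) : ℤ) : K) = (M : ℤ) * (q i k : K) := fun i k => by
    have := congrArg (Rat.cast (K := K)) (hp (i, k))
    simpa using this
  let Z : Fin (Module.finrank ℚ S) → K := fun k => ∏ i, z i ^ p (i, k)
  have hZ : ∀ k, Z k ≠ 0 := fun k => Finset.prod_ne_zero_iff.2 fun i _ => zpow_ne_zero _ (hz i)
  have hlog : ∀ (δ : Derivation C K K) k,
      δ (Z k) / Z k = ∑ i, (M : ℤ) * (q i k : K) * (δ (z i) / z i) := fun δ k => by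
    rw [Derivation.prod_div_prod _ _ _ fun i _ => zpow_ne_zero _ (hz i)]
    simp only [δ.zpow_div (hz _), hp']
  have halg : ∀ k, IsAlgebraic C (Z k) :=
    isAlgebraic_of_sum_logDeriv_eq_derivation (fun k => (e k : C))
      (fun m hm => by
        have h1 := Fintype.linearIndependent_iff.1 e.linearIndependent (fun k => (m k : ℚ)) (by
          apply Subtype.ext
          simpa [Rat.smul_def, mul_comm] using hm)
        exact funext fun k => by exact_mod_cast h1 k)
      Z hZ (((M : ℤ) : C) • ∑ i, c i • x i) fun δ => by
        have h1 := hc δ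
        simp only [mul_sub, Finset.sum_sub_distrib, sub_eq_zero] at h1
        rw [δ.map_smul, map_sum]
        simp only [δ.map_smul]
        simp only [hlog, Algebra.smul_def]
        rw [← h1]
        simp only [← hq, map_sum, map_mul, Finset.mul_sum, Finset.sum_mul]
        rw [Finset.sum_comm]
        refine Finset.sum_congr rfl fun i _ => Finset.sum_congr rfl fun k _ => ?_
        simp only [map_intCast, map_ratCast]
        ring
  have hN : ∀ k, ∑ i, (q i k : K) * D (x i) = 0 := fun k => by
    have h1 := hlog D k
    rw [D.apply_eq_zero_of_isAlgebraic (halg k), zero_div] at h1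
    simp only [hD, mul_assoc, ← Finset.mul_sum, mul_div_cancel_left₀ _ (hz _)] at h1
    exact (mul_eq_zero.1 h1.symm).resolve_left hM0
  have hfin : (fun i => algebraMap C K (c i)) =
      ∑ k, algebraMap C K (e k : C) • fun i => (q i k : K) := by
    funext i
    rw [← hq i]
    simp only [map_sum, map_mul, map_ratCast, Finset.sum_apply, Pi.smul_apply, smul_eq_mul]
    exact Finset.sum_congr rfl fun k _ => mul_comm _ _
  rw [hfin]
  exact Submodule.sum_mem _ fun k _ => Submodule.smul_mem _ _
    (Submodule.subset_span ⟨fun i => q i k, hN k, rfl⟩)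

/-- The number of independent relations between the forms `dz/z - dx` is at most the number of
rational relations between the `D x`, whenever `D z = z * D x`. -/
lemma finrank_relations_le (D : Derivation C K K)
    (hC : ∀ x, D x = 0 → x ∈ Set.range (algebraMap C K)) {ι : Type*} [Fintype ι] (z x : ι → K)
    (hz : ∀ i, z i ≠ 0) (hD : ∀ i, D (z i) = z i * D (x i)) (A : Submodule K (ι → K))
    (hA : ∀ k, k ∈ A ↔ ∀ δ : Derivation C K K, ∑ i, k i * (δ (z i) / z i - δ (x i)) = 0)
    (N : Submodule ℚ (ι → ℚ)) (hN : ∀ q : ι → ℚ, ∑ i, (q i : K) * D (x i) = 0 → q ∈ N) :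
    Module.finrank K A ≤ Module.finrank ℚ N := by
  have hstab : ∀ k ∈ A, (fun i => D (k i)) ∈ A := by
    intro k hk
    rw [hA] at hk ⊢
    intro δ
    have h1 := congrArg D (hk δ)
    have h2 := hk ⁅D, δ⁆
    simp only [map_sum, map_zero, Derivation.leibniz, Finset.sum_add_distrib, smul_eq_mul] at h1
    have h3 : ∀ i, D (δ (z i) / z i - δ (x i)) = ⁅D, δ⁆ (z i) / z i - ⁅D, δ⁆ (x i) := by
      intro i
      simp only [Derivation.commutator_apply, map_sub, Derivation.leibniz_div, hD,
        Derivation.leibniz, smul_eq_mul]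
      have := hz i
      field_simp
      ring
    simp only [h3, h2, zero_add] at h1
    rw [← h1]
    exact Finset.sum_congr rfl fun i _ => mul_comm _ _
  let b := Module.finBasis ℚ N
  have hle : A ≤ Submodule.span K (Set.range fun k => fun i => (((b k : ι → ℚ) i : ℚ) : K)) := by
    refine (A.le_span_constants_of_derivation_stable D hC hstab).trans (Submodule.span_le.2 ?_)
    rintro _ ⟨hk, c, rfl⟩
    refine Submodule.span_le.2 ?_ (mem_span_rat_relations D z x hz hD c ((hA _).1 hk))
    rintro _ ⟨q, hq, rfl⟩
    have hq' := congrArg Subtype.val (b.sum_repr ⟨q, hN q hq⟩)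
    have : (fun i => (q i : K)) = ∑ k, (b.repr ⟨q, hN q hq⟩ k : K) •
        fun i => (((b k : ι → ℚ) i : ℚ) : K) := by
      funext i
      have := congrArg (Rat.cast (K := K)) (congrFun hq' i)
      simp only [Submodule.coe_sum, Finset.sum_apply, Submodule.coe_smul, Pi.smul_apply,
        smul_eq_mul, Rat.cast_sum, Rat.cast_mul] at this
      simp [← this]
    rw [SetLike.mem_coe, this]
    exact Submodule.sum_mem _ fun k _ => Submodule.smul_mem _ _ (Submodule.subset_span ⟨k, rfl⟩)
  refine (Submodule.finrank_mono hle).trans ((finrank_range_le_card _).trans ?_)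
  simp

end ConstantVectors

section Evaluation

variable {C K : Type*} [Field C] [Field K] [Algebra C K]

/-- Evaluation of derivations at a point, as a linear functional; in other words, the differential
of the point. -/
def Derivation.evalDual (C : Type*) {K : Type*} [Field C] [Field K] [Algebra C K] (x : K) :
    Module.Dual K (Derivation C K K) where
  toFun δ := δ x
  map_add' _ _ := rfl
  map_smul' _ _ := rfl

@[simp]
lemma Derivation.evalDual_apply (x : K) (δ : Derivation C K K) : evalDual C x δ = δ x := rfl

open Polynomial in
/-- Elements with independent differentials modulo the differential of `t` are independent
over the polynomials in `t`. -/
lemma eq_zero_of_aeval_add_sum_eq_zero {t : K} (ht : Transcendental C t) {J : Type*} [Fintype J]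
    (y : J → K)
    (hy : LinearIndependent K fun j =>
      (Submodule.span K {Derivation.evalDual C t}).mkQ (Derivation.evalDual C (y j)))
    (p₀ : C[X]) (p : J → C[X]) (h : aeval t p₀ + ∑ j, aeval t (p j) * y j = 0) :
    p₀ = 0 ∧ p = 0 := by
  have hp : ∀ j, p j = 0 := by
    have h1 : ∑ j, aeval t (p j) • Derivation.evalDual C (y j) =
        -(aeval t (derivative p₀) + ∑ j, aeval t (derivative (p j)) * y j) •
          Derivation.evalDual C t := by
      ext δ
      have := congrArg δ h
      simp only [map_add, map_sum, Derivation.map_aeval, Derivation.leibniz, smul_eq_mul,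
        map_zero, Finset.sum_add_distrib] at this
      simp only [LinearMap.coe_sum, Finset.sum_apply, LinearMap.smul_apply,
        Derivation.evalDual_apply, smul_eq_mul]
      have h2 : ∑ j, y j * (aeval t (derivative (p j)) * δ t) =
          (∑ j, aeval t (derivative (p j)) * y j) * δ t := by
        rw [Finset.sum_mul]
        exact Finset.sum_congr rfl fun j _ => by ring
      rw [h2] at this
      linear_combination this
    have h2 := Fintype.linearIndependent_iff.1 hy (fun j => aeval t (p j)) (by
      simp only [← map_smul, ← map_sum]
      rw [h1, Submodule.mkQ_apply, Submodule.Quotient.mk_eq_zero]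
      exact Submodule.smul_mem _ _ (Submodule.mem_span_singleton_self _))
    exact fun j => (transcendental_iff.1 ht) _ (h2 j)
  refine ⟨(transcendental_iff.1 ht) _ ?_, funext hp⟩
  simpa [hp] using h

open Polynomial in
/-- The rational relations modulo constants between the elements `y + t κ` and `t y` are limited by
the number of elements among the `y`s that are independent over the polynomials in `t`. -/
lemma finrank_add_card_le_of_relations [CharZero K] (t : K) {ι J : Type*} [Fintype ι] [Fintype J]
    (y : ι → K) (hy : LinearIndependent ℚ y) (a : J → ι)
    (ha : ∀ (p₀ : C[X]) (p : J → C[X]),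
      aeval t p₀ + ∑ j, aeval t (p j) * y (a j) = 0 → p₀ = 0 ∧ p = 0)
    (κ : ι → C) (N : Submodule ℚ (ι ⊕ ι → ℚ))
    (hN : ∀ q ∈ N, ∃ c : C, ∑ i, (q (Sum.inl i) : K) * (y i + t * algebraMap C K (κ i)) +
      ∑ i, (q (Sum.inr i) : K) * (t * y i) = algebraMap C K c) :
    Module.finrank ℚ N + Fintype.card J ≤ Fintype.card ι := by
  classical
  have : CharZero C := (algebraMap C K).charZero
  let Y : (ι → ℚ) →ₗ[ℚ] K := Fintype.linearCombination ℚ y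
  have hY : ∀ g, Y g = ∑ i, (g i : K) * y i := fun g => by
    simp [Y, Fintype.linearCombination_apply, Rat.smul_def]
  have hY0 : ∀ g, Y g = 0 → g = 0 := fun g hg =>
    funext (Fintype.linearIndependent_iff.1 hy g (by simpa [Y, Fintype.linearCombination_apply]
      using hg))
  have hY1 : ∀ i, Y (Pi.single i 1) = y i := fun i => by
    simp [Y, Fintype.linearCombination_apply_single]
  let Λ : Submodule ℚ K :=
    { carrier := {x | ∃ (p₀ : C[X]) (p : J → C[X]), x = aeval t p₀ + ∑ j, aeval t (p j) * y (a j)}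
      zero_mem' := ⟨0, 0, by simp⟩
      add_mem' := by
        rintro _ _ ⟨p₀, p, rfl⟩ ⟨q₀, q, rfl⟩
        refine ⟨p₀ + q₀, p + q, ?_⟩
        simp only [map_add, Pi.add_apply, add_mul, Finset.sum_add_distrib]
        ring
      smul_mem' := by
        rintro c _ ⟨p₀, p, rfl⟩
        refine ⟨Polynomial.C (c : C) * p₀, fun j => Polynomial.C (c : C) * p j, ?_⟩
        simp [Rat.smul_def, Finset.mul_sum, mul_assoc] }
  let V' := Λ.comap Y
  obtain ⟨ρ, hρ⟩ := LinearMap.exists_leftInverse_of_injective V'.subtype V'.ker_subtype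
  let e : (J → ℚ) →ₗ[ℚ] V' := Fintype.linearCombination ℚ fun j =>
    ⟨Pi.single (a j) 1, 0, Pi.single j 1, by
      simp [hY1, Pi.single_apply, apply_ite (aeval t)]⟩
  have he : ∀ w, Y (e w : V') = ∑ j, (w j : K) * y (a j) := fun w => by
    simp only [e, Fintype.linearCombination_apply, Submodule.coe_sum, map_sum, Submodule.coe_smul,
      map_smul, Rat.smul_def]
    simp [hY1]
  let π₁ : N →ₗ[ℚ] (ι → ℚ) := LinearMap.funLeft ℚ ℚ Sum.inl ∘ₗ N.subtype
  let π₂ : N →ₗ[ℚ] (ι → ℚ) := LinearMap.funLeft ℚ ℚ Sum.inr ∘ₗ N.subtype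
  let Ψ : (N × (J → ℚ)) →ₗ[ℚ] (((ι → ℚ) ⧸ V') × V') :=
    LinearMap.prod (V'.mkQ ∘ₗ π₂ ∘ₗ LinearMap.fst ℚ N (J → ℚ)) (LinearMap.coprod (ρ ∘ₗ π₁) e)
  have hΨ : Function.Injective Ψ := by
    rw [injective_iff_map_eq_zero]
    rintro ⟨q, w⟩ h
    have h1 : V'.mkQ (π₂ q) = 0 := congrArg Prod.fst h
    have h2 : ρ (π₁ q) + e w = 0 := congrArg Prod.snd h
    rw [Submodule.mkQ_apply, Submodule.Quotient.mk_eq_zero] at h1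
    obtain ⟨p₀, p, hp⟩ := h1
    obtain ⟨c, hc⟩ := hN q q.2
    let k : C := ∑ i, ((q : ι ⊕ ι → ℚ) (Sum.inl i) : C) * κ i
    have hc' : Y (π₁ q) + t * algebraMap C K k + t * Y (π₂ q) = algebraMap C K c := by
      rw [← hc, hY, hY]
      simp only [π₁, π₂, k, LinearMap.comp_apply, LinearMap.funLeft_apply, Submodule.subtype_apply,
        map_sum, map_mul, map_ratCast, mul_add, Finset.sum_add_distrib, Finset.mul_sum]
      congr 1
      · congr 1
        exact Finset.sum_congr rfl fun i _ => by ring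
      · exact Finset.sum_congr rfl fun i _ => by ring
    have h3 : π₁ q ∈ V' := by
      refine ⟨Polynomial.C c - X * Polynomial.C k - X * p₀, fun j => -(X * p j), ?_⟩
      have : Y (π₁ q) = algebraMap C K c - t * algebraMap C K k - t * Y (π₂ q) := by
        rw [← hc']; ring
      rw [this, hp]
      simp only [map_sub, map_mul, map_neg, aeval_X, aeval_C, neg_mul, Finset.sum_neg_distrib,
        mul_add, Finset.mul_sum, mul_assoc]
      ring
    have h4 : ρ (π₁ q) = ⟨π₁ q, h3⟩ := LinearMap.congr_fun hρ ⟨π₁ q, h3⟩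
    have h5 : π₁ q + (e w : V') = 0 := by
      rw [h4] at h2
      exact congrArg Subtype.val h2
    have h6 : Y (π₁ q) = -∑ j, (w j : K) * y (a j) := by
      rw [eq_neg_iff_add_eq_zero, ← he, ← map_add, h5, map_zero]
    obtain ⟨h7, h8⟩ := ha (X * (Polynomial.C k + p₀) - Polynomial.C c)
      (fun j => X * p j - Polynomial.C (w j : C)) (by
        rw [h6, hp] at hc'
        simp only [map_sub, map_mul, map_add, aeval_X, aeval_C, sub_mul, Finset.sum_sub_distrib,
          map_ratCast, ← hc']
        simp only [mul_add, Finset.mul_sum, mul_assoc]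
        ring)
    have hw : w = 0 := funext fun j => by
      have := congrArg (fun f => coeff f 0) (congrFun h8 j)
      simpa using this
    have hp' : ∀ j, p j = 0 := fun j => by
      have := congrFun h8 j
      simpa [hw] using this
    have h9 : π₁ q = 0 := by simpa [hw] using h5
    have hk : k = 0 := Finset.sum_eq_zero fun i _ => by
      have : (q : ι ⊕ ι → ℚ) (Sum.inl i) = 0 := congrFun h9 i
      simp [this]
    have hc0 : c = 0 := by
      have := congrArg (fun f => coeff f 0) h7
      simpa using this
    have hp0 : p₀ = 0 := by simpa [hk, hc0] using h7
    have h10 : π₂ q = 0 := hY0 _ (by simp [hp, hp0, hp'])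
    refine Prod.ext (Subtype.ext (funext fun i => ?_)) hw
    rcases i with i | i
    · exact congrFun h9 i
    · exact congrFun h10 i
  have := LinearMap.finrank_le_finrank_of_injective hΨ
  rwa [Module.finrank_prod, Module.finrank_prod, Submodule.finrank_quotient_add_finrank,
    Module.finrank_fintype_fun_eq_card, Module.finrank_fintype_fun_eq_card] at this

end Evaluation

/-- An exponential-differential transcendence bound: the forms `dE/E - du`, `dG/G - dv` with
`u = y + t κ` and `v = t y` force at least as many independent elements as there are
`ℚ`-independent `y`s. -/
theorem card_le_card_of_derivation_exp {C K : Type*} [Field C] [Field K] [Algebra C K]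
    [CharZero K] [IsAlgClosed K] (D : Derivation C K K)
    (hC : ∀ x, D x = 0 → x ∈ Set.range (algebraMap C K)) {ι τ : Type*} [Fintype ι] [Fintype τ]
    {t : K} (ht : D t ≠ 0) (y : ι → K) (hy : LinearIndependent ℚ y) (κ : ι → C) (E G : ι → K)
    (hE0 : ∀ i, E i ≠ 0) (hG0 : ∀ i, G i ≠ 0)
    (hE : ∀ i, D (E i) = E i * D (y i + t * algebraMap C K (κ i)))
    (hG : ∀ i, D (G i) = G i * D (t * y i)) (s : τ → K)
    (hs : ∀ δ : Derivation C K K, (∀ j, δ (s j) = 0) → ∀ i, δ (E i) = 0 ∧ δ (G i) = 0) :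
    Fintype.card ι ≤ Fintype.card τ := by
  classical
  have htr : Transcendental C t := fun h => ht (D.apply_eq_zero_of_isAlgebraic h)
  let ev : K → Module.Dual K (Derivation C K K) := Derivation.evalDual C
  let P : Submodule K (Module.Dual K (Derivation C K K)) := Submodule.span K {ev t}
  obtain ⟨J, a, ha, hspan, hli⟩ := exists_linearIndependent' K fun i => P.mkQ (ev (y i))
  have : Finite J := Finite.of_injective a ha
  have := Fintype.ofFinite J
  let z : ι ⊕ ι → K := Sum.elim E G
  let x : ι ⊕ ι → K := Sum.elim (fun i => y i + t * algebraMap C K (κ i)) fun i => t * y i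
  have hz : ∀ i, z i ≠ 0 := Sum.rec hE0 hG0
  have hD : ∀ i, D (z i) = z i * D (x i) := Sum.rec hE hG
  let ω : ι ⊕ ι → Module.Dual K (Derivation C K K) := fun i => (z i)⁻¹ • ev (z i) - ev (x i)
  have hω : ∀ i δ, ω i δ = δ (z i) / z i - δ (x i) := fun i δ => by
    simp [ω, ev, div_eq_inv_mul]
  let L := Fintype.linearCombination K ω
  let N : Submodule ℚ (ι ⊕ ι → ℚ) := LinearMap.ker (Fintype.linearCombination ℚ fun i => D (x i))
  have hNmem : ∀ q : ι ⊕ ι → ℚ, q ∈ N ↔ ∑ i, (q i : K) * D (x i) = 0 := fun q => by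
    simp [N, LinearMap.mem_ker, Fintype.linearCombination_apply, Rat.smul_def]
  have hker : Module.finrank K (LinearMap.ker L) ≤ Module.finrank ℚ N :=
    finrank_relations_le D hC z x hz hD _ (fun k => by
      rw [LinearMap.mem_ker, LinearMap.ext_iff]
      simp [L, Fintype.linearCombination_apply, hω]) N fun q hq => (hNmem q).2 hq
  have hN : Module.finrank ℚ N + Fintype.card J ≤ Fintype.card ι :=
    finrank_add_card_le_of_relations t y hy a
      (eq_zero_of_aeval_add_sum_eq_zero htr (fun j => y (a j)) hli) κ N fun q hq => by
        have h1 : D (∑ i, (q i : K) * x i) = 0 := by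
          rw [← (hNmem q).1 hq, map_sum]
          refine Finset.sum_congr rfl fun i _ => ?_
          have h2 : D ((q i : ℚ) : K) = 0 := D.apply_eq_zero_of_isAlgebraic (by
            have : CharZero C := (algebraMap C K).charZero
            simpa using isAlgebraic_algebraMap (R := C) (A := K) (q i : C))
          simp [h2]
        obtain ⟨c, hc⟩ := hC _ h1
        exact ⟨c, by rw [hc, Fintype.sum_sum_type]; rfl⟩
  let h : τ ⊕ Option J → Module.Dual K (Derivation C K K) :=
    Sum.elim (fun j => ev (s j)) (Option.elim · (ev t) fun j => ev (y (a j)))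
  let H := Submodule.span K (Set.range h)
  have hHs : ∀ j, ev (s j) ∈ H := fun j => Submodule.subset_span ⟨Sum.inl j, rfl⟩
  have hHt : ev t ∈ H := Submodule.subset_span ⟨Sum.inr none, rfl⟩
  have hPH : P ≤ H := (Submodule.span_singleton_le_iff_mem _ _).2 hHt
  have hHy : ∀ i, ev (y i) ∈ H := fun i => by
    have h1 : P.mkQ (ev (y i)) ∈ H.map P.mkQ := by
      have h2 : P.mkQ (ev (y i)) ∈ Submodule.span K (Set.range fun i => P.mkQ (ev (y i))) :=
        Submodule.subset_span ⟨i, rfl⟩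
      rw [← hspan] at h2
      refine Submodule.span_le.2 ?_ h2
      rintro _ ⟨j, rfl⟩
      exact Submodule.mem_map_of_mem (Submodule.subset_span ⟨Sum.inr (some j), rfl⟩)
    have h2 : ev (y i) ∈ (H.map P.mkQ).comap P.mkQ := h1
    rwa [Submodule.comap_map_mkQ, sup_eq_right.2 hPH] at h2
  have hHz : ∀ i, ev (z i) ∈ H := fun i => by
    have h1 : ev (z i) ∈ Submodule.span K (Set.range fun j => ev (s j)) :=
      mem_span_of_iInf_ker_le_ker fun δ hδ => by
        have h2 := hs δ fun j => (Submodule.mem_iInf _).1 hδ j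
        rcases i with i | i
        · exact (h2 i).1
        · exact (h2 i).2
    exact Submodule.span_le.2 (Set.range_subset_iff.2 hHs) h1
  have hHx : ∀ i, ev (x i) ∈ H := by
    rintro (i | i)
    · have : ev (x (Sum.inl i)) = ev (y i) + algebraMap C K (κ i) • ev t := by
        ext δ
        simp [ev, x, Algebra.smul_def]
      rw [this]
      exact H.add_mem (hHy i) (H.smul_mem _ hHt)
    · have : ev (x (Sum.inr i)) = t • ev (y i) + y i • ev t := by
        ext δ
        simp [ev, x]
      rw [this]
      exact H.add_mem (H.smul_mem _ (hHy i)) (H.smul_mem _ hHt)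
  have hLH : LinearMap.range L ≤ H := by
    rw [Fintype.range_linearCombination, Submodule.span_le]
    rintro _ ⟨i, rfl⟩
    exact H.sub_mem (H.smul_mem _ (hHz i)) (hHx i)
  have hLD : ∀ φ ∈ LinearMap.range L, φ D = 0 := by
    rintro _ ⟨k, rfl⟩
    simp [L, Fintype.linearCombination_apply, hω, hD, hz]
  have : FiniteDimensional K H := FiniteDimensional.span_of_finite K (Set.finite_range h)
  have hlt : Module.finrank K (LinearMap.range L) < Module.finrank K H :=
    Submodule.finrank_lt_finrank_of_lt (lt_of_le_of_ne hLH fun e => ht (hLD _ (e ▸ hHt)))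
  have hHcard : Module.finrank K H ≤ Fintype.card τ + (Fintype.card J + 1) := by
    refine (finrank_range_le_card (R := K) h).trans_eq ?_
    simp
  have hrk := L.finrank_range_add_finrank_ker
  rw [Module.finrank_fintype_fun_eq_card, Fintype.card_sum] at hrk
  omega

section ExpEval

open MvPolynomial

variable {ι : Type*}

/-- Evaluation of an integer polynomial at a point and its exponentials. -/
noncomputable def expEval (x : ι → ℂ) : MvPolynomial (ι ⊕ ι) ℤ →ₐ[ℤ] ℂ :=
  aeval (Sum.elim x fun i => Complex.exp (x i))

@[simp] lemma expEval_X_inl (x : ι → ℂ) (i : ι) : expEval x (X (Sum.inl i)) = x i := by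
  simp [expEval]

@[simp] lemma expEval_X_inr (x : ι → ℂ) (i : ι) :
    expEval x (X (Sum.inr i)) = Complex.exp (x i) := by
  simp [expEval]

open Classical in
/-- The derivation of polynomials that induces the partial derivative of the exponential
polynomial. -/
noncomputable def expPderiv (i : ι) :
    Derivation ℤ (MvPolynomial (ι ⊕ ι) ℤ) (MvPolynomial (ι ⊕ ι) ℤ) :=
  mkDerivation ℤ (Sum.elim (fun j => if j = i then 1 else 0)
    fun j => if j = i then X (Sum.inr j) else 0)

open Classical in
@[simp] lemma expPderiv_X_inl (i j : ι) :
    expPderiv i (X (Sum.inl j)) = if j = i then 1 else 0 := by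
  simp [expPderiv, mkDerivation_X]

open Classical in
@[simp] lemma expPderiv_X_inr (i j : ι) :
    expPderiv i (X (Sum.inr j)) = if j = i then X (Sum.inr j) else 0 := by
  simp [expPderiv, mkDerivation_X]

lemma isExpPoly_intCast {n : ℕ} (a : ℤ) : IsExpPoly fun _ : Fin n → ℂ => (a : ℂ) := by
  have hnat : ∀ m : ℕ, IsExpPoly fun _ : Fin n → ℂ => (m : ℂ) := by
    intro m
    induction m with
    | zero => simpa using! IsExpPoly.zero
    | succ m ih => simpa using! ih.add IsExpPoly.one
  obtain ⟨m, rfl | rfl⟩ := a.eq_nat_or_neg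
  · simpa using hnat m
  · simpa using! (hnat m).neg

lemma isExpPoly_expEval {n : ℕ} (P : MvPolynomial (Fin n ⊕ Fin n) ℤ) :
    IsExpPoly fun x => expEval x P := by
  induction P using MvPolynomial.induction_on with
  | C a => simpa [expEval] using isExpPoly_intCast a
  | add p q hp hq => simpa using! hp.add hq
  | mul_X p i hp =>
    rcases i with i | i
    · simpa using! hp.mul (IsExpPoly.proj i)
    · simpa using! hp.mul (IsExpPoly.proj i).exp

variable [Fintype ι]

lemma hasFDerivAt_expEval (P : MvPolynomial (ι ⊕ ι) ℤ) (x : ι → ℂ) :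
    HasFDerivAt (fun x => expEval x P)
      (∑ i, expEval x (expPderiv i P) • ContinuousLinearMap.proj (R := ℂ) (φ := fun _ : ι => ℂ) i)
      x := by
  classical
  induction P using MvPolynomial.induction_on with
  | C a =>
    simp only [expEval, map_intCast, eq_intCast]
    refine (hasFDerivAt_const (𝕜 := ℂ) (a : ℂ) x).congr_fderiv ?_
    ext v
    simp
  | add p q hp hq =>
    simp only [map_add]
    refine (hp.add hq).congr_fderiv ?_
    ext v
    simp [add_mul, Finset.sum_add_distrib]
  | mul_X p i hp =>
    have hproj : ∀ i, HasFDerivAt (fun x : ι → ℂ => x i)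
        (ContinuousLinearMap.proj (R := ℂ) (φ := fun _ : ι => ℂ) i) x := fun i =>
      (ContinuousLinearMap.proj (R := ℂ) (φ := fun _ : ι => ℂ) i).hasFDerivAt
    rcases i with i | i
    · have := hp.mul (hproj i)
      simp only [map_mul, expEval_X_inl]
      refine this.congr_fderiv ?_
      ext v
      simp [Finset.sum_add_distrib, add_mul, Finset.mul_sum, mul_assoc, ite_mul,
        apply_ite (expEval x)]
    · have := hp.mul (hproj i).cexp
      simp only [map_mul, expEval_X_inr]
      refine this.congr_fderiv ?_
      ext v
      simp [Finset.sum_add_distrib, add_mul, Finset.mul_sum, mul_assoc, ite_mul,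
        apply_ite (expEval x)]

lemma contDiff_expEval (P : MvPolynomial (ι ⊕ ι) ℤ) {m : WithTop ℕ∞} :
    ContDiff ℂ m fun x : ι → ℂ => expEval x P := by
  induction P using MvPolynomial.induction_on with
  | C a => simpa [expEval] using contDiff_const
  | add p q hp hq => simpa using hp.add hq
  | mul_X p i hp =>
    rcases i with i | i
    · simpa using hp.mul (contDiff_apply ℂ ℂ i)
    · simpa using hp.mul (contDiff_apply ℂ ℂ i).cexp

/-- A vector orthogonal to the gradients of all exponential-polynomial relations of `p` gives a
derivation compatible with exponentiation on `p`. -/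
lemma exists_derivation_of_forall_expPderiv (p v : ι → ℂ)
    (hv : ∀ P, expEval p P = 0 → ∑ i, v i * expEval p (expPderiv i P) = 0) :
    ∃ D : Derivation ℤ ℂ ℂ, ∀ i, D (p i) = v i ∧
      D (Complex.exp (p i)) = Complex.exp (p i) * v i := by
  classical
  let φ : MvPolynomial (ι ⊕ ι) ℤ →ₐ[ℤ] TrivSqZeroExt ℂ ℂ := aeval (Sum.elim
    (fun i => TrivSqZeroExt.inl (p i) + TrivSqZeroExt.inr (v i))
    fun i => TrivSqZeroExt.inl (Complex.exp (p i)) +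
      TrivSqZeroExt.inr (Complex.exp (p i) * v i))
  have hφ : ∀ P, φ P = TrivSqZeroExt.inl (expEval p P) +
      TrivSqZeroExt.inr (∑ i, v i * expEval p (expPderiv i P)) := by
    intro P
    induction P using MvPolynomial.induction_on with
    | C a => simp [φ, expEval]
    | add P Q hP hQ =>
      rw [map_add, hP, hQ]
      ext <;> simp [mul_add, Finset.sum_add_distrib]
    | mul_X P i hP =>
      rw [map_mul, hP]
      rcases i with i | i
      · ext <;> simp [φ, Finset.sum_add_distrib, mul_add, apply_ite (expEval p),
          Finset.mul_sum, mul_comm, mul_left_comm]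
      · ext <;> simp [φ, Finset.sum_add_distrib, mul_add, apply_ite (expEval p), mul_assoc,
          Finset.mul_sum, mul_comm, mul_left_comm]
  let I := RingHom.ker (expEval p).toRingHom
  let f : MvPolynomial (ι ⊕ ι) ℤ ⧸ I →+* ℂ := RingHom.kerLift _
  have hf : Function.Injective f := RingHom.kerLift_injective _
  have : IsDomain (MvPolynomial (ι ⊕ ι) ℤ ⧸ I) := hf.isDomain f
  let ψ : MvPolynomial (ι ⊕ ι) ℤ ⧸ I →+* TrivSqZeroExt ℂ ℂ :=
    Ideal.Quotient.lift I φ.toRingHom fun P hP => by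
      have hP : expEval p P = 0 := hP
      change φ P = 0
      rw [hφ, hv P hP, hP]
      simp
  have hψ : ∀ P, ψ (Ideal.Quotient.mk I P) = φ P := fun P => rfl
  have hfmk : ∀ P, f (Ideal.Quotient.mk I P) = expEval p P := fun P => rfl
  obtain ⟨D, hD⟩ := exists_derivation_of_ringHom_trivSqZeroExt f hf ψ (by
    intro P
    obtain ⟨P, rfl⟩ := Ideal.Quotient.mk_surjective P
    rw [hψ, hfmk, hφ]
    simp)
  refine ⟨D, fun i => ⟨?_, ?_⟩⟩
  · have := hD (Ideal.Quotient.mk I (X (Sum.inl i)))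
    rw [hfmk, hψ, expEval_X_inl] at this
    simpa [φ] using this
  · have := hD (Ideal.Quotient.mk I (X (Sum.inr i)))
    rw [hfmk, hψ, expEval_X_inr] at this
    simpa [φ] using this

end ExpEval

section Curve

open MvPolynomial Topology

variable {ι : Type*} [Fintype ι]

/-- The formal Jacobian matrix of a system of exponential polynomials. -/
noncomputable def expJacobian (Q : ι → MvPolynomial (ι ⊕ ι) ℤ) :
    Matrix ι ι (MvPolynomial (ι ⊕ ι) ℤ) :=
  Matrix.of fun k i => expPderiv i (Q k)

lemma AnalyticOnNhd.expEval_comp {U : Set ℂ} {x : ℂ → ι → ℂ} (hx : AnalyticOnNhd ℂ x U)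
    (P : MvPolynomial (ι ⊕ ι) ℤ) : AnalyticOnNhd ℂ (fun s => expEval (x s) P) U := fun s hs =>
  ((contDiff_expEval P (m := ⊤)).contDiffAt.analyticAt (x := x s)).comp (hx s hs)

variable [DecidableEq ι]

/-- The numerator of the derivative of `P` along the `φ`-th coordinate curve of the system `Q`. -/
noncomputable def expCurveDeriv (Q : ι → MvPolynomial (ι ⊕ ι) ℤ) (φ : ι)
    (P : MvPolynomial (ι ⊕ ι) ℤ) : MvPolynomial (ι ⊕ ι) ℤ :=
  ∑ i, expPderiv i P * (expJacobian Q).adjugate i φ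

lemma det_mul_deriv_expEval (Q : ι → MvPolynomial (ι ⊕ ι) ℤ) {x : ℂ → ι → ℂ} {s : ℂ}
    (hx : DifferentiableAt ℂ x s) (w c : ι → ℂ)
    (hc : ∀ᶠ s in 𝓝 s, ∀ k, expEval (x s) (Q k) = c k + s * w k) (P : MvPolynomial (ι ⊕ ι) ℤ) :
    expEval (x s) (expJacobian Q).det * deriv (fun s => expEval (x s) P) s =
      ∑ φ, w φ * expEval (x s) (expCurveDeriv Q φ P) := by
  let v := deriv x s
  have hder : ∀ P, HasDerivAt (fun s => expEval (x s) P)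
      (∑ i, expEval (x s) (expPderiv i P) * v i) s := fun P => by
    refine ((hasFDerivAt_expEval P (x s)).comp_hasDerivAt s hx.hasDerivAt).congr_deriv ?_
    simp [v]
  let M : Matrix ι ι ℂ := (expJacobian Q).map (expEval (x s))
  have hM : M.mulVec v = w := funext fun k => by
    have h1 : HasDerivAt (fun s => expEval (x s) (Q k)) (w k) s := by
      have : HasDerivAt (fun s => c k + s * w k) (w k) s := by
        simpa using ((hasDerivAt_id s).mul_const (w k)).const_add (c k)
      exact this.congr_of_eventuallyEq (hc.mono fun s h => h k)
    exact (hder (Q k)).unique h1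
  have hdet : M.det = expEval (x s) (expJacobian Q).det :=
    ((expEval (x s)).map_det (expJacobian Q)).symm
  have hadj : M.adjugate = (expJacobian Q).adjugate.map (expEval (x s)) :=
    ((expEval (x s)).map_adjugate (expJacobian Q)).symm
  have h2 : M.adjugate.mulVec w = M.det • v := by
    rw [← hM, Matrix.mulVec_mulVec, Matrix.adjugate_mul, Matrix.smul_mulVec, Matrix.one_mulVec]
  rw [(hder P).deriv, ← hdet]
  have h3 : ∀ i, M.det * v i = ∑ φ, expEval (x s) ((expJacobian Q).adjugate i φ) * w φ := by
    intro i
    have := congrFun h2 i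
    rw [hadj] at this
    exact this.symm
  simp only [expCurveDeriv, map_sum, map_mul, Finset.mul_sum]
  rw [Finset.sum_comm]
  refine Finset.sum_congr rfl fun i _ => ?_
  rw [mul_left_comm, h3, Finset.mul_sum]
  exact Finset.sum_congr rfl fun φ _ => by ring

/-- If the ideal of relations of `p` is stable under the derivations along the curves `w`, then it
vanishes along these curves. -/
lemma expEval_eq_of_curve (p : ι → ℂ) (Q : ι → MvPolynomial (ι ⊕ ι) ℤ) (B : Set ι)
    (hI : ∀ P, expEval p P = 0 → ∀ φ ∉ B, expEval p (expCurveDeriv Q φ P) = 0)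
    (P₀ : MvPolynomial (ι ⊕ ι) ℤ) (hP₀ : ∀ φ ∉ B, expEval p (expCurveDeriv Q φ P₀) = 0)
    {U : Set ℂ} (hU : IsOpen U) (hUc : IsPreconnected U) (h0 : (0 : ℂ) ∈ U) {x : ℂ → ι → ℂ}
    (hx : AnalyticOnNhd ℂ x U) (hx0 : x 0 = p) (w : ι → ℂ) (hw : ∀ k ∈ B, w k = 0)
    (hc : ∀ s ∈ U, ∀ k, expEval (x s) (Q k) = expEval p (Q k) + s * w k)
    (hdet : ∀ s ∈ U, expEval (x s) (expJacobian Q).det ≠ 0) {s : ℂ} (hs : s ∈ U) :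
    expEval (x s) P₀ = expEval p P₀ := by
  have hrel : ∀ P, ∀ s ∈ U, expEval (x s) (expJacobian Q).det *
      deriv (fun s => expEval (x s) P) s = ∑ φ, w φ * expEval (x s) (expCurveDeriv Q φ P) :=
    fun P s hs => det_mul_deriv_expEval Q (hx s hs).differentiableAt w (fun k => expEval p (Q k))
      (Filter.eventually_of_mem (hU.mem_nhds hs) hc) P
  have hord : ∀ m : ℕ, ∀ P, expEval p P = 0 →
      (m : ℕ∞) ≤ analyticOrderAt (fun s => expEval (x s) P) 0 := by
    intro m
    induction m with
    | zero => simp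
    | succ m ih =>
      intro P hP
      have hA := hx.expEval_comp P 0 h0
      rw [Nat.cast_add_one, ← analyticOrderAt_deriv_ge_iff hA (by rwa [hx0])]
      have h1 : analyticOrderAt (fun s => expEval (x s) (expJacobian Q).det *
          deriv (fun s => expEval (x s) P) s) 0 =
          analyticOrderAt (deriv (fun s => expEval (x s) P)) 0 := by
        have := analyticOrderAt_mul (hx.expEval_comp (expJacobian Q).det 0 h0) hA.deriv
        have hd : analyticOrderAt (fun s => expEval (x s) (expJacobian Q).det) 0 = 0 :=
          analyticOrderAt_eq_zero.2 (Or.inr (hdet 0 h0))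
        rw [hd, zero_add] at this
        exact this
      rw [← h1, analyticOrderAt_congr (Filter.eventually_of_mem (hU.mem_nhds h0) (hrel P))]
      have hsum : ∀ S : Finset ι, (m : ℕ∞) ≤ analyticOrderAt
          (∑ φ ∈ S, fun s => w φ * expEval (x s) (expCurveDeriv Q φ P)) 0 := by
        intro S
        induction S using Finset.induction_on with
        | empty =>
          have : analyticOrderAt (0 : ℂ → ℂ) 0 = ⊤ := analyticOrderAt_eq_top.2 (by simp)
          simp [this]
        | insert φ S hφ ihS =>
          rw [Finset.sum_insert hφ]
          refine le_trans (le_min ?_ ihS) le_analyticOrderAt_add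
          by_cases hB : φ ∈ B
          · have : analyticOrderAt (fun s => w φ * expEval (x s) (expCurveDeriv Q φ P)) 0 = ⊤ :=
              analyticOrderAt_eq_top.2 (by simp [hw φ hB])
            simp [this]
          · have := analyticOrderAt_mul (analyticAt_const (v := w φ) (x := (0 : ℂ)) (𝕜 := ℂ))
              (hx.expEval_comp (expCurveDeriv Q φ P) 0 h0)
            refine le_trans (le_trans (ih _ (hI P hP φ hB)) ?_) this.ge
            exact le_add_self
      convert! hsum Finset.univ using 2
      ext s
      simp
  have hzero : ∀ P, expEval p P = 0 → ∀ s ∈ U, expEval (x s) P = 0 := fun P hP =>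
    (hx.expEval_comp P).eqOn_zero_of_preconnected_of_eventuallyEq_zero hUc h0
      (analyticOrderAt_eq_top.1 (ENat.eq_top_iff_forall_ge.2 fun m => hord m P hP))
  have hder : U.EqOn (deriv fun s => expEval (x s) P₀) 0 := fun s hs => by
    have h1 := hrel P₀ s hs
    rw [Finset.sum_eq_zero fun φ _ => ?_] at h1
    · exact (mul_eq_zero.1 h1).resolve_left (hdet s hs)
    · by_cases hB : φ ∈ B
      · simp [hw φ hB]
      · simp [hzero _ (hP₀ φ hB) s hs]
  have := hU.is_const_of_deriv_eq_zero hUc (hx.expEval_comp P₀).differentiableOn hder hs h0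
  rwa [hx0] at this

/-- In the situation of `expEval_eq_of_curve`, the values of the coordinates outside `B` can be
prescribed freely near `p`. -/
lemma exists_pos_forall_exists_expEval_eq (p : ι → ℂ) (Q : ι → MvPolynomial (ι ⊕ ι) ℤ) (B : Set ι)
    (hdet : expEval p (expJacobian Q).det ≠ 0)
    (hI : ∀ P, expEval p P = 0 → ∀ φ ∉ B, expEval p (expCurveDeriv Q φ P) = 0)
    (P₀ : MvPolynomial (ι ⊕ ι) ℤ) (hP₀ : ∀ φ ∉ B, expEval p (expCurveDeriv Q φ P₀) = 0) :
    ∃ ε > 0, ∀ w : ι → ℂ, (∀ k ∈ B, w k = 0) → ‖w‖ < ε → ∃ x : ι → ℂ,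
      (∀ k, expEval x (Q k) = expEval p (Q k) + w k) ∧ expEval x (expJacobian Q).det ≠ 0 ∧
      expEval x P₀ = expEval p P₀ := by
  let Φ : (ι → ℂ) → ι → ℂ := fun x k => expEval x (Q k)
  have hΦ : ContDiffAt ℂ ⊤ Φ p := contDiffAt_pi.2 fun k => (contDiff_expEval (Q k)).contDiffAt
  let M : Matrix ι ι ℂ := (expJacobian Q).map (expEval p)
  have hM : M.det = expEval p (expJacobian Q).det :=
    ((expEval p).map_det (expJacobian Q)).symm
  let f : (ι → ℂ) →L[ℂ] ι → ℂ := (Matrix.toLin' M).toContinuousLinearMap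
  have hf : f.det ≠ 0 := by
    have : f.det = M.det := LinearMap.det_toLin' M
    rwa [this, hM]
  have hΦ' : HasFDerivAt Φ (f.toContinuousLinearEquivOfDetNeZero hf : (ι → ℂ) →L[ℂ] ι → ℂ) p := by
    rw [ContinuousLinearMap.coe_toContinuousLinearEquivOfDetNeZero, hasFDerivAt_pi']
    intro k
    refine (hasFDerivAt_expEval (Q k) p).congr_fderiv ?_
    ext v
    simp [f, M, expJacobian, Matrix.mulVec, dotProduct]
  let Ψ := hΦ.localInverse hΦ' (by simp)
  have hΨ : ContDiffAt ℂ ⊤ Ψ (Φ p) := hΦ.to_localInverse hΦ' (by simp)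
  have hΨp : Ψ (Φ p) = p := hΦ.localInverse_apply_image hΦ' (by simp)
  have h1 : ∀ᶠ y in 𝓝 (Φ p), AnalyticAt ℂ Ψ y := hΨ.analyticAt.eventually_analyticAt
  have h2 : ∀ᶠ y in 𝓝 (Φ p), Φ (Ψ y) = y :=
    (hΦ.hasStrictFDerivAt' hΦ' (by simp)).eventually_right_inverse
  have h3 : ∀ᶠ y in 𝓝 (Φ p), expEval (Ψ y) (expJacobian Q).det ≠ 0 := by
    have hcont : ContinuousAt (fun y => expEval (Ψ y) (expJacobian Q).det) (Φ p) :=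
      ContinuousAt.comp (f := Ψ)
        (contDiff_expEval (expJacobian Q).det (m := ⊤)).continuous.continuousAt
        hΨ.continuousAt
    exact hcont.eventually_ne (by rwa [hΨp])
  obtain ⟨ε, hε, hball⟩ := Metric.eventually_nhds_iff_ball.1 (h1.and (h2.and h3))
  refine ⟨ε, hε, fun w hw hwε => ?_⟩
  let ℓ : ℂ → ι → ℂ := fun s => Φ p + s • w
  have hℓ : AnalyticOnNhd ℂ ℓ Set.univ := fun s _ =>
    analyticAt_const.add (analyticAt_id.smul analyticAt_const)
  let U := ℓ ⁻¹' Metric.ball (Φ p) ε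
  have hU : IsOpen U := Metric.isOpen_ball.preimage (hℓ.continuous)
  have hUconv : Convex ℝ U := by
    have : U = (LinearMap.toSpanSingleton ℂ (ι → ℂ) w).restrictScalars ℝ ⁻¹' Metric.ball 0 ε := by
      ext s
      simp [U, ℓ, norm_smul]
    exact this ▸ (convex_ball 0 ε).linear_preimage _
  have hU0 : (0 : ℂ) ∈ U := by simpa [U, ℓ] using hε
  have hU1 : (1 : ℂ) ∈ U := by simpa [U, ℓ] using hwε
  have hx : AnalyticOnNhd ℂ (Ψ ∘ ℓ) U := fun s hs => (hball _ hs).1.comp (hℓ s trivial)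
  have hval : ∀ s ∈ U, ∀ k, expEval ((Ψ ∘ ℓ) s) (Q k) = expEval p (Q k) + s * w k :=
    fun s hs k => congrFun (hball _ hs).2.1 k
  refine ⟨(Ψ ∘ ℓ) 1, fun k => by simpa using hval 1 hU1 k, (hball _ hU1).2.2, ?_⟩
  exact expEval_eq_of_curve p Q B hI P₀ hP₀ hU hUconv.isPreconnected hU0 hx
    (by simpa [ℓ] using hΨp) w hw hval (fun s hs => (hball _ hs).2.2) hU1

end Curve

section ExpAlgebraic

open MvPolynomial

/-- A basis of `ι → K` that extends a basis of the span of `T` consisting of elements of `T` by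
standard unit vectors. -/
lemma exists_linearIndependent_extending_by_single {ι K : Type*} [Fintype ι] [DecidableEq ι]
    [Field K] (T : Set (ι → K)) : ∃ (b : ι → ι → K) (B : Set ι), LinearIndependent K b ∧
      (∀ k ∈ B, b k ∈ T) ∧ (∀ k ∉ B, ∃ j, b k = Pi.single j 1) ∧
      T ⊆ Submodule.span K (b '' B) := by
  obtain ⟨s, hsT, hTs, hs⟩ := exists_linearIndependent K T
  have hs' : LinearIndepOn K id s := hs
  let E : Set (ι → K) := Set.range fun j => Pi.single j 1
  obtain ⟨t, htsub, hst, htspan, ht⟩ := exists_linearIndepOn_id_extension hs'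
    (Set.subset_union_left (t := E))
  have htop : Submodule.span K t = ⊤ := by
    rw [eq_top_iff, ← (Pi.basisFun K ι).span_eq, Submodule.span_le]
    rintro _ ⟨j, rfl⟩
    exact htspan (Or.inr ⟨j, by simp⟩)
  let bt : Module.Basis t K (ι → K) := .mk ht (by simp [htop])
  let e : ι ≃ t := (Pi.basisFun K ι).indexEquiv bt
  refine ⟨fun k => e k, {k | (e k : ι → K) ∈ s}, ?_, fun k hk => hsT hk, fun k hk => ?_, ?_⟩
  · exact LinearIndependent.comp ht e e.injective
  · obtain ⟨j, hj⟩ := (htsub (e k).2).resolve_left hk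
    exact ⟨j, hj.symm⟩
  · have : (fun k => (e k : ι → K)) '' {k | (e k : ι → K) ∈ s} = s := by
      ext v
      constructor
      · rintro ⟨k, hk, rfl⟩
        exact hk
      · exact fun hv => ⟨e.symm ⟨v, hst hv⟩, by simpa using hv, by simp⟩
    rw [this, hTs]
    exact Submodule.subset_span

/-- The gradient at `p` of an exponential polynomial. -/
noncomputable def expGradient {ι : Type*} [Fintype ι] (p : ι → ℂ) (P : MvPolynomial (ι ⊕ ι) ℤ) :
    ι → ℂ :=
  fun i => expEval p (expPderiv i P)

lemma expEval_expCurveDeriv_eq_zero {ι : Type*} [Fintype ι] [DecidableEq ι] {p : ι → ℂ}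
    {Q : ι → MvPolynomial (ι ⊕ ι) ℤ} {B : Set ι} {P : MvPolynomial (ι ⊕ ι) ℤ}
    (hP : expGradient p P ∈ Submodule.span ℂ ((fun k => expGradient p (Q k)) '' B)) {φ : ι}
    (hφ : φ ∉ B) : expEval p (expCurveDeriv Q φ P) = 0 := by
  let M : Matrix ι ι ℂ := (expJacobian Q).map (expEval p)
  have hadj : M.adjugate = (expJacobian Q).adjugate.map (expEval p) :=
    ((expEval p).map_adjugate (expJacobian Q)).symm
  have key : ∀ u ∈ Submodule.span ℂ ((fun k => expGradient p (Q k)) '' B),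
      ∑ i, u i * M.adjugate i φ = 0 := fun u hu => by
    induction hu using Submodule.span_induction with
    | mem _ h =>
      obtain ⟨k, hk, rfl⟩ := h
      have := congrFun (congrFun (Matrix.mul_adjugate M) k) φ
      rw [Matrix.mul_apply, Matrix.smul_apply,
        Matrix.one_apply_ne (fun h : k = φ => hφ (h ▸ hk)), smul_zero] at this
      exact this
    | zero => simp
    | add _ _ _ _ h1 h2 => simp [add_mul, Finset.sum_add_distrib, h1, h2]
    | smul c _ _ h => simp [mul_assoc, ← Finset.mul_sum, h]
  have := key _ hP
  rw [hadj] at this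
  simpa [expCurveDeriv, expGradient] using this

lemma expGradient_X_inl {ι : Type*} [Fintype ι] [DecidableEq ι] (p : ι → ℂ) (j : ι) :
    expGradient p (X (Sum.inl j)) = Pi.single j 1 := by
  ext i
  by_cases h : i = j
  · subst h; simp [expGradient]
  · simp [expGradient, h, Ne.symm h]

lemma det_expJacobian_eq {ι : Type*} [Fintype ι] [DecidableEq ι] (p : ι → ℂ)
    (Q : ι → MvPolynomial (ι ⊕ ι) ℤ) :
    expEval p (expJacobian Q).det = (Matrix.of fun k => expGradient p (Q k)).det :=
  (expEval p).map_det (expJacobian Q)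

/-- A complex number is exponentially algebraic once a point above it is a nonsingular zero of a
system given by formal exponential polynomials. -/
lemma expAlgebraic_of_expEval {n : ℕ} (hn : 0 < n) (x : Fin n → ℂ)
    (S : Fin n → MvPolynomial (Fin n ⊕ Fin n) ℤ) (hS : ∀ k, expEval x (S k) = 0)
    (hdet : (Matrix.of fun k => expGradient x (S k)).det ≠ 0) : ExpAlgebraic (x ⟨0, hn⟩) := by
  refine ⟨n, hn, x, fun k x => expEval x (S k), rfl, fun k => isExpPoly_expEval _, hS, ?_⟩
  convert! hdet using 2
  ext k j
  rw [Matrix.of_apply, (hasFDerivAt_expEval (S k) x).fderiv]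
  simp [expGradient, Pi.single_apply]

/-- Every complex number can be moved by an arbitrarily small amount to a nonreal point of
`ℚ(i)`. -/
lemma exists_norm_lt_add_eq_rat (z : ℂ) {ε : ℝ} (hε : 0 < ε) : ∃ (w : ℂ) (q c : ℚ), ‖w‖ < ε ∧
    c ≠ 0 ∧ z + w = q + c * Complex.I := by
  obtain ⟨q, hq1, hq2⟩ := exists_rat_btwn (show z.re < z.re + ε / 2 by linarith)
  obtain ⟨c, hc0, hc⟩ : ∃ c : ℚ, c ≠ 0 ∧ |(c : ℝ) - z.im| < ε / 2 := by
    rcases le_or_gt 0 z.im with h | h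
    · obtain ⟨c, h1, h2⟩ := exists_rat_btwn (show z.im < z.im + ε / 2 by linarith)
      refine ⟨c, fun h0 => ?_, by rw [abs_lt]; constructor <;> linarith⟩
      simp [h0] at h1
      linarith
    · obtain ⟨c, h1, h2⟩ := exists_rat_btwn (show z.im - ε / 2 < z.im by linarith)
      refine ⟨c, fun h0 => ?_, by rw [abs_lt]; constructor <;> linarith⟩
      simp [h0] at h2
      linarith
  refine ⟨q + c * Complex.I - z, q, c, ?_, hc0, by ring⟩
  refine (Complex.norm_le_abs_re_add_abs_im _).trans_lt ?_
  have h1 : |(q : ℝ) - z.re| < ε / 2 := by rw [abs_lt]; constructor <;> linarith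
  simp
  linarith

/-- An exponential polynomial vanishing at a given point of `ℚ(i)` with nonzero imaginary part. -/
noncomputable def ratMinpoly {ι : Type*} (q c : ℚ) (j : ι) : MvPolynomial (ι ⊕ ι) ℤ :=
  (C ((q.den : ℤ) * c.den) * X (Sum.inl j) - C (q.num * c.den)) ^ 2 + C ((c.num * q.den) ^ 2)

lemma expEval_ratMinpoly {ι : Type*} [Fintype ι] {x : ι → ℂ} {q c : ℚ} {j : ι}
    (h : x j = q + c * Complex.I) : expEval x (ratMinpoly q c j) = 0 := by
  have hq : (q.den : ℂ) * q = q.num := by exact_mod_cast Rat.den_mul_eq_num q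
  have hc : (c.den : ℂ) * c = c.num := by exact_mod_cast Rat.den_mul_eq_num c
  have : expEval x (ratMinpoly q c j) = (q.den * c.den * x j - q.num * c.den) ^ 2 +
      (c.num * q.den) ^ 2 := by
    simp [ratMinpoly]
  rw [this, h, ← hq, ← hc]
  linear_combination (q.den * c.den * c : ℂ) ^ 2 * Complex.I_sq

lemma exists_expGradient_ratMinpoly {ι : Type*} [Fintype ι] [DecidableEq ι] {x : ι → ℂ} {q c : ℚ}
    {j : ι} (h : x j = q + c * Complex.I) (hc : c ≠ 0) :
    ∃ d : ℂ, d ≠ 0 ∧ expGradient x (ratMinpoly q c j) = d • Pi.single j 1 := by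
  have hq : (q.den : ℂ) * q = q.num := by exact_mod_cast Rat.den_mul_eq_num q
  refine ⟨2 * (q.den * c.den) ^ 2 * c * Complex.I, by simp [hc], ?_⟩
  rw [← expGradient_X_inl x j]
  ext i
  by_cases hij : j = i
  · simp [ratMinpoly, expGradient, Derivation.leibniz_pow, hij ▸ h, hij]
    rw [← hq, show expEval x 2 = 2 from map_ofNat _ 2]
    ring
  · simp [ratMinpoly, expGradient, Derivation.leibniz_pow, hij]

/-- A number that is not exponentially algebraic is moved by a derivation of `ℂ` that is compatible
with the exponentials of any further given numbers. -/
theorem exists_exp_derivation_of_not_expAlgebraic {n : ℕ} (hn : 0 < n) (p : Fin n → ℂ)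
    (hp : ¬ ExpAlgebraic (p ⟨0, hn⟩)) : ∃ D : Derivation ℤ ℂ ℂ, D (p ⟨0, hn⟩) ≠ 0 ∧
      ∀ i, D (Complex.exp (p i)) = Complex.exp (p i) * D (p i) := by
  let T : Set (Fin n → ℂ) := expGradient p '' {P | expEval p P = 0}
  by_cases hmem : Pi.single (⟨0, hn⟩ : Fin n) (1 : ℂ) ∈ Submodule.span ℂ T
  · refine (hp ?_).elim
    obtain ⟨b, B, hb, hbT, hbE, hTB⟩ := exists_linearIndependent_extending_by_single T
    have hQ : ∀ k, ∃ P, expGradient p P = b k ∧ (k ∈ B → expEval p P = 0) ∧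
        (k ∉ B → ∃ j, P = X (Sum.inl j)) := fun k => by
      by_cases hk : k ∈ B
      · obtain ⟨P, hP, hPb⟩ := hbT k hk
        exact ⟨P, hPb, fun _ => hP, fun h => (h hk).elim⟩
      · obtain ⟨j, hj⟩ := hbE k hk
        exact ⟨X (Sum.inl j), by rw [expGradient_X_inl, hj], fun h => (hk h).elim,
          fun _ => ⟨j, rfl⟩⟩
    choose Q hQb hQB hQE using hQ
    obtain rfl : b = fun k => expGradient p (Q k) := funext fun k => (hQb k).symm
    have hspan : Submodule.span ℂ T ≤ Submodule.span ℂ ((fun k => expGradient p (Q k)) '' B) :=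
      Submodule.span_le.2 hTB
    have hdet : expEval p (expJacobian Q).det ≠ 0 := by
      rw [det_expJacobian_eq]
      exact ((Matrix.isUnit_iff_isUnit_det _).1
        (Matrix.linearIndependent_rows_iff_isUnit.1 hb)).ne_zero
    obtain ⟨ε, hε, h⟩ := exists_pos_forall_exists_expEval_eq p Q B hdet
      (fun P hP φ hφ =>
        expEval_expCurveDeriv_eq_zero (hspan (Submodule.subset_span ⟨P, hP, rfl⟩)) hφ)
      (X (Sum.inl ⟨0, hn⟩))
      (fun φ hφ => expEval_expCurveDeriv_eq_zero (by rw [expGradient_X_inl]; exact hspan hmem) hφ)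
    choose w₀ q c hw₀ hc hqc using fun k => exists_norm_lt_add_eq_rat (expEval p (Q k)) hε
    classical
    let w : Fin n → ℂ := fun k => if k ∈ B then 0 else w₀ k
    obtain ⟨x, hx, hxdet, hx0⟩ := h w (fun k hk => by simp [w, hk]) (by
      rw [pi_norm_lt_iff hε]
      intro k
      by_cases hk : k ∈ B <;> simp [w, hk, hε, hw₀])
    have hS : ∀ k, ∃ (P : MvPolynomial (Fin n ⊕ Fin n) ℤ) (d : ℂ), d ≠ 0 ∧ expEval x P = 0 ∧
        expGradient x P = d • expGradient x (Q k) := fun k => by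
      by_cases hk : k ∈ B
      · exact ⟨Q k, 1, one_ne_zero, by rw [hx, hQB k hk]; simp [w, hk], by simp⟩
      · obtain ⟨j, hj⟩ := hQE k hk
        have hxj : x j = q k + c k * Complex.I := by
          rw [← hqc, ← expEval_X_inl x j, ← hj, hx]
          simp [w, hk]
        obtain ⟨d, hd, hgrad⟩ := exists_expGradient_ratMinpoly hxj (hc k)
        exact ⟨_, d, hd, expEval_ratMinpoly hxj, by rw [hgrad, hj, expGradient_X_inl]⟩
    choose S d hd hSx hSd using hS
    have hx0' : x ⟨0, hn⟩ = p ⟨0, hn⟩ := by simpa using hx0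
    rw [← hx0']
    refine expAlgebraic_of_expEval hn x S hSx ?_
    have : (Matrix.of fun k => expGradient x (S k)) =
        Matrix.of fun k j => d k * (Matrix.of fun k => expGradient x (Q k)) k j := by
      ext k j
      simp [hSd]
    rw [this, Matrix.det_mul_column, ← det_expJacobian_eq]
    exact mul_ne_zero (Finset.prod_ne_zero_iff.2 fun k _ => hd k) hxdet
  · obtain ⟨ψ, hψ, hψT⟩ := Submodule.exists_dual_map_eq_bot_of_notMem hmem inferInstance
    have hv : ∀ u : Fin n → ℂ, ψ u = ∑ i, ψ (Pi.single i 1) * u i := fun u => by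
      conv_lhs => rw [pi_eq_sum_univ' u]
      simp [mul_comm]
    obtain ⟨D, hD⟩ := exists_derivation_of_forall_expPderiv p (fun i => ψ (Pi.single i 1))
      fun P hP => by
        have : ψ (expGradient p P) ∈ (Submodule.span ℂ T).map ψ :=
          ⟨_, Submodule.subset_span ⟨P, hP, rfl⟩, rfl⟩
        rw [hψT, Submodule.mem_bot, hv] at this
        exact this
    exact ⟨D, by rwa [(hD _).1], fun i => by rw [(hD i).2, (hD i).1]⟩

end ExpAlgebraic

/-- A number that is not exponentially algebraic is moved by a derivation of `ℂ` that is compatible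
with the exponentials of the elements of a given finite set. -/
lemma exists_exp_derivation_of_finite {γ : ℂ} (hγ : ¬ ExpAlgebraic γ) {s : Set ℂ}
    (hs : s.Finite) : ∃ D : Derivation ℤ ℂ ℂ, D γ ≠ 0 ∧
      ∀ z ∈ s, D (Complex.exp z) = Complex.exp z * D z := by
  have : Fintype s := hs.fintype
  let e := Fintype.equivFin s
  let p : Fin (Fintype.card s + 1) → ℂ := Fin.cons γ fun i => e.symm i
  obtain ⟨D, hD, hexp⟩ := exists_exp_derivation_of_not_expAlgebraic (Nat.succ_pos _) p hγ
  exact ⟨D, hD, fun z hz => by simpa [p] using hexp (e ⟨z, hz⟩).succ⟩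

/-- The field of constants of a derivation. -/
def Derivation.constants {R K : Type*} [CommRing R] [Field K] [Algebra R K]
    (D : Derivation R K K) : Subfield K where
  carrier := {x | D x = 0}
  mul_mem' hx hy := by
    simp only [Set.mem_ofPred_eq] at hx hy ⊢
    simp [hx, hy]
  one_mem' := D.map_one_eq_zero
  add_mem' hx hy := by
    simp only [Set.mem_ofPred_eq] at hx hy ⊢
    simp [hx, hy]
  zero_mem' := D.map_zero
  neg_mem' hx := by
    simp only [Set.mem_ofPred_eq] at hx ⊢
    simp [hx]
  inv_mem' x hx := by
    simp only [Set.mem_ofPred_eq] at hx ⊢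
    simp [D.leibniz_inv, hx]

/-- A derivation is linear over its field of constants. -/
def Derivation.overConstants {R K : Type*} [CommRing R] [Field K] [Algebra R K]
    (D : Derivation R K K) : Derivation D.constants K K :=
  .mk' { toFun := D
         map_add' := D.map_add
         map_smul' := fun c x => by
          have : D c = 0 := c.2
          simp [Subfield.smul_def, this] } D.leibniz

/-- A derivation that vanishes on the image of a transcendence basis vanishes on the image of the
field. -/
lemma Derivation.apply_eq_zero_of_isTranscendenceBasis {R L K σ : Type*} [CommRing R] [Field L]
    [CharZero L] [Field K] [CharZero K] [Algebra R K] (D : Derivation R K K) {x : σ → L}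
    (hx : IsTranscendenceBasis ℚ x) (φ : L →+* K) (h : ∀ i, D (φ (x i)) = 0) (y : L) :
    D (φ y) = 0 := by
  have hmem : ∀ a : Algebra.adjoin ℚ (Set.range x), φ a ∈ D.constants := by
    rintro ⟨a, ha⟩
    induction ha using Algebra.adjoin_induction with
    | mem _ h' =>
      obtain ⟨i, rfl⟩ := h'
      exact h i
    | algebraMap q => simp
    | add _ _ _ _ h1 h2 => simpa using add_mem h1 h2
    | mul _ _ _ _ h1 h2 => simpa using mul_mem h1 h2
  let f : Algebra.adjoin ℚ (Set.range x) →+* D.constants :=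
    (φ.comp (Algebra.adjoin ℚ (Set.range x)).val.toRingHom).codRestrict D.constants hmem
  have hf : Function.Injective f := fun a b hab =>
    Subtype.ext (φ.injective (congrArg Subtype.val hab))
  have halg : IsAlgebraic (Algebra.adjoin ℚ (Set.range x)) y := hx.isAlgebraic.isAlgebraic y
  exact D.overConstants.apply_eq_zero_of_isAlgebraic
    (halg.ringHom_of_comp_eq f φ hf (by ext; rfl))

lemma linearIndependent_log_of_prod_zpow {ι : Type*} [Fintype ι] {a : ι → ℝ} (h0 : ∀ i, a i ≠ 0)
    (hmi : ∀ m : ι → ℤ, (∏ i, a i ^ m i) = 1 → m = 0) :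
    LinearIndependent ℚ fun i => ((Real.log (a i) : ℝ) : ℂ) := by
  rw [← LinearIndependent.iff_fractionRing ℤ ℚ, Fintype.linearIndependent_iff]
  intro g hg i
  have hg' : ∑ i, g i * Real.log (a i) = 0 := by
    have : ((∑ i, g i * Real.log (a i) : ℝ) : ℂ) = 0 := by simpa using hg
    exact_mod_cast this
  have hlog : Real.log (∏ i, a i ^ (2 * g i)) = 0 := by
    rw [Real.log_prod fun i _ => zpow_ne_zero _ (h0 i)]
    simp only [Real.log_zpow]
    push_cast
    simp_rw [mul_assoc, ← Finset.mul_sum, hg', mul_zero]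
  have hpos : 0 < ∏ i, a i ^ (2 * g i) := Finset.prod_pos fun i _ => by
    rw [two_mul]
    exact (Even.zpow_pos ⟨g i, rfl⟩ (h0 i))
  have := congrFun (hmi _ (Real.eq_one_of_pos_of_log_eq_zero hpos hlog)) i
  simpa using this

lemma Derivation.apply_eq_zero_of_apply_sq_eq_zero {R K : Type*} [CommRing R] [Field K]
    [CharZero K] [Algebra R K] (D : Derivation R K K) {x : K} (h : D (x ^ 2) = 0) : D x = 0 := by
  rcases eq_or_ne x 0 with rfl | hx
  · simp
  · simpa [D.leibniz_pow, hx] using h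

/-- Modulus and argument of a power with exponent `1 + ir` of a real number. -/
lemma exists_ofReal_cpow_one_add_I_mul {a : ℝ} (ha : a ≠ 0) (r : ℝ) : ∃ ε : ℤ,
    let z : ℂ := (a : ℂ) ^ (1 + Complex.I * (r : ℂ))
    let t : ℂ := Complex.I * r
    let E := Complex.exp (Real.log a + t * (ε * (Real.pi * Complex.I)))
    let G := Complex.exp (t * Real.log a)
    z * (starRingEnd ℂ) z = E ^ 2 ∧ z = (starRingEnd ℂ) z * G ^ 2 := by
  obtain ⟨ε, hε⟩ : ∃ ε : ℤ, Complex.log a = Real.log a + ε * (Real.pi * Complex.I) := by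
    rcases ha.lt_or_gt with h | h
    · refine ⟨1, ?_⟩
      rw [Complex.log, Complex.arg_ofReal_of_neg h]
      simp
    · refine ⟨0, ?_⟩
      rw [← Complex.ofReal_log h.le]
      simp
  refine ⟨ε, ?_⟩
  have hz : (a : ℂ) ^ (1 + Complex.I * (r : ℂ)) =
      Complex.exp ((Real.log a + ε * (Real.pi * Complex.I)) * (1 + Complex.I * r)) := by
    rw [Complex.cpow_def_of_ne_zero (by exact_mod_cast ha), hε]
  have hzc : (starRingEnd ℂ) ((a : ℂ) ^ (1 + Complex.I * (r : ℂ))) =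
      Complex.exp ((Real.log a - ε * (Real.pi * Complex.I)) * (1 - Complex.I * r)) := by
    rw [hz, ← Complex.exp_conj]
    simp [Complex.conj_ofReal, sub_eq_add_neg]
  intro z t E G
  constructor
  · change _ * (starRingEnd ℂ) ((a : ℂ) ^ (1 + Complex.I * (r : ℂ))) = _
    rw [hzc]
    change (a : ℂ) ^ (1 + Complex.I * (r : ℂ)) * _ = _
    rw [hz, ← Complex.exp_add, ← Complex.exp_nat_mul]
    congr 1
    push_cast
    ring
  · change (a : ℂ) ^ (1 + Complex.I * (r : ℂ)) =
      (starRingEnd ℂ) ((a : ℂ) ^ (1 + Complex.I * (r : ℂ))) * _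
    rw [hzc, hz, ← Complex.exp_nat_mul, ← Complex.exp_add, Complex.exp_eq_exp_iff_exists_int]
    refine ⟨ε, ?_⟩
    push_cast
    ring

/-- **Wilkie's theorem on powers `1 + ir`.** If `r` is a real number not exponentially
algebraic in `ℂ_exp` and `a₁,…,aₙ` are nonzero multiplicatively independent reals,
then `2 · trdeg_ℚ(a₁^{1+ir},…,aₙ^{1+ir}) ≥ n`, with principal complex powers. -/
theorem wilkie_powers_one_add_ir
    (r : ℝ) (hr : ¬ ExpAlgebraic (r : ℂ)) (n : ℕ) (a : Fin n → ℝ)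
    (h0 : ∀ i, a i ≠ 0)
    (hmi : ∀ m : Fin n → ℤ, (∏ i, a i ^ m i) = 1 → m = 0) :
    (n : Cardinal) ≤ 2 * trdeg ℚ (IntermediateField.adjoin ℚ
      (Set.range fun i => (a i : ℂ) ^ (1 + Complex.I * (r : ℂ)))) := by
  let z : Fin n → ℂ := fun i => (a i : ℂ) ^ (1 + Complex.I * (r : ℂ))
  let L := IntermediateField.adjoin ℚ (Set.range z)
  let zL : Fin n → L := fun i => ⟨z i, IntermediateField.subset_adjoin _ _ ⟨i, rfl⟩⟩
  obtain ⟨S, hS⟩ := exists_isTranscendenceBasis ℚ L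
  have hcard : trdeg ℚ L = Cardinal.mk S := hS.cardinalMk_eq_trdeg.symm
  change (n : Cardinal) ≤ 2 * trdeg ℚ L
  rw [hcard]
  rcases finite_or_infinite S with hfin | hinf
  swap
  · calc (n : Cardinal) ≤ Cardinal.aleph0 := Cardinal.natCast_le_aleph0
      _ ≤ Cardinal.mk S := Cardinal.aleph0_le_mk S
      _ ≤ 2 * Cardinal.mk S := by simpa using mul_le_mul_left (one_le_two (α := Cardinal)) _
  have : Fintype S := Fintype.ofFinite S
  choose ε hε using fun i => exists_ofReal_cpow_one_add_I_mul (h0 i) r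
  let t : ℂ := Complex.I * r
  let y : Fin n → ℂ := fun i => Real.log (a i)
  let ϖ : ℂ := Real.pi * Complex.I
  obtain ⟨D, hDr, hexp⟩ := exists_exp_derivation_of_finite hr
    (s := insert ϖ (Set.range (fun i => y i + t * (ε i * ϖ)) ∪ Set.range fun i => t * y i))
    (Set.toFinite _)
  have hDϖ : D ϖ = 0 := by
    have := hexp ϖ (Set.mem_insert _ _)
    rw [show Complex.exp ϖ = -1 from Complex.exp_pi_mul_I] at this
    simpa using this
  have hDI : D Complex.I = 0 := D.apply_eq_zero_of_apply_sq_eq_zero (by simp)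
  have hDt : D t ≠ 0 := by simpa [t, hDI] using hDr
  let κ : Fin n → D.constants := fun i => ⟨ε i * ϖ, mul_mem (intCast_mem _ _) hDϖ⟩
  have key := card_le_card_of_derivation_exp (τ := S ⊕ S) D.overConstants
    (fun x hx => ⟨⟨x, hx⟩, rfl⟩) hDt y (linearIndependent_log_of_prod_zpow h0 hmi) κ
    (fun i => Complex.exp (y i + t * (ε i * ϖ))) (fun i => Complex.exp (t * y i))
    (fun _ => Complex.exp_ne_zero _) (fun _ => Complex.exp_ne_zero _)
    (fun i => hexp _ (Or.inr (Or.inl ⟨i, rfl⟩))) (fun i => hexp _ (Or.inr (Or.inr ⟨i, rfl⟩)))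
    (Sum.elim (fun s => (s : L)) fun s => (starRingEnd ℂ) (s : L)) (fun δ hδ i => by
      have h1 : δ (z i) = 0 := δ.apply_eq_zero_of_isTranscendenceBasis hS (algebraMap L ℂ)
        (fun s => hδ (Sum.inl s)) (zL i)
      have h2 : δ ((starRingEnd ℂ) (z i)) = 0 := δ.apply_eq_zero_of_isTranscendenceBasis hS
        ((starRingEnd ℂ).comp (algebraMap L ℂ)) (fun s => hδ (Sum.inr s)) (zL i)
      have hE := congrArg δ (hε i).1
      have hG := congrArg δ (hε i).2
      have hz : (starRingEnd ℂ) (z i) ≠ 0 := by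
        simp [z, h0 i, Complex.cpow_def_of_ne_zero]
      constructor
      · refine δ.apply_eq_zero_of_apply_sq_eq_zero (hE.symm.trans ?_)
        rw [δ.leibniz]
        change z i • δ ((starRingEnd ℂ) (z i)) + (starRingEnd ℂ) (z i) • δ (z i) = 0
        rw [h1, h2, smul_zero, smul_zero, add_zero]
      · refine δ.apply_eq_zero_of_apply_sq_eq_zero ?_
        rw [δ.leibniz] at hG
        change δ (z i) = (starRingEnd ℂ) (z i) • δ (Complex.exp (t * y i) ^ 2) +
          Complex.exp (t * y i) ^ 2 • δ ((starRingEnd ℂ) (z i)) at hG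
        rw [h1, h2, smul_zero, add_zero] at hG
        exact (mul_eq_zero.1 hG.symm).resolve_left hz)
  rw [Fintype.card_fin, Fintype.card_sum, ← two_mul] at key
  rw [Cardinal.mk_fintype]
  exact_mod_cast key
end
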